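/- Let 𝒪 be the triangulation 2_12_1_1 of the genus-5 surface and let ℳ = 𝒪 ∖ {{1,2,3}} be the complex obtained by removing the facet {1,2,3}. Then there is no acyclic uniform rank-4 chirotope on {1,…,12} that is admissible for ℳ. -/

import Mathlib

open Finset

def facets : Finset (Finset ℕ) :=
  {{1, 2, 3}, {1, 2, 12}, {1, 3, 6}, {1, 4, 8}, {1, 4, 11}, {1, 5, 9}, {1, 5, 10}, {1, 6, 9}, {1, 8, 10}, {1, 11, 12}, {2, 3, 4}, {2, 4, 7}, {2, 5, 9}, {2, 5, 12}, {2, 6, 10}, {2, 6, 11}, {2, 7, 10}, {2, 9, 11}, {3, 4, 5}, {3, 5, 8}, {3, 6, 10}, {3, 7, 11}, {3, 7, 12}, {3, 8, 11}, {3, 10, 12}, {4, 5, 6}, {4, 6, 9}, {4, 7, 11}, {4, 8, 12}, {4, 9, 12}, {5, 6, 7}, {5, 7, 10}, {5, 8, 12}, {6, 7, 8}, {6, 8, 11}, {7, 8, 9}, {7, 9, 12}, {8, 9, 10}, {9, 10, 11}, {10, 11, 12}}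

/-- The complex obtained by removing the facet 1, 2, 3. -/
def facetsM : Finset (Finset ℕ) := facets.erase {1, 2, 3}

/-- The sign `sᵢ = (-1)^i · χ(c₁,…,ĉᵢ,…,c₅)` of the `i`-th element of a circuit
supported on the 5-set enumerated in increasing order by `c`. -/
def circSign (χ : ℕ → ℕ → ℕ → ℕ → ℤ) (c : Fin 5 → ℕ) (i : Fin 5) : ℤ :=
  (-1 : ℤ) ^ ((i : ℕ) + 1) *
    χ (c (i.succAbove 0)) (c (i.succAbove 1)) (c (i.succAbove 2)) (c (i.succAbove 3))

/-- A uniform rank-4 chirotope on the ground set `E`: values ±1 on tuples of pairwise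
distinct elements, alternating (interchanging two arguments negates the value), and the
three-term Grassmann–Plücker relations. -/
def IsChirotope (E : Finset ℕ) (χ : ℕ → ℕ → ℕ → ℕ → ℤ) : Prop :=
  (∀ a ∈ E, ∀ b ∈ E, ∀ c ∈ E, ∀ d ∈ E,
      a ≠ b → a ≠ c → a ≠ d → b ≠ c → b ≠ d → c ≠ d →
      χ a b c d = 1 ∨ χ a b c d = -1) ∧
  (∀ a ∈ E, ∀ b ∈ E, ∀ c ∈ E, ∀ d ∈ E, χ b a c d = -χ a b c d) ∧
  (∀ a ∈ E, ∀ b ∈ E, ∀ c ∈ E, ∀ d ∈ E, χ a c b d = -χ a b c d) ∧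
  (∀ a ∈ E, ∀ b ∈ E, ∀ c ∈ E, ∀ d ∈ E, χ a b d c = -χ a b c d) ∧
  (∀ y₁ ∈ E, ∀ y₂ ∈ E, ∀ x₁ ∈ E, ∀ x₂ ∈ E, ∀ x₃ ∈ E, ∀ x₄ ∈ E,
      y₁ ≠ y₂ →
      x₁ ≠ x₂ → x₁ ≠ x₃ → x₁ ≠ x₄ → x₂ ≠ x₃ → x₂ ≠ x₄ → x₃ ≠ x₄ →
      x₁ ≠ y₁ → x₁ ≠ y₂ → x₂ ≠ y₁ → x₂ ≠ y₂ → x₃ ≠ y₁ → x₃ ≠ y₂ →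
      x₄ ≠ y₁ → x₄ ≠ y₂ →
      ({1, -1} : Set ℤ) ⊆
        ({χ y₁ y₂ x₁ x₂ * χ y₁ y₂ x₃ x₄, -(χ y₁ y₂ x₁ x₃ * χ y₁ y₂ x₂ x₄),
          χ y₁ y₂ x₁ x₄ * χ y₁ y₂ x₂ x₃} : Set ℤ))

/-- Acyclic: for every 5-element subset of `E` (enumerated in increasing order by the
strictly monotone `c`), the circuit signs `s₁,…,s₅` are not all equal, i.e. no circuit
is all-positive. -/
def IsAcyclic (E : Finset ℕ) (χ : ℕ → ℕ → ℕ → ℕ → ℤ) : Prop :=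
  ∀ c : Fin 5 → ℕ, StrictMono c → (∀ i, c i ∈ E) →
    ¬ (∀ i j : Fin 5, circSign χ c i = circSign χ c j)

/-- Admissible for the complex with facet list `K`: for every triangle `F ∈ K` and every
edge `G` of the complex with `F ∩ G = ∅`, no circuit on `F ∪ G` is positive exactly on
`F` and negative exactly on `G` (or vice versa). -/
def IsAdmissible (K : Finset (Finset ℕ)) (χ : ℕ → ℕ → ℕ → ℕ → ℤ) : Prop :=
  ∀ F ∈ K, ∀ G : Finset ℕ, G.card = 2 → (∃ T ∈ K, G ⊆ T) → F ∩ G = ∅ →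
    ∀ c : Fin 5 → ℕ, StrictMono c → Finset.image c Finset.univ = F ∪ G →
      ¬ ∃ ε : ℤ, (ε = 1 ∨ ε = -1) ∧
          (∀ i : Fin 5, c i ∈ F → circSign χ c i = ε) ∧
          (∀ i : Fin 5, c i ∈ G → circSign χ c i = -ε)

/-- Moves the lanes of the fields in `a` up and those in `b` down by `w` bits. -/
def moveUp (w a b x : ℕ) : ℕ :=
  Nat.lor (Nat.shiftLeft (Nat.land x a) w) (Nat.shiftRight (Nat.land x b) w)

def moveDown (w a b x : ℕ) : ℕ :=
  Nat.lor (Nat.land a (Nat.shiftRight x w)) (Nat.land b (Nat.shiftLeft x w))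

def reviseStage12 {α : Type} (f0 f1 f2 f4 f8 f16 f3 f5 f6 f9 f10 f12 f17 f18 f20 f24 f7 f11 f13
    f14 f19 f21 f22 f25 f26 f28 f15 f23 f27 f29 f30 t0 t1 t2 t3 t4 x7_3 x7_4 x11_2 x11_4 x13_1
    x13_4 x14_0 x14_4 x19_2 x19_3 x21_1 x21_3 x22_0 x22_3 x25_1 x25_2 x26_0 x26_2 x28_0 x28_1 x3_2
    x3_3 x3_4 x5_1 x5_3 x5_4 x6_0 x6_3 x6_4 x9_1 x9_2 x9_4 x10_0 x10_2 x10_4 x12_0 x12_1 x12_4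
    x17_1 x17_2 x17_3 x18_0 x18_2 x18_3 x20_0 x20_1 x20_3 x24_0 x24_1 x24_2 x1_1 x1_2 x1_3 x1_4
    x2_0 x2_2 x2_3 x2_4 x4_0 x4_1 x4_3 x4_4 x8_0 x8_1 x8_2 x8_4 x16_0 x16_1 x16_2 x16_3 x0_0 x0_1
    x0_2 x0_3 x0_4 : ℕ) (k : ℕ → ℕ → ℕ → ℕ → ℕ → ℕ → α) : α :=
  k (Nat.land f0 (Nat.lor x0_0 (Nat.lor x0_1 (Nat.lor x0_2 (Nat.lor x0_3 x0_4))))) (Nat.lor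
    (Nat.land f0 x0_0) (Nat.lor (Nat.land f2 x2_0) (Nat.lor (Nat.land f4 x4_0) (Nat.lor (Nat.land
    f6 x6_0) (Nat.lor (Nat.land f8 x8_0) (Nat.lor (Nat.land f10 x10_0) (Nat.lor (Nat.land f12
    x12_0) (Nat.lor (Nat.land f14 x14_0) (Nat.lor (Nat.land f16 x16_0) (Nat.lor (Nat.land f18
    x18_0) (Nat.lor (Nat.land f20 x20_0) (Nat.lor (Nat.land f22 x22_0) (Nat.lor (Nat.land f24
    x24_0) (Nat.lor (Nat.land f26 x26_0) (Nat.lor (Nat.land f28 x28_0) (Nat.land f30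
    t0)))))))))))))))) (Nat.lor (Nat.land f0 x0_1) (Nat.lor (Nat.land f1 x1_1) (Nat.lor (Nat.land
    f4 x4_1) (Nat.lor (Nat.land f5 x5_1) (Nat.lor (Nat.land f8 x8_1) (Nat.lor (Nat.land f9 x9_1)
    (Nat.lor (Nat.land f12 x12_1) (Nat.lor (Nat.land f13 x13_1) (Nat.lor (Nat.land f16 x16_1)
    (Nat.lor (Nat.land f17 x17_1) (Nat.lor (Nat.land f20 x20_1) (Nat.lor (Nat.land f21 x21_1)
    (Nat.lor (Nat.land f24 x24_1) (Nat.lor (Nat.land f25 x25_1) (Nat.lor (Nat.land f28 x28_1)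
    (Nat.land f29 t1)))))))))))))))) (Nat.lor (Nat.land f0 x0_2) (Nat.lor (Nat.land f1 x1_2)
    (Nat.lor (Nat.land f2 x2_2) (Nat.lor (Nat.land f3 x3_2) (Nat.lor (Nat.land f8 x8_2) (Nat.lor
    (Nat.land f9 x9_2) (Nat.lor (Nat.land f10 x10_2) (Nat.lor (Nat.land f11 x11_2) (Nat.lor
    (Nat.land f16 x16_2) (Nat.lor (Nat.land f17 x17_2) (Nat.lor (Nat.land f18 x18_2) (Nat.lor
    (Nat.land f19 x19_2) (Nat.lor (Nat.land f24 x24_2) (Nat.lor (Nat.land f25 x25_2) (Nat.lor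
    (Nat.land f26 x26_2) (Nat.land f27 t2)))))))))))))))) (Nat.lor (Nat.land f0 x0_3) (Nat.lor
    (Nat.land f1 x1_3) (Nat.lor (Nat.land f2 x2_3) (Nat.lor (Nat.land f3 x3_3) (Nat.lor (Nat.land
    f4 x4_3) (Nat.lor (Nat.land f5 x5_3) (Nat.lor (Nat.land f6 x6_3) (Nat.lor (Nat.land f7 x7_3)
    (Nat.lor (Nat.land f16 x16_3) (Nat.lor (Nat.land f17 x17_3) (Nat.lor (Nat.land f18 x18_3)
    (Nat.lor (Nat.land f19 x19_3) (Nat.lor (Nat.land f20 x20_3) (Nat.lor (Nat.land f21 x21_3)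
    (Nat.lor (Nat.land f22 x22_3) (Nat.land f23 t3)))))))))))))))) (Nat.lor (Nat.land f0 x0_4)
    (Nat.lor (Nat.land f1 x1_4) (Nat.lor (Nat.land f2 x2_4) (Nat.lor (Nat.land f3 x3_4) (Nat.lor
    (Nat.land f4 x4_4) (Nat.lor (Nat.land f5 x5_4) (Nat.lor (Nat.land f6 x6_4) (Nat.lor (Nat.land
    f7 x7_4) (Nat.lor (Nat.land f8 x8_4) (Nat.lor (Nat.land f9 x9_4) (Nat.lor (Nat.land f10 x10_4)
    (Nat.lor (Nat.land f11 x11_4) (Nat.lor (Nat.land f12 x12_4) (Nat.lor (Nat.land f13 x13_4)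
    (Nat.lor (Nat.land f14 x14_4) (Nat.land f15 t4))))))))))))))))

def reviseStage11 {α : Type} (w0 w1 w2 w3 w4 a0 a1 a2 a3 a4 b0 b1 b2 b3 b4 f0 f1 f2 f4 f8 f16 f3
    f5 f6 f9 f10 f12 f17 f18 f20 f24 f7 f11 f13 f14 f19 f21 f22 f25 f26 f28 f15 f23 f27 f29 f30 t0
    t1 t2 t3 t4 x7_3 x7_4 x11_2 x11_4 x13_1 x13_4 x14_0 x14_4 x19_2 x19_3 x21_1 x21_3 x22_0 x22_3
    x25_1 x25_2 x26_0 x26_2 x28_0 x28_1 x3_2 x3_3 x3_4 x5_1 x5_3 x5_4 x6_0 x6_3 x6_4 x9_1 x9_2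
    x9_4 x10_0 x10_2 x10_4 x12_0 x12_1 x12_4 x17_1 x17_2 x17_3 x18_0 x18_2 x18_3 x20_0 x20_1 x20_3
    x24_0 x24_1 x24_2 x1_1 x1_2 x1_3 x1_4 x2_0 x2_2 x2_3 x2_4 x4_0 x4_1 x4_3 x4_4 x8_0 x8_1 x8_2
    x8_4 x16_0 x16_1 x16_2 x16_3 g1 g2 g4 g8 g16 : ℕ) (k : ℕ → ℕ → ℕ → ℕ → ℕ → ℕ → α) : α :=
  reviseStage12 f0 f1 f2 f4 f8 f16 f3 f5 f6 f9 f10 f12 f17 f18 f20 f24 f7 f11 f13 f14 f19 f21 f22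
    f25 f26 f28 f15 f23 f27 f29 f30 t0 t1 t2 t3 t4 x7_3 x7_4 x11_2 x11_4 x13_1 x13_4 x14_0 x14_4
    x19_2 x19_3 x21_1 x21_3 x22_0 x22_3 x25_1 x25_2 x26_0 x26_2 x28_0 x28_1 x3_2 x3_3 x3_4 x5_1
    x5_3 x5_4 x6_0 x6_3 x6_4 x9_1 x9_2 x9_4 x10_0 x10_2 x10_4 x12_0 x12_1 x12_4 x17_1 x17_2 x17_3
    x18_0 x18_2 x18_3 x20_0 x20_1 x20_3 x24_0 x24_1 x24_2 x1_1 x1_2 x1_3 x1_4 x2_0 x2_2 x2_3 x2_4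
    x4_0 x4_1 x4_3 x4_4 x8_0 x8_1 x8_2 x8_4 x16_0 x16_1 x16_2 x16_3 (moveDown w0 a0 b0 g1)
    (moveDown w1 a1 b1 g2) (moveDown w2 a2 b2 g4) (moveDown w3 a3 b3 g8) (moveDown w4 a4 b4 g16) k

def reviseStage10 {α : Type} (w0 w1 w2 w3 w4 a0 a1 a2 a3 a4 b0 b1 b2 b3 b4 f0 f1 f2 f4 f8 f16 f3
    f5 f6 f9 f10 f12 f17 f18 f20 f24 f7 f11 f13 f14 f19 f21 f22 f25 f26 f28 f15 f23 f27 f29 f30 t0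
    t1 t2 t3 t4 x7_3 x7_4 x11_2 x11_4 x13_1 x13_4 x14_0 x14_4 x19_2 x19_3 x21_1 x21_3 x22_0 x22_3
    x25_1 x25_2 x26_0 x26_2 x28_0 x28_1 x3_2 x3_3 x3_4 x5_1 x5_3 x5_4 x6_0 x6_3 x6_4 x9_1 x9_2
    x9_4 x10_0 x10_2 x10_4 x12_0 x12_1 x12_4 x17_1 x17_2 x17_3 x18_0 x18_2 x18_3 x20_0 x20_1 x20_3
    x24_0 x24_1 x24_2 x1_1 x1_2 x1_3 x1_4 x2_0 x2_2 x2_3 x2_4 x4_0 x4_1 x4_3 x4_4 x8_0 x8_1 x8_2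
    x8_4 x16_0 x16_1 x16_2 x16_3 : ℕ) (k : ℕ → ℕ → ℕ → ℕ → ℕ → ℕ → α) : α :=
  reviseStage11 w0 w1 w2 w3 w4 a0 a1 a2 a3 a4 b0 b1 b2 b3 b4 f0 f1 f2 f4 f8 f16 f3 f5 f6 f9 f10
    f12 f17 f18 f20 f24 f7 f11 f13 f14 f19 f21 f22 f25 f26 f28 f15 f23 f27 f29 f30 t0 t1 t2 t3 t4
    x7_3 x7_4 x11_2 x11_4 x13_1 x13_4 x14_0 x14_4 x19_2 x19_3 x21_1 x21_3 x22_0 x22_3 x25_1 x25_2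
    x26_0 x26_2 x28_0 x28_1 x3_2 x3_3 x3_4 x5_1 x5_3 x5_4 x6_0 x6_3 x6_4 x9_1 x9_2 x9_4 x10_0
    x10_2 x10_4 x12_0 x12_1 x12_4 x17_1 x17_2 x17_3 x18_0 x18_2 x18_3 x20_0 x20_1 x20_3 x24_0
    x24_1 x24_2 x1_1 x1_2 x1_3 x1_4 x2_0 x2_2 x2_3 x2_4 x4_0 x4_1 x4_3 x4_4 x8_0 x8_1 x8_2 x8_4
    x16_0 x16_1 x16_2 x16_3 (Nat.lor x1_1 (Nat.lor x1_2 (Nat.lor x1_3 x1_4))) (Nat.lor x2_0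
    (Nat.lor x2_2 (Nat.lor x2_3 x2_4))) (Nat.lor x4_0 (Nat.lor x4_1 (Nat.lor x4_3 x4_4))) (Nat.lor
    x8_0 (Nat.lor x8_1 (Nat.lor x8_2 x8_4))) (Nat.lor x16_0 (Nat.lor x16_1 (Nat.lor x16_2 x16_3)))
    k

def reviseStage9 {α : Type} (w0 w1 w2 w3 w4 a0 a1 a2 a3 a4 b0 b1 b2 b3 b4 f0 f1 f2 f4 f8 f16 f3 f5
    f6 f9 f10 f12 f17 f18 f20 f24 f7 f11 f13 f14 f19 f21 f22 f25 f26 f28 f15 f23 f27 f29 f30 t0 t1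
    t2 t3 t4 x7_3 x7_4 x11_2 x11_4 x13_1 x13_4 x14_0 x14_4 x19_2 x19_3 x21_1 x21_3 x22_0 x22_3
    x25_1 x25_2 x26_0 x26_2 x28_0 x28_1 x3_2 x3_3 x3_4 x5_1 x5_3 x5_4 x6_0 x6_3 x6_4 x9_1 x9_2
    x9_4 x10_0 x10_2 x10_4 x12_0 x12_1 x12_4 x17_1 x17_2 x17_3 x18_0 x18_2 x18_3 x20_0 x20_1 x20_3
    x24_0 x24_1 x24_2 g3 g5 g6 g9 g10 g12 g17 g18 g20 g24 : ℕ) (k : ℕ → ℕ → ℕ → ℕ → ℕ → ℕ → α) : α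
    :=
  reviseStage10 w0 w1 w2 w3 w4 a0 a1 a2 a3 a4 b0 b1 b2 b3 b4 f0 f1 f2 f4 f8 f16 f3 f5 f6 f9 f10
    f12 f17 f18 f20 f24 f7 f11 f13 f14 f19 f21 f22 f25 f26 f28 f15 f23 f27 f29 f30 t0 t1 t2 t3 t4
    x7_3 x7_4 x11_2 x11_4 x13_1 x13_4 x14_0 x14_4 x19_2 x19_3 x21_1 x21_3 x22_0 x22_3 x25_1 x25_2
    x26_0 x26_2 x28_0 x28_1 x3_2 x3_3 x3_4 x5_1 x5_3 x5_4 x6_0 x6_3 x6_4 x9_1 x9_2 x9_4 x10_0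
    x10_2 x10_4 x12_0 x12_1 x12_4 x17_1 x17_2 x17_3 x18_0 x18_2 x18_3 x20_0 x20_1 x20_3 x24_0
    x24_1 x24_2 (moveDown w1 a1 b1 g3) (moveDown w2 a2 b2 g5) (moveDown w3 a3 b3 g9) (moveDown w4
    a4 b4 g17) (moveDown w0 a0 b0 g3) (moveDown w2 a2 b2 g6) (moveDown w3 a3 b3 g10) (moveDown w4
    a4 b4 g18) (moveDown w0 a0 b0 g5) (moveDown w1 a1 b1 g6) (moveDown w3 a3 b3 g12) (moveDown w4
    a4 b4 g20) (moveDown w0 a0 b0 g9) (moveDown w1 a1 b1 g10) (moveDown w2 a2 b2 g12) (moveDown w4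
    a4 b4 g24) (moveDown w0 a0 b0 g17) (moveDown w1 a1 b1 g18) (moveDown w2 a2 b2 g20) (moveDown
    w3 a3 b3 g24) k

def reviseStage8 {α : Type} (w0 w1 w2 w3 w4 a0 a1 a2 a3 a4 b0 b1 b2 b3 b4 f0 f1 f2 f4 f8 f16 f3 f5
    f6 f9 f10 f12 f17 f18 f20 f24 f7 f11 f13 f14 f19 f21 f22 f25 f26 f28 f15 f23 f27 f29 f30 t0 t1
    t2 t3 t4 x7_3 x7_4 x11_2 x11_4 x13_1 x13_4 x14_0 x14_4 x19_2 x19_3 x21_1 x21_3 x22_0 x22_3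
    x25_1 x25_2 x26_0 x26_2 x28_0 x28_1 x3_2 x3_3 x3_4 x5_1 x5_3 x5_4 x6_0 x6_3 x6_4 x9_1 x9_2
    x9_4 x10_0 x10_2 x10_4 x12_0 x12_1 x12_4 x17_1 x17_2 x17_3 x18_0 x18_2 x18_3 x20_0 x20_1 x20_3
    x24_0 x24_1 x24_2 : ℕ) (k : ℕ → ℕ → ℕ → ℕ → ℕ → ℕ → α) : α :=
  reviseStage9 w0 w1 w2 w3 w4 a0 a1 a2 a3 a4 b0 b1 b2 b3 b4 f0 f1 f2 f4 f8 f16 f3 f5 f6 f9 f10 f12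
    f17 f18 f20 f24 f7 f11 f13 f14 f19 f21 f22 f25 f26 f28 f15 f23 f27 f29 f30 t0 t1 t2 t3 t4 x7_3
    x7_4 x11_2 x11_4 x13_1 x13_4 x14_0 x14_4 x19_2 x19_3 x21_1 x21_3 x22_0 x22_3 x25_1 x25_2 x26_0
    x26_2 x28_0 x28_1 x3_2 x3_3 x3_4 x5_1 x5_3 x5_4 x6_0 x6_3 x6_4 x9_1 x9_2 x9_4 x10_0 x10_2
    x10_4 x12_0 x12_1 x12_4 x17_1 x17_2 x17_3 x18_0 x18_2 x18_3 x20_0 x20_1 x20_3 x24_0 x24_1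
    x24_2 (Nat.lor x3_2 (Nat.lor x3_3 x3_4)) (Nat.lor x5_1 (Nat.lor x5_3 x5_4)) (Nat.lor x6_0
    (Nat.lor x6_3 x6_4)) (Nat.lor x9_1 (Nat.lor x9_2 x9_4)) (Nat.lor x10_0 (Nat.lor x10_2 x10_4))
    (Nat.lor x12_0 (Nat.lor x12_1 x12_4)) (Nat.lor x17_1 (Nat.lor x17_2 x17_3)) (Nat.lor x18_0
    (Nat.lor x18_2 x18_3)) (Nat.lor x20_0 (Nat.lor x20_1 x20_3)) (Nat.lor x24_0 (Nat.lor x24_1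
    x24_2)) k

def reviseStage7 {α : Type} (w0 w1 w2 w3 w4 a0 a1 a2 a3 a4 b0 b1 b2 b3 b4 f0 f1 f2 f4 f8 f16 f3 f5
    f6 f9 f10 f12 f17 f18 f20 f24 f7 f11 f13 f14 f19 f21 f22 f25 f26 f28 f15 f23 f27 f29 f30 t0 t1
    t2 t3 t4 x7_3 x7_4 x11_2 x11_4 x13_1 x13_4 x14_0 x14_4 x19_2 x19_3 x21_1 x21_3 x22_0 x22_3
    x25_1 x25_2 x26_0 x26_2 x28_0 x28_1 g7 g11 g13 g14 g19 g21 g22 g25 g26 g28 : ℕ) (k : ℕ → ℕ → ℕ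
    → ℕ → ℕ → ℕ → α) : α :=
  reviseStage8 w0 w1 w2 w3 w4 a0 a1 a2 a3 a4 b0 b1 b2 b3 b4 f0 f1 f2 f4 f8 f16 f3 f5 f6 f9 f10 f12
    f17 f18 f20 f24 f7 f11 f13 f14 f19 f21 f22 f25 f26 f28 f15 f23 f27 f29 f30 t0 t1 t2 t3 t4 x7_3
    x7_4 x11_2 x11_4 x13_1 x13_4 x14_0 x14_4 x19_2 x19_3 x21_1 x21_3 x22_0 x22_3 x25_1 x25_2 x26_0
    x26_2 x28_0 x28_1 (moveDown w2 a2 b2 g7) (moveDown w3 a3 b3 g11) (moveDown w4 a4 b4 g19)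
    (moveDown w1 a1 b1 g7) (moveDown w3 a3 b3 g13) (moveDown w4 a4 b4 g21) (moveDown w0 a0 b0 g7)
    (moveDown w3 a3 b3 g14) (moveDown w4 a4 b4 g22) (moveDown w1 a1 b1 g11) (moveDown w2 a2 b2
    g13) (moveDown w4 a4 b4 g25) (moveDown w0 a0 b0 g11) (moveDown w2 a2 b2 g14) (moveDown w4 a4
    b4 g26) (moveDown w0 a0 b0 g13) (moveDown w1 a1 b1 g14) (moveDown w4 a4 b4 g28) (moveDown w1
    a1 b1 g19) (moveDown w2 a2 b2 g21) (moveDown w3 a3 b3 g25) (moveDown w0 a0 b0 g19) (moveDown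
    w2 a2 b2 g22) (moveDown w3 a3 b3 g26) (moveDown w0 a0 b0 g21) (moveDown w1 a1 b1 g22)
    (moveDown w3 a3 b3 g28) (moveDown w0 a0 b0 g25) (moveDown w1 a1 b1 g26) (moveDown w2 a2 b2
    g28) k

def reviseStage6 {α : Type} (w0 w1 w2 w3 w4 a0 a1 a2 a3 a4 b0 b1 b2 b3 b4 f0 f1 f2 f4 f8 f16 f3 f5
    f6 f9 f10 f12 f17 f18 f20 f24 f7 f11 f13 f14 f19 f21 f22 f25 f26 f28 f15 f23 f27 f29 f30 t0 t1
    t2 t3 t4 x7_3 x7_4 x11_2 x11_4 x13_1 x13_4 x14_0 x14_4 x19_2 x19_3 x21_1 x21_3 x22_0 x22_3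
    x25_1 x25_2 x26_0 x26_2 x28_0 x28_1 : ℕ) (k : ℕ → ℕ → ℕ → ℕ → ℕ → ℕ → α) : α :=
  reviseStage7 w0 w1 w2 w3 w4 a0 a1 a2 a3 a4 b0 b1 b2 b3 b4 f0 f1 f2 f4 f8 f16 f3 f5 f6 f9 f10 f12
    f17 f18 f20 f24 f7 f11 f13 f14 f19 f21 f22 f25 f26 f28 f15 f23 f27 f29 f30 t0 t1 t2 t3 t4 x7_3
    x7_4 x11_2 x11_4 x13_1 x13_4 x14_0 x14_4 x19_2 x19_3 x21_1 x21_3 x22_0 x22_3 x25_1 x25_2 x26_0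
    x26_2 x28_0 x28_1 (Nat.lor x7_3 x7_4) (Nat.lor x11_2 x11_4) (Nat.lor x13_1 x13_4) (Nat.lor
    x14_0 x14_4) (Nat.lor x19_2 x19_3) (Nat.lor x21_1 x21_3) (Nat.lor x22_0 x22_3) (Nat.lor x25_1
    x25_2) (Nat.lor x26_0 x26_2) (Nat.lor x28_0 x28_1) k

def reviseStage5 {α : Type} (w0 w1 w2 w3 w4 a0 a1 a2 a3 a4 b0 b1 b2 b3 b4 f0 f1 f2 f4 f8 f16 f3 f5
    f6 f9 f10 f12 f17 f18 f20 f24 f7 f11 f13 f14 f19 f21 f22 f25 f26 f28 f15 f23 f27 f29 f30 t0 t1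
    t2 t3 t4 : ℕ) (k : ℕ → ℕ → ℕ → ℕ → ℕ → ℕ → α) : α :=
  reviseStage6 w0 w1 w2 w3 w4 a0 a1 a2 a3 a4 b0 b1 b2 b3 b4 f0 f1 f2 f4 f8 f16 f3 f5 f6 f9 f10 f12
    f17 f18 f20 f24 f7 f11 f13 f14 f19 f21 f22 f25 f26 f28 f15 f23 f27 f29 f30 t0 t1 t2 t3 t4
    (moveDown w3 a3 b3 t4) (moveDown w4 a4 b4 t3) (moveDown w2 a2 b2 t4) (moveDown w4 a4 b4 t2)
    (moveDown w1 a1 b1 t4) (moveDown w4 a4 b4 t1) (moveDown w0 a0 b0 t4) (moveDown w4 a4 b4 t0)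
    (moveDown w2 a2 b2 t3) (moveDown w3 a3 b3 t2) (moveDown w1 a1 b1 t3) (moveDown w3 a3 b3 t1)
    (moveDown w0 a0 b0 t3) (moveDown w3 a3 b3 t0) (moveDown w1 a1 b1 t2) (moveDown w2 a2 b2 t1)
    (moveDown w0 a0 b0 t2) (moveDown w2 a2 b2 t0) (moveDown w0 a0 b0 t1) (moveDown w1 a1 b1 t0) k

def reviseStage4 {α : Type} (w0 w1 w2 w3 w4 a0 a1 a2 a3 a4 b0 b1 b2 b3 b4 f0 f1 f2 f4 f8 f16 f3 f5
    f6 f9 f10 f12 f17 f18 f20 f24 f7 f11 f13 f14 f19 f21 f22 f25 f26 f28 f15 f23 f27 f29 f30 : ℕ)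
    (k : ℕ → ℕ → ℕ → ℕ → ℕ → ℕ → α) : α :=
  reviseStage5 w0 w1 w2 w3 w4 a0 a1 a2 a3 a4 b0 b1 b2 b3 b4 f0 f1 f2 f4 f8 f16 f3 f5 f6 f9 f10 f12
    f17 f18 f20 f24 f7 f11 f13 f14 f19 f21 f22 f25 f26 f28 f15 f23 f27 f29 f30 (Nat.lor a0 b0)
    (Nat.lor a1 b1) (Nat.lor a2 b2) (Nat.lor a3 b3) (Nat.lor a4 b4) k

def reviseStage3 {α : Type} (w0 w1 w2 w3 w4 a0 a1 a2 a3 a4 b0 b1 b2 b3 b4 f0 f1 f2 f4 f8 f16 f3 f5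
    f6 f9 f10 f12 f17 f18 f20 f24 f7 f11 f13 f14 f19 f21 f22 f25 f26 f28 : ℕ) (k : ℕ → ℕ → ℕ → ℕ →
    ℕ → ℕ → α) : α :=
  reviseStage4 w0 w1 w2 w3 w4 a0 a1 a2 a3 a4 b0 b1 b2 b3 b4 f0 f1 f2 f4 f8 f16 f3 f5 f6 f9 f10 f12
    f17 f18 f20 f24 f7 f11 f13 f14 f19 f21 f22 f25 f26 f28 (Nat.lor (moveUp w0 a0 b0 f14) (Nat.lor
    (moveUp w1 a1 b1 f13) (Nat.lor (moveUp w2 a2 b2 f11) (moveUp w3 a3 b3 f7)))) (Nat.lor (moveUp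
    w0 a0 b0 f22) (Nat.lor (moveUp w1 a1 b1 f21) (Nat.lor (moveUp w2 a2 b2 f19) (moveUp w4 a4 b4
    f7)))) (Nat.lor (moveUp w0 a0 b0 f26) (Nat.lor (moveUp w1 a1 b1 f25) (Nat.lor (moveUp w3 a3 b3
    f19) (moveUp w4 a4 b4 f11)))) (Nat.lor (moveUp w0 a0 b0 f28) (Nat.lor (moveUp w2 a2 b2 f25)
    (Nat.lor (moveUp w3 a3 b3 f21) (moveUp w4 a4 b4 f13)))) (Nat.lor (moveUp w1 a1 b1 f28)
    (Nat.lor (moveUp w2 a2 b2 f26) (Nat.lor (moveUp w3 a3 b3 f22) (moveUp w4 a4 b4 f14)))) k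

def reviseStage2 {α : Type} (w0 w1 w2 w3 w4 a0 a1 a2 a3 a4 b0 b1 b2 b3 b4 f0 f1 f2 f4 f8 f16 f3 f5
    f6 f9 f10 f12 f17 f18 f20 f24 : ℕ) (k : ℕ → ℕ → ℕ → ℕ → ℕ → ℕ → α) : α :=
  reviseStage3 w0 w1 w2 w3 w4 a0 a1 a2 a3 a4 b0 b1 b2 b3 b4 f0 f1 f2 f4 f8 f16 f3 f5 f6 f9 f10 f12
    f17 f18 f20 f24 (Nat.lor (moveUp w0 a0 b0 f6) (Nat.lor (moveUp w1 a1 b1 f5) (moveUp w2 a2 b2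
    f3))) (Nat.lor (moveUp w0 a0 b0 f10) (Nat.lor (moveUp w1 a1 b1 f9) (moveUp w3 a3 b3 f3)))
    (Nat.lor (moveUp w0 a0 b0 f12) (Nat.lor (moveUp w2 a2 b2 f9) (moveUp w3 a3 b3 f5))) (Nat.lor
    (moveUp w1 a1 b1 f12) (Nat.lor (moveUp w2 a2 b2 f10) (moveUp w3 a3 b3 f6))) (Nat.lor (moveUp
    w0 a0 b0 f18) (Nat.lor (moveUp w1 a1 b1 f17) (moveUp w4 a4 b4 f3))) (Nat.lor (moveUp w0 a0 b0
    f20) (Nat.lor (moveUp w2 a2 b2 f17) (moveUp w4 a4 b4 f5))) (Nat.lor (moveUp w1 a1 b1 f20)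
    (Nat.lor (moveUp w2 a2 b2 f18) (moveUp w4 a4 b4 f6))) (Nat.lor (moveUp w0 a0 b0 f24) (Nat.lor
    (moveUp w3 a3 b3 f17) (moveUp w4 a4 b4 f9))) (Nat.lor (moveUp w1 a1 b1 f24) (Nat.lor (moveUp
    w3 a3 b3 f18) (moveUp w4 a4 b4 f10))) (Nat.lor (moveUp w2 a2 b2 f24) (Nat.lor (moveUp w3 a3 b3
    f20) (moveUp w4 a4 b4 f12))) k

def reviseStage1 {α : Type} (w0 w1 w2 w3 w4 a0 a1 a2 a3 a4 b0 b1 b2 b3 b4 f0 f1 f2 f4 f8 f16 : ℕ)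
    (k : ℕ → ℕ → ℕ → ℕ → ℕ → ℕ → α) : α :=
  reviseStage2 w0 w1 w2 w3 w4 a0 a1 a2 a3 a4 b0 b1 b2 b3 b4 f0 f1 f2 f4 f8 f16 (Nat.lor (moveUp w0
    a0 b0 f2) (moveUp w1 a1 b1 f1)) (Nat.lor (moveUp w0 a0 b0 f4) (moveUp w2 a2 b2 f1)) (Nat.lor
    (moveUp w1 a1 b1 f4) (moveUp w2 a2 b2 f2)) (Nat.lor (moveUp w0 a0 b0 f8) (moveUp w3 a3 b3 f1))
    (Nat.lor (moveUp w1 a1 b1 f8) (moveUp w3 a3 b3 f2)) (Nat.lor (moveUp w2 a2 b2 f8) (moveUp w3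
    a3 b3 f4)) (Nat.lor (moveUp w0 a0 b0 f16) (moveUp w4 a4 b4 f1)) (Nat.lor (moveUp w1 a1 b1 f16)
    (moveUp w4 a4 b4 f2)) (Nat.lor (moveUp w2 a2 b2 f16) (moveUp w4 a4 b4 f4)) (Nat.lor (moveUp w3
    a3 b3 f16) (moveUp w4 a4 b4 f8)) k

def reviseStage0 {α : Type} (w0 w1 w2 w3 w4 a0 a1 a2 a3 a4 b0 b1 b2 b3 b4 f0 : ℕ) (k : ℕ → ℕ → ℕ →
    ℕ → ℕ → ℕ → α) : α :=
  reviseStage1 w0 w1 w2 w3 w4 a0 a1 a2 a3 a4 b0 b1 b2 b3 b4 f0 (moveUp w0 a0 b0 f0) (moveUp w1 a1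
    b1 f0) (moveUp w2 a2 b2 f0) (moveUp w3 a3 b3 f0) (moveUp w4 a4 b4 f0) k

def lorL : List ℕ → ℕ
  | [] => 0
  | [x] => x
  | x :: y :: l => Nat.lor x (lorL (y :: l))

def fwd (w a b : ℕ → ℕ) (D : ℕ) : ℕ → ℕ → ℕ
  | 0, _ => D
  | n + 1, A => lorL (((List.range 5).filter A.testBit).map fun q =>
      moveUp (w q) (a q) (b q) (fwd w a b D n (A ^^^ 2 ^ q)))

def bwd (w a b : ℕ → ℕ) : ℕ → ℕ → ℕ → ℕ
  | 0, _, q => Nat.lor (a q) (b q)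
  | n + 1, A, q => moveDown (w q) (a q) (b q)
      (lorL (((List.range 5).filter fun p => !(A ^^^ 2 ^ q).testBit p).map fun p =>
        bwd w a b n (A ^^^ 2 ^ q) p))

def popc (A : ℕ) : ℕ := ((List.range 5).filter A.testBit).length

def outRow (w a b : ℕ → ℕ) (D q : ℕ) : ℕ :=
  lorL (((List.range 32).filter fun A => !A.testBit q).map fun A =>
    Nat.land (fwd w a b D (popc A) A) (bwd w a b (4 - popc A) A q))

def outBase (w a b : ℕ → ℕ) (D : ℕ) : ℕ :=
  Nat.land D (lorL ((List.range 5).map fun q => bwd w a b 4 0 q))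

theorem reviseStage0_eq {α : Type} (w a b : ℕ → ℕ) (D : ℕ) (k : ℕ → ℕ → ℕ → ℕ → ℕ → ℕ → α) :
    reviseStage0 (w 0) (w 1) (w 2) (w 3) (w 4) (a 0) (a 1) (a 2) (a 3) (a 4)
      (b 0) (b 1) (b 2) (b 3) (b 4) D k =
    k (outBase w a b D) (outRow w a b D 0) (outRow w a b D 1) (outRow w a b D 2)
      (outRow w a b D 3) (outRow w a b D 4) := by
  rfl

def force {α : Type} (x : ℕ) (k : ℕ → α) : α := cond (Nat.beq x 0) (k x) (k x)

/-- The mask selecting, among the first `n` fields of `L` bits, those indexed by a bit of `R`. -/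
noncomputable def fieldMask (L R n : ℕ) : ℕ :=
  Nat.rec 0 (fun i ih => cond (Nat.testBit R i)
    (Nat.lor ih (Nat.shiftLeft (Nat.sub (Nat.pow 2 L) 1) (Nat.mul i L))) ih) n

noncomputable def deltaSwap (L d R x : ℕ) : ℕ :=
  (fun y => Nat.xor x (Nat.xor y (Nat.shiftLeft y (Nat.mul d L))))
    (Nat.land (Nat.xor x (Nat.shiftRight x (Nat.mul d L))) (fieldMask L R 32))

noncomputable def swapHalves (L x : ℕ) : ℕ :=
  Nat.lor (Nat.shiftRight x (Nat.mul 16 L))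
    (Nat.shiftLeft (Nat.land x (fieldMask L 0xFFFF 32)) (Nat.mul 16 L))

noncomputable def sw0 (L x : ℕ) : ℕ := deltaSwap L 1 0x22222222 x
noncomputable def sw1 (L x : ℕ) : ℕ := deltaSwap L 2 0x0C0C0C0C x
noncomputable def sw2 (L x : ℕ) : ℕ := deltaSwap L 4 0x00F000F0 x
noncomputable def sw3 (L x : ℕ) : ℕ := deltaSwap L 8 0x0000FF00 x

noncomputable def swBase (L x : ℕ) : ℕ :=
  deltaSwap L 1 0x55550000 (deltaSwap L 2 0x33330000
    (deltaSwap L 4 0x0F0F0000 (deltaSwap L 8 0x00FF0000 x)))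

noncomputable def inRow1 (L x : ℕ) : ℕ := sw3 L (swapHalves L x)
noncomputable def inRow2 (L x : ℕ) : ℕ := sw2 L (sw3 L x)
noncomputable def inRow3 (L x : ℕ) : ℕ := sw1 L (sw2 L (sw3 L (swapHalves L x)))
noncomputable def inRow4 (L x : ℕ) : ℕ := sw0 L (sw1 L (sw2 L (sw3 L x)))

noncomputable def outRow1 (L x : ℕ) : ℕ := swapHalves L (sw3 L x)
noncomputable def outRow2 (L x : ℕ) : ℕ := sw3 L (sw2 L x)
noncomputable def outRow3 (L x : ℕ) : ℕ := swapHalves L (sw3 L (sw2 L (sw1 L x)))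
noncomputable def outRow4 (L x : ℕ) : ℕ := sw3 L (sw2 L (sw1 L (sw0 L x)))

noncomputable def reviseRows {α : Type} (L d t4 t3 t2 t1 t0 : ℕ)
    (k : ℕ → ℕ → ℕ → ℕ → ℕ → ℕ → α) : α :=
  reviseStage0 (Nat.mul 1 L) (Nat.mul 2 L) (Nat.mul 4 L) (Nat.mul 8 L) (Nat.mul 16 L)
    (Nat.land t0 (fieldMask L 0x55555555 32)) (Nat.land t1 (fieldMask L 0x33333333 32))
    (Nat.land t2 (fieldMask L 0x0F0F0F0F 32)) (Nat.land t3 (fieldMask L 0x00FF00FF 32))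
    (Nat.land t4 (fieldMask L 0x0000FFFF 32))
    (Nat.land t0 (fieldMask L 0xAAAAAAAA 32)) (Nat.land t1 (fieldMask L 0xCCCCCCCC 32))
    (Nat.land t2 (fieldMask L 0xF0F0F0F0 32)) (Nat.land t3 (fieldMask L 0xFF00FF00 32))
    (Nat.land t4 (fieldMask L 0xFFFF0000 32)) d
    fun e u0 u1 u2 u3 u4 =>
      force (swBase L e) fun y0 => force u4 fun y1 => force (outRow1 L u3) fun y2 =>
      force (outRow2 L u2) fun y3 => force (outRow3 L u1) fun y4 =>
      force (outRow4 L u0) fun y5 => k y0 y1 y2 y3 y4 y5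

noncomputable def revise {α : Type} (L x0 x1 x2 x3 x4 x5 : ℕ)
    (k : ℕ → ℕ → ℕ → ℕ → ℕ → ℕ → α) : α :=
  reviseRows L (swBase L x0) x1 (inRow1 L x2) (inRow2 L x3) (inRow3 L x4) (inRow4 L x5) k

inductive Trie where
  | leaf (x : ℕ)
  | node (l r : Trie)

noncomputable def Trie.get (p : List Bool) : Trie → ℕ :=
  List.rec (fun t => Trie.rec (fun x => x) (fun _ _ _ _ => 0) t)
    (fun b _ ih t => Trie.rec (fun _ => 0) (fun l r _ _ => ih (cond b r l)) t) p

noncomputable def Trie.set (p : List Bool) (v : ℕ) : Trie → Trie :=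
  List.rec (fun t => Trie.rec (fun _ => .leaf v) (fun l r _ _ => .node l r) t)
    (fun b _ ih t => Trie.rec (fun x => .leaf x)
      (fun l r _ _ => cond b (.node l (ih r)) (.node (ih l) r)) t) p

/-- Removes the `o`-th element of a set of naturals given by its indicator list. -/
noncomputable def rem (o : ℕ) (p : List Bool) : List Bool :=
  List.rec (fun _ => [])
    (fun b p ih o => cond b (Nat.rec (false :: p) (fun o _ => true :: ih o) o) (false :: ih o)) p o

noncomputable def subsets (n : ℕ) : ℕ → List (List Bool) :=
  Nat.rec (fun k => cond (Nat.beq k 0) [[]] [])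
    (fun _ ih k => Nat.rec ((ih 0).map (false :: ·))
      (fun k _ => (ih (k + 1)).map (false :: ·) ++ (ih k).map (true :: ·)) k) n

/-- Passes on the entry at `p` together with the function that replaces it. -/
noncomputable def Trie.focus {α : Type} (p : List Bool) : Trie → (ℕ → (ℕ → Trie) → α) → α :=
  List.rec (motive := fun _ => Trie → (ℕ → (ℕ → Trie) → α) → α)
    (fun t k => Trie.rec (fun y => k y fun v => .leaf v) (fun l r _ _ => k 0 fun _ => .node l r) t)
    (fun b _ ih t k => Trie.rec (fun x => k 0 fun _ => .leaf x)
      (fun l r _ _ => cond b (ih r fun y f => k y fun v => .node l (f v))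
        (ih l fun y f => k y fun v => .node (f v) r)) t) p

/-- Passes on the entries at `rem 0 s`, `rem 1 s`, … together with the function that replaces
them. -/
noncomputable def Trie.focusRem {α : Type} (s : List Bool) :
    Trie → (List ℕ → (List ℕ → Trie) → α) → α :=
  List.rec (motive := fun _ => Trie → (List ℕ → (List ℕ → Trie) → α) → α)
    (fun t k => k [] fun _ => t)
    (fun b p ih t k => Trie.rec (fun _ => k [] fun _ => t)
      (fun l r _ _ => cond b
        (l.focus p fun y f => ih r fun ys g =>
          k (y :: ys) fun vs => List.rec (.node l r) (fun v vs _ => .node (f v) (g vs)) vs)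
        (ih l fun ys g => k ys fun vs => .node (g vs) r)) t) s

noncomputable def reviseAt {α : Type} (L : ℕ) (s : List Bool) (t : Trie) (k : Trie → α) : α :=
  t.focusRem s fun ys g =>
    List.rec (k t) (fun y0 ys _ => List.rec (k t) (fun y1 ys _ => List.rec (k t) (fun y2 ys _ =>
    List.rec (k t) (fun y3 ys _ => List.rec (k t) (fun y4 ys _ => List.rec (k t) (fun y5 _ _ =>
      revise L y0 y1 y2 y3 y4 y5 fun y0 y1 y2 y3 y4 y5 => k (g [y0, y1, y2, y3, y4, y5]))
      ys) ys) ys) ys) ys) ys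

noncomputable def reviseAll {α : Type} (L : ℕ) (k : Trie → α) (l : List (List Bool))
    (t : Trie) : α :=
  List.rec (fun t => k t) (fun s _ ih t => reviseAt L s t ih) l t

def foldFields (L x : ℕ) : ℕ :=
  (fun x => (fun x => (fun x => (fun x =>
    Nat.lor x (Nat.shiftRight x (Nat.mul 1 L)))
    (Nat.lor x (Nat.shiftRight x (Nat.mul 2 L))))
    (Nat.lor x (Nat.shiftRight x (Nat.mul 4 L))))
    (Nat.lor x (Nat.shiftRight x (Nat.mul 8 L))))
    (Nat.lor x (Nat.shiftRight x (Nat.mul 16 L)))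

noncomputable def alive (L : ℕ) (t : Trie) (l : List (List Bool)) (x : ℕ) : ℕ :=
  List.rec x (fun f _ ih => Nat.land (foldFields L (t.get f)) ih) l

noncomputable def mkTrie (n : ℕ) (g : List Bool → ℕ) : Trie :=
  Nat.rec (fun g => .leaf (g [])) (fun _ ih g =>
    .node (ih fun p => g (false :: p)) (ih fun p => g (true :: p))) n g

def facetMasks : List ℕ :=
  [0x803, 0x025, 0x089, 0x409, 0x111, 0x211, 0x121, 0x281, 0xc01, 0x00e, 0x04a, 0x112, 0x812,
    0x222, 0x422, 0x242, 0x502, 0x01c, 0x094, 0x224, 0x444, 0x844, 0x484, 0xa04, 0x038, 0x128,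
    0x448, 0x888, 0x908, 0x070, 0x250, 0x890, 0x0e0, 0x4a0, 0x1c0, 0x940, 0x380, 0x700, 0xe00]

def edgeMasks : List ℕ :=
  [0x003, 0x005, 0x006, 0x009, 0x00a, 0x00c, 0x011, 0x012, 0x014, 0x018, 0x021, 0x022, 0x024,
    0x028, 0x030, 0x042, 0x044, 0x048, 0x050, 0x060, 0x081, 0x084, 0x088, 0x090, 0x0a0, 0x0c0,
    0x101, 0x102, 0x108, 0x110, 0x120, 0x140, 0x180, 0x201, 0x202, 0x204, 0x210, 0x220, 0x240,
    0x280, 0x300, 0x401, 0x402, 0x404, 0x408, 0x420, 0x440, 0x480, 0x500, 0x600, 0x801, 0x802,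
    0x804, 0x808, 0x810, 0x840, 0x880, 0x900, 0xa00, 0xc00]

/-- Masks of the elements of a set, in decreasing order. -/
noncomputable def elemMasks (p : List Bool) : List ℕ :=
  List.rec [] (fun b p ih => cond b (Nat.shiftLeft 1 p.length :: ih) ih) p

/-- The two fields with relative sign vector `r`. -/
noncomputable def fieldPair (L r : ℕ) : ℕ :=
  Nat.xor (Nat.sub (Nat.pow 2 (Nat.mul 32 L)) 1)
    (Nat.shiftLeft (fieldMask L 0x10001 32) (Nat.mul r L))

/-- The code, up to a global sign, of the partition of a set into `T` and its complement. -/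
noncomputable def relCode (T : ℕ) (l : List ℕ) : ℕ :=
  List.rec 0 (fun m l _ =>
    (List.rec (fun _ => 0) (fun m' _ ih d => Nat.lor (cond (Nat.beq (Nat.land m T) 0)
      (cond (Nat.beq (Nat.land m' T) 0) 0 d) (cond (Nat.beq (Nat.land m' T) 0) d 0))
       (ih (Nat.div d 2))) l 8)) l

noncomputable def copies (L : ℕ) : ℕ := Nat.div (Nat.sub (Nat.pow 2 (Nat.mul 32 L)) 1)
  (Nat.sub (Nat.pow 2 L) 1)

noncomputable def signFields (L R : ℕ) (P : Trie) (p : List Bool) : ℕ :=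
  Nat.lor (Nat.land (fieldMask L R 32) (Nat.mul (P.get (true :: p)) (copies L)))
    (Nat.land (fieldMask L (Nat.xor 0xFFFFFFFF R) 32) (Nat.mul (P.get (false :: p)) (copies L)))

noncomputable def dom (L : ℕ) (P : Trie) (f : List Bool) : ℕ :=
  Nat.land (fieldPair L 0) (Nat.land (signFields L 0xFFFF0000 P (rem 0 f))
    (Nat.land (signFields L 0xFF0000FF P (rem 1 f)) (Nat.land (signFields L 0x0F0FF0F0 P (rem 2 f))
    (Nat.land (signFields L 0xCCCC3333 P (rem 3 f)) (signFields L 0x5555AAAA P (rem 4 f))))))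

noncomputable def pathOf (n m : ℕ) : List Bool :=
  Nat.rec [] (fun i ih => Nat.testBit m i :: ih) n

noncomputable def Trie.restrict {α : Type} (P : Trie) (p : List Bool) (x : ℕ) (k : Trie → α) : α :=
  P.focus p fun y f => force (Nat.land y x) fun y => k (f y)

noncomputable def clearEdges {α : Type} (L T : ℕ) (k : Trie → α) (l : List ℕ) : Trie → α :=
  List.rec k (fun G _ ih t => cond (Nat.beq (Nat.land T G) 0)
    (t.restrict (pathOf 12 (Nat.lor T G))
      (fieldPair L (relCode T (elemMasks (pathOf 12 (Nat.lor T G))))) ih) (ih t)) l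

noncomputable def clearFacets {α : Type} (L : ℕ) (k : Trie → α) (l : List ℕ) : Trie → α :=
  List.rec k (fun T _ ih t => clearEdges L T ih edgeMasks t) l

inductive Cert where
  | leaf (b : ℕ)
  | node (v : ℕ) (c₀ c₁ : Cert)

noncomputable def pushToken (t : ℕ) (s : List Cert) : List Cert :=
  cond (Nat.ble 0xF01 t) (.leaf (Nat.sub t 0xF01) :: s)
    (List.rec [] (fun c₁ s _ => List.rec [] (fun c₀ s _ => .node t c₀ c₁ :: s) s) s)

noncomputable def pushChunk (x n : ℕ) (s : List Cert) : List Cert :=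
  Nat.rec (fun _ s => s) (fun _ ih x s =>
    ih (Nat.shiftRight x 12) (pushToken (Nat.land x 0xFFF) s)) n x s

noncomputable def decode (l : List ℕ) (s : List Cert) : Cert :=
  List.rec (fun s => List.rec (.leaf 0) (fun c _ _ => c) s)
    (fun x _ ih s => ih (pushChunk x 64 s)) l s

noncomputable def cnt (b : ℕ) (c : Cert) : ℕ :=
  Cert.rec (fun b' => cond (Nat.beq b' b) 1 0) (fun _ _ _ m n => Nat.add m n) c

noncomputable def keep (n lo m : ℕ) : ℕ :=
  Nat.xor (Nat.sub (Nat.pow 2 n) 1) (Nat.shiftLeft (Nat.sub (Nat.pow 2 m) 1) lo)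

noncomputable def restrictions {α : Type} (b n : ℕ) (c : Cert) :
    ℕ → Trie → (Trie → α) → α :=
  Cert.rec (fun _ _ P k => k P) (fun v c₀ c₁ ih₀ ih₁ lo P k =>
    cond (Nat.beq (Nat.add (cnt b c₀) (cnt b c₁)) 0) (k P)
      (P.restrict (true :: pathOf 12 v) (keep n lo (cnt b c₀)) fun P =>
        P.restrict (false :: pathOf 12 v) (keep n (Nat.add lo (cnt b c₀)) (cnt b c₁)) fun P =>
        ih₀ lo P fun P => ih₁ (Nat.add lo (cnt b c₀)) P k)) c

noncomputable def check (c : Cert) (b L r : ℕ) : Bool :=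
  cond (Nat.ble (cnt b c) L)
    (restrictions b (cnt b c) c 0 ((mkTrie 13 fun _ => Nat.sub (Nat.pow 2 (cnt b c)) 1).set
        (false :: pathOf 12 0xF) 0) fun P =>
      clearFacets L (reviseAll L
        (fun t => Nat.beq (alive L t (subsets 12 5) (Nat.sub (Nat.pow 2 L) 1)) 0)
        ((subsets 12 6 ++ (subsets 12 6 ++ subsets 12 6)).take r)) facetMasks
        (mkTrie 12 (dom L P)))
    false

/-- Bit `ℓ` of field `r`. -/
def bitAt (L ℓ x r : ℕ) : Bool := Nat.testBit x (r * L + ℓ)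

section Fields

variable {L ℓ : ℕ}

theorem bitAt_land (x y r : ℕ) : bitAt L ℓ (Nat.land x y) r = (bitAt L ℓ x r && bitAt L ℓ y r) :=
  Nat.testBit_and x y _

theorem bitAt_lor (x y r : ℕ) : bitAt L ℓ (Nat.lor x y) r = (bitAt L ℓ x r || bitAt L ℓ y r) :=
  Nat.testBit_or x y _

theorem bitAt_xor (x y r : ℕ) :
    bitAt L ℓ (Nat.xor x y) r = Bool.xor (bitAt L ℓ x r) (bitAt L ℓ y r) :=
  Nat.testBit_xor x y _

theorem bitAt_shiftRight (x d r : ℕ) :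
    bitAt L ℓ (Nat.shiftRight x (Nat.mul d L)) r = bitAt L ℓ x (r + d) := by
  have : Nat.shiftRight x (Nat.mul d L) = x >>> (d * L) := rfl
  rw [bitAt, bitAt, this, Nat.testBit_shiftRight]
  congr 1
  ring

theorem bitAt_shiftLeft (hℓ : ℓ < L) (x d r : ℕ) :
    bitAt L ℓ (Nat.shiftLeft x (Nat.mul d L)) r = (decide (d ≤ r) && bitAt L ℓ x (r - d)) := by
  have : Nat.shiftLeft x (Nat.mul d L) = x <<< (d * L) := rfl
  rw [bitAt, bitAt, this, Nat.testBit_shiftLeft]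
  by_cases h : d ≤ r
  · obtain ⟨e, rfl⟩ := Nat.exists_eq_add_of_le h
    have h1 : (d + e) * L + ℓ ≥ d * L := by nlinarith
    have h2 : (d + e) * L + ℓ - d * L = (d + e - d) * L + ℓ := by
      rw [Nat.add_sub_cancel_left, Nat.add_mul, Nat.add_assoc, Nat.add_sub_cancel_left]
    simp [h1, h2]
  · have h1 : ¬ d * L ≤ r * L + ℓ := by
      have : (r + 1) * L ≤ d * L := Nat.mul_le_mul_right _ (by omega)
      nlinarith
    simp [h, h1]

theorem testBit_ones (n i : ℕ) : Nat.testBit (Nat.sub (Nat.pow 2 n) 1) i = decide (i < n) :=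
  Nat.testBit_two_pow_sub_one n i

theorem bitAt_ones (hℓ : ℓ < L) (r : ℕ) :
    bitAt L ℓ (Nat.sub (Nat.pow 2 L) 1) r = decide (r = 0) := by
  rw [bitAt, testBit_ones]
  rcases r with _ | r
  · simpa using hℓ
  · simp; nlinarith

theorem bitAt_fieldMask (hℓ : ℓ < L) (R n r : ℕ) :
    bitAt L ℓ (fieldMask L R n) r = (decide (r < n) && R.testBit r) := by
  induction n with
  | zero => simp [fieldMask, bitAt]
  | succ n ih =>
    have step : fieldMask L R (n + 1) = cond (Nat.testBit R n)
      (Nat.lor (fieldMask L R n) (Nat.shiftLeft (Nat.sub (Nat.pow 2 L) 1) (Nat.mul n L)))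
      (fieldMask L R n) := rfl
    rw [step]
    cases h : R.testBit n
    · rw [cond_false, ih]
      by_cases hr : r = n
      · simp [hr, h]
      · congr 2; simp; omega
    · rw [cond_true, bitAt_lor, ih, bitAt_shiftLeft hℓ, bitAt_ones hℓ]
      by_cases hr : r = n
      · simp [hr, h]
      · have : (decide (n ≤ r) && decide (r - n = 0)) = false := by simp; omega
        rw [this, Bool.or_false]
        congr 2; simp; omega

/-- The involution of field indices performed by `deltaSwap`. -/
def swapIdx (d R r : ℕ) : ℕ :=
  if R.testBit r then r + d else if d ≤ r ∧ R.testBit (r - d) then r - d else r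

theorem bitAt_deltaSwap (hℓ : ℓ < L) {d R : ℕ} (hR : R < 2 ^ 32)
    (hd : ∀ r < 32, R.testBit r → ¬ (d ≤ r ∧ R.testBit (r - d))) {x r : ℕ} :
    bitAt L ℓ (deltaSwap L d R x) r = bitAt L ℓ x (swapIdx d R r) := by
  have hlt : ∀ i, R.testBit i → i < 32 := fun i hi => by
    by_contra h
    rw [Nat.testBit_lt_two_pow (hR.trans_le (Nat.pow_le_pow_right (by norm_num) (by omega)))] at hi
    cases hi
  have hm : ∀ i, (decide (i < 32) && R.testBit i) = R.testBit i := fun i => by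
    cases h : R.testBit i
    · simp
    · simp [hlt i h]
  simp only [deltaSwap, bitAt_xor, bitAt_land, bitAt_shiftRight, bitAt_shiftLeft hℓ,
    bitAt_fieldMask hℓ, hm, swapIdx]
  by_cases h1 : R.testBit r
  · have h2 := hd r (hlt r h1) h1
    rw [if_pos h1, h1]
    rw [not_and] at h2
    by_cases h3 : d ≤ r
    · simp [h2 h3, h3]
    · simp [h3]
  · rw [if_neg h1]
    rw [Bool.not_eq_true] at h1
    by_cases h3 : d ≤ r ∧ R.testBit (r - d)
    · rw [if_pos h3]
      simp only [h1, h3.1, h3.2, decide_true, Bool.and_true, Bool.and_false, Bool.true_and,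
        Bool.false_xor, Nat.sub_add_cancel]
      cases bitAt L ℓ x r <;> cases bitAt L ℓ x (r - d) <;> rfl
    · rw [if_neg h3]
      rw [not_and, Bool.not_eq_true] at h3
      by_cases h4 : d ≤ r
      · simp [h1, h3 h4]
      · simp [h1, h4]

theorem bitAt_swapHalves (hℓ : ℓ < L) {x r : ℕ} (hr : r < 32) (h : bitAt L ℓ x (r ^^^ 16) = true) :
    bitAt L ℓ (swapHalves L x) r = true := by
  simp only [swapHalves, bitAt_lor, bitAt_land, bitAt_shiftRight, bitAt_shiftLeft hℓ,
    bitAt_fieldMask hℓ]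
  have : ∀ r < 32, (r + 16 = r ^^^ 16) ∨ (16 ≤ r ∧ r - 16 = r ^^^ 16 ∧ r - 16 < 32 ∧
    Nat.testBit 0xFFFF (r - 16)) := by decide
  rcases this r hr with h1 | ⟨h1, h2, h3, h4⟩
  · rw [h1, h]; rfl
  · rw [h2] at h3 h4 ⊢
    simp [h, h1, h3, h4]

theorem bitAt_moveUp (hℓ : ℓ < L) {q r a b x : ℕ} (hq : q < 5) (hr : r < 32)
    (hx : bitAt L ℓ x r = true)
    (ha : Nat.testBit r q = false → bitAt L ℓ a r = true)
    (hb : Nat.testBit r q = true → bitAt L ℓ b r = true) :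
    bitAt L ℓ (moveUp (Nat.mul (2 ^ q) L) a b x) (r ^^^ 2 ^ q) = true := by
  have key : ∀ q < 5, ∀ r < 32,
      (r.testBit q = false ∧ 2 ^ q ≤ r ^^^ 2 ^ q ∧ (r ^^^ 2 ^ q) - 2 ^ q = r) ∨
      (r.testBit q = true ∧ (r ^^^ 2 ^ q) + 2 ^ q = r) := by decide
  simp only [moveUp, bitAt_lor, bitAt_land, bitAt_shiftRight, bitAt_shiftLeft hℓ]
  rcases key q hq r hr with ⟨h1, h2, h3⟩ | ⟨h1, h2⟩
  · simp [h2, h3, hx, ha h1]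
  · simp [h2, hx, hb h1]

theorem bitAt_moveDown (hℓ : ℓ < L) {q r a b x : ℕ} (hq : q < 5) (hr : r < 32)
    (hx : bitAt L ℓ x (r ^^^ 2 ^ q) = true)
    (ha : Nat.testBit r q = false → bitAt L ℓ a r = true)
    (hb : Nat.testBit r q = true → bitAt L ℓ b r = true) :
    bitAt L ℓ (moveDown (Nat.mul (2 ^ q) L) a b x) r = true := by
  have key : ∀ q < 5, ∀ r < 32,
      (r.testBit q = false ∧ r + 2 ^ q = r ^^^ 2 ^ q) ∨
      (r.testBit q = true ∧ 2 ^ q ≤ r ∧ r - 2 ^ q = r ^^^ 2 ^ q) := by decide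
  simp only [moveDown, bitAt_lor, bitAt_land, bitAt_shiftRight, bitAt_shiftLeft hℓ]
  rcases key q hq r hr with ⟨h1, h2⟩ | ⟨h1, h2, h3⟩
  · simp [h2, hx, ha h1]
  · simp [h2, h3, hx, hb h1]

theorem bitAt_lorL {l : List ℕ} {x r : ℕ} (hx : x ∈ l) (h : bitAt L ℓ x r = true) :
    bitAt L ℓ (lorL l) r = true := by
  induction l with
  | nil => cases hx
  | cons y l ih =>
    rcases l with _ | ⟨z, l⟩
    · rw [List.mem_singleton.1 hx] at h; exact h
    · rw [lorL, bitAt_lor]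
      rcases List.mem_cons.1 hx with rfl | hx
      · simp [h]
      · simp [ih hx]

end Fields

/-- A sequence of coordinates flipped one after the other, starting from the flipped set `A`;
`P A q` holds whenever coordinate `q` is flipped after exactly those in `A`. -/
def FlipPath (P : ℕ → ℕ → Prop) : ℕ → List ℕ → Prop
  | _, [] => True
  | A, q :: l => q < 5 ∧ A.testBit q = false ∧ P A q ∧ FlipPath P (A ^^^ 2 ^ q) l

section Paths

variable {L ℓ U D : ℕ} {T a b : ℕ → ℕ}

theorem flip_lt {A q : ℕ} (hA : A < 32) (hq : q < 5) : A ^^^ 2 ^ q < 32 :=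
  Nat.xor_lt_two_pow (n := 5) hA (Nat.pow_lt_pow_right (by norm_num) hq)

theorem testBit_flip {A q : ℕ} (_hA : A < 32) (_hq : q < 5) (h : A.testBit q = false) :
    (A ^^^ 2 ^ q).testBit q = true := by
  rw [Nat.testBit_xor, h, Nat.testBit_two_pow_self]; rfl

theorem popc_flip : ∀ A < 32, ∀ q < 5, A.testBit q = false → popc (A ^^^ 2 ^ q) = popc A + 1 := by
  decide +kernel

theorem bitAt_fwd (hℓ : ℓ < L) (hU : U < 32)
    (ha : ∀ q < 5, ∀ r < 32, bitAt L ℓ (T q) r = true → r.testBit q = false →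
      bitAt L ℓ (a q) r = true)
    (hb : ∀ q < 5, ∀ r < 32, bitAt L ℓ (T q) r = true → r.testBit q = true →
      bitAt L ℓ (b q) r = true)
    {n A q : ℕ} (hA : A < 32) (hq : q < 5) (hAq : A.testBit q = false)
    (hT : bitAt L ℓ (T q) (U ^^^ A) = true)
    (h : bitAt L ℓ (fwd (fun q => Nat.mul (2 ^ q) L) a b D n A) (U ^^^ A) = true) :
    bitAt L ℓ (fwd (fun q => Nat.mul (2 ^ q) L) a b D (n + 1) (A ^^^ 2 ^ q)) (U ^^^ (A ^^^ 2 ^ q))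
      = true := by
  have hUA : U ^^^ A < 32 := Nat.xor_lt_two_pow (n := 5) hU hA
  rw [fwd]
  refine bitAt_lorL (List.mem_map.2 ⟨q, List.mem_filter.2 ⟨List.mem_range.2 hq,
    testBit_flip hA hq hAq⟩, rfl⟩) ?_
  rw [Nat.xor_xor_cancel_right, ← Nat.xor_assoc]
  exact bitAt_moveUp hℓ hq hUA h (ha q hq _ hUA hT) (hb q hq _ hUA hT)

theorem bitAt_bwd (hℓ : ℓ < L) (hU : U < 32)
    (ha : ∀ q < 5, ∀ r < 32, bitAt L ℓ (T q) r = true → r.testBit q = false →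
      bitAt L ℓ (a q) r = true)
    (hb : ∀ q < 5, ∀ r < 32, bitAt L ℓ (T q) r = true → r.testBit q = true →
      bitAt L ℓ (b q) r = true)
    (l : List ℕ) {A q : ℕ} (hA : A < 32)
    (h : FlipPath (fun A q => bitAt L ℓ (T q) (U ^^^ A) = true) A (q :: l)) :
    bitAt L ℓ (bwd (fun q => Nat.mul (2 ^ q) L) a b l.length A q) (U ^^^ A) = true := by
  induction l generalizing A q with
  | nil =>
    obtain ⟨hq, hAq, hT, -⟩ := h
    have hUA : U ^^^ A < 32 := Nat.xor_lt_two_pow (n := 5) hU hA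
    rw [List.length_nil, bwd, bitAt_lor]
    cases hc : (U ^^^ A).testBit q
    · rw [ha q hq _ hUA hT hc]; rfl
    · rw [hb q hq _ hUA hT hc, Bool.or_true]
  | cons p l ih =>
    obtain ⟨hq, hAq, hT, h⟩ := h
    have hUA : U ^^^ A < 32 := Nat.xor_lt_two_pow (n := 5) hU hA
    have hx := ih (flip_lt hA hq) h
    rw [List.length_cons, bwd]
    refine bitAt_moveDown hℓ hq hUA (bitAt_lorL (List.mem_map.2 ⟨p, List.mem_filter.2
      ⟨List.mem_range.2 h.1, ?_⟩, rfl⟩) ?_) (ha q hq _ hUA hT) (hb q hq _ hUA hT)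
    · rw [h.2.1]; rfl
    · rw [Nat.xor_assoc]; exact hx

theorem FlipPath.bitAt_outRow (hℓ : ℓ < L) (hU : U < 32)
    (ha : ∀ q < 5, ∀ r < 32, bitAt L ℓ (T q) r = true → r.testBit q = false →
      bitAt L ℓ (a q) r = true)
    (hb : ∀ q < 5, ∀ r < 32, bitAt L ℓ (T q) r = true → r.testBit q = true →
      bitAt L ℓ (b q) r = true)
    (l : List ℕ) {A : ℕ} (hA : A < 32) (hl : popc A + l.length = 5)
    (h : FlipPath (fun A q => bitAt L ℓ (T q) (U ^^^ A) = true) A l)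
    (hf : bitAt L ℓ (fwd (fun q => Nat.mul (2 ^ q) L) a b D (popc A) A) (U ^^^ A) = true) :
    FlipPath (fun A q => bitAt L ℓ (outRow (fun q => Nat.mul (2 ^ q) L) a b D q) (U ^^^ A) = true)
      A l := by
  induction l generalizing A with
  | nil => trivial
  | cons q l ih =>
    have hbw := bitAt_bwd hℓ hU ha hb l hA h
    obtain ⟨hq, hAq, hT, h⟩ := h
    rw [List.length_cons] at hl
    refine ⟨hq, hAq, ?_, ih (flip_lt hA hq) ?_ h ?_⟩
    · refine bitAt_lorL (List.mem_map.2 ⟨A, List.mem_filter.2 ⟨List.mem_range.2 hA, ?_⟩, rfl⟩) ?_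
      · rw [hAq]; rfl
      · have : 4 - popc A = l.length := by omega
        rw [bitAt_land, hf, this, hbw]; rfl
    · rw [popc_flip A hA q hq hAq]; omega
    · rw [popc_flip A hA q hq hAq]
      exact bitAt_fwd hℓ hU ha hb hA hq hAq hT hf

theorem FlipPath.bitAt_outBase (hℓ : ℓ < L) (hU : U < 32)
    (ha : ∀ q < 5, ∀ r < 32, bitAt L ℓ (T q) r = true → r.testBit q = false →
      bitAt L ℓ (a q) r = true)
    (hb : ∀ q < 5, ∀ r < 32, bitAt L ℓ (T q) r = true → r.testBit q = true →
      bitAt L ℓ (b q) r = true) {l : List ℕ} (hl : l.length = 5)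
    (h : FlipPath (fun A q => bitAt L ℓ (T q) (U ^^^ A) = true) 0 l)
    (hD : bitAt L ℓ D U = true) :
    bitAt L ℓ (outBase (fun q => Nat.mul (2 ^ q) L) a b D) U = true := by
  obtain _ | ⟨q, l⟩ := l
  · cases hl
  · have hbw := bitAt_bwd hℓ hU ha hb l (by norm_num) h
    rw [Nat.succ_injective hl, Nat.xor_zero] at hbw
    rw [outBase, bitAt_land, hD, Bool.true_and]
    exact bitAt_lorL (List.mem_map.2 ⟨q, List.mem_range.2 h.1, rfl⟩) hbw

end Paths

theorem FlipPath.imp {P Q : ℕ → ℕ → Prop} (h : ∀ A q, P A q → Q A q) {A : ℕ} {l : List ℕ}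
    (hl : FlipPath P A l) : FlipPath Q A l := by
  induction l generalizing A with
  | nil => trivial
  | cons q l ih => exact ⟨hl.1, hl.2.1, h _ _ hl.2.2.1, ih hl.2.2.2⟩

theorem FlipPath.exists_of_mem {P Q : ℕ → ℕ → Prop} {A q : ℕ} {l : List ℕ}
    (hP : FlipPath P A l) (hQ : FlipPath Q A l) (hq : q ∈ l) : ∃ A, P A q ∧ Q A q := by
  induction l generalizing A with
  | nil => cases hq
  | cons p l ih =>
    rcases List.mem_cons.1 hq with rfl | hq
    · exact ⟨A, hP.2.2.1, hQ.2.2.1⟩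
    · exact ih hP.2.2.2 hQ.2.2.2 hq

instance FlipPath.decidable (P : ℕ → ℕ → Prop) [∀ A q, Decidable (P A q)] :
    ∀ A l, Decidable (FlipPath P A l)
  | _, [] => isTrue trivial
  | A, q :: l =>
    haveI := FlipPath.decidable P (A ^^^ 2 ^ q) l
    inferInstanceAs (Decidable (q < 5 ∧ A.testBit q = false ∧ P A q ∧ FlipPath P (A ^^^ 2 ^ q) l))

/-- The set of coordinates flipped before `q`, for the tournament in which `p` precedes `q > p`
if and only if `bqp` holds. -/
def flipMask (b10 b20 b21 b30 b31 b32 b40 b41 b42 b43 : Bool) : ℕ → ℕ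
  | 0 => 2 * (!b10).toNat + 4 * (!b20).toNat + 8 * (!b30).toNat + 16 * (!b40).toNat
  | 1 => b10.toNat + 4 * (!b21).toNat + 8 * (!b31).toNat + 16 * (!b41).toNat
  | 2 => b20.toNat + 2 * b21.toNat + 8 * (!b32).toNat + 16 * (!b42).toNat
  | 3 => b30.toNat + 2 * b31.toNat + 4 * b32.toNat + 16 * (!b43).toNat
  | _ => b40.toNat + 2 * b41.toNat + 4 * b42.toNat + 8 * b43.toNat

/-- The coordinates sorted by the number of coordinates flipped before them. -/
def flipOrder (m : ℕ → ℕ) : List ℕ :=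
  (List.range 5).map fun i => ((List.range 5).filter fun q => popc (m q) == i).headD 0

def NotAllEq (a b c : Bool) : Prop := ¬ (a = b ∧ a = c)

instance (a b c : Bool) : Decidable (NotAllEq a b c) := inferInstanceAs (Decidable (¬ _))

theorem flipPath_of_transitive : ∀ b10 b20 b21 b30 b31 b32 b40 b41 b42 b43 : Bool,
    NotAllEq b10 (!b20) b21 → NotAllEq b10 (!b30) b31 → NotAllEq b20 (!b30) b32 →
    NotAllEq b21 (!b31) b32 → NotAllEq b10 (!b40) b41 → NotAllEq b20 (!b40) b42 →
    NotAllEq b21 (!b41) b42 → NotAllEq b30 (!b40) b43 → NotAllEq b31 (!b41) b43 →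
    NotAllEq b32 (!b42) b43 →
    FlipPath (fun A q => flipMask b10 b20 b21 b30 b31 b32 b40 b41 b42 b43 q = A) 0
      (flipOrder (flipMask b10 b20 b21 b30 b31 b32 b40 b41 b42 b43)) ∧
    ∀ q < 5, q ∈ flipOrder (flipMask b10 b20 b21 b30 b31 b32 b40 b41 b42 b43) := by
  decide +kernel

/-- The field index of the signs obtained from `x₀, …, x₄` by alternation. -/
def fieldOf (x₀ x₁ x₂ x₃ x₄ : Bool) : ℕ :=
  16 * x₀.toNat + 8 * (Bool.xor (!x₁) x₀).toNat + 4 * (Bool.xor x₂ x₀).toNat +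
    2 * (Bool.xor (!x₃) x₀).toNat + (Bool.xor x₄ x₀).toNat

theorem fieldOf_lt : ∀ x₀ x₁ x₂ x₃ x₄ : Bool, fieldOf x₀ x₁ x₂ x₃ x₄ < 32 := by decide

def swIdx0 : ℕ → ℕ := swapIdx 1 0x22222222
def swIdx1 : ℕ → ℕ := swapIdx 2 0x0C0C0C0C
def swIdx2 : ℕ → ℕ := swapIdx 4 0x00F000F0
def swIdx3 : ℕ → ℕ := swapIdx 8 0x0000FF00

def swIdxBase (r : ℕ) : ℕ :=
  swapIdx 8 0x00FF0000 (swapIdx 4 0x0F0F0000 (swapIdx 2 0x33330000 (swapIdx 1 0x55550000 r)))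

section Transforms

variable {L ℓ : ℕ}

theorem bitAt_sw0 (hℓ : ℓ < L) (x r : ℕ) : bitAt L ℓ (sw0 L x) r = bitAt L ℓ x (swIdx0 r) :=
  bitAt_deltaSwap hℓ (by norm_num) (by decide +kernel)

theorem bitAt_sw1 (hℓ : ℓ < L) (x r : ℕ) : bitAt L ℓ (sw1 L x) r = bitAt L ℓ x (swIdx1 r) :=
  bitAt_deltaSwap hℓ (by norm_num) (by decide +kernel)

theorem bitAt_sw2 (hℓ : ℓ < L) (x r : ℕ) : bitAt L ℓ (sw2 L x) r = bitAt L ℓ x (swIdx2 r) :=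
  bitAt_deltaSwap hℓ (by norm_num) (by decide +kernel)

theorem bitAt_sw3 (hℓ : ℓ < L) (x r : ℕ) : bitAt L ℓ (sw3 L x) r = bitAt L ℓ x (swIdx3 r) :=
  bitAt_deltaSwap hℓ (by norm_num) (by decide +kernel)

theorem bitAt_swBase (hℓ : ℓ < L) (x r : ℕ) :
    bitAt L ℓ (swBase L x) r = bitAt L ℓ x (swIdxBase r) := by
  rw [swBase, bitAt_deltaSwap hℓ (by norm_num) (by decide +kernel),
    bitAt_deltaSwap hℓ (by norm_num) (by decide +kernel),
    bitAt_deltaSwap hℓ (by norm_num) (by decide +kernel),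
    bitAt_deltaSwap hℓ (by norm_num) (by decide +kernel)]
  rfl

theorem swIdx_lt : ∀ r < 32, swIdx0 r < 32 ∧ swIdx1 r < 32 ∧ swIdx2 r < 32 ∧ swIdx3 r < 32 := by
  decide +kernel

theorem bitAt_inRow1 (hℓ : ℓ < L) {x r : ℕ} (hr : r < 32)
    (h : bitAt L ℓ x (swIdx3 r ^^^ 16) = true) : bitAt L ℓ (inRow1 L x) r = true := by
  rw [inRow1, bitAt_sw3 hℓ]
  exact bitAt_swapHalves hℓ (swIdx_lt r hr).2.2.2 h

theorem bitAt_inRow2 (hℓ : ℓ < L) {x r : ℕ}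
    (h : bitAt L ℓ x (swIdx3 (swIdx2 r)) = true) : bitAt L ℓ (inRow2 L x) r = true := by
  rwa [inRow2, bitAt_sw2 hℓ, bitAt_sw3 hℓ]

theorem bitAt_inRow3 (hℓ : ℓ < L) {x r : ℕ} (hr : r < 32)
    (h : bitAt L ℓ x (swIdx3 (swIdx2 (swIdx1 r)) ^^^ 16) = true) :
    bitAt L ℓ (inRow3 L x) r = true := by
  rw [inRow3, bitAt_sw1 hℓ, bitAt_sw2 hℓ, bitAt_sw3 hℓ]
  have h1 := (swIdx_lt r hr).2.1
  have h2 := (swIdx_lt _ h1).2.2.1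
  exact bitAt_swapHalves hℓ (swIdx_lt _ h2).2.2.2 h

theorem bitAt_inRow4 (hℓ : ℓ < L) {x r : ℕ}
    (h : bitAt L ℓ x (swIdx3 (swIdx2 (swIdx1 (swIdx0 r)))) = true) :
    bitAt L ℓ (inRow4 L x) r = true := by
  rwa [inRow4, bitAt_sw0 hℓ, bitAt_sw1 hℓ, bitAt_sw2 hℓ, bitAt_sw3 hℓ]

theorem bitAt_outRow1 (hℓ : ℓ < L) {x r : ℕ} (hr : r < 32)
    (h : bitAt L ℓ x (swIdx3 (r ^^^ 16)) = true) : bitAt L ℓ (outRow1 L x) r = true := by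
  rw [outRow1]
  exact bitAt_swapHalves hℓ hr (by rwa [bitAt_sw3 hℓ])

theorem bitAt_outRow2 (hℓ : ℓ < L) {x r : ℕ}
    (h : bitAt L ℓ x (swIdx2 (swIdx3 r)) = true) : bitAt L ℓ (outRow2 L x) r = true := by
  rwa [outRow2, bitAt_sw3 hℓ, bitAt_sw2 hℓ]

theorem bitAt_outRow3 (hℓ : ℓ < L) {x r : ℕ} (hr : r < 32)
    (h : bitAt L ℓ x (swIdx1 (swIdx2 (swIdx3 (r ^^^ 16)))) = true) :
    bitAt L ℓ (outRow3 L x) r = true := by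
  rw [outRow3]
  exact bitAt_swapHalves hℓ hr (by rwa [bitAt_sw3 hℓ, bitAt_sw2 hℓ, bitAt_sw1 hℓ])

theorem bitAt_outRow4 (hℓ : ℓ < L) {x r : ℕ}
    (h : bitAt L ℓ x (swIdx0 (swIdx1 (swIdx2 (swIdx3 r)))) = true) :
    bitAt L ℓ (outRow4 L x) r = true := by
  rwa [outRow4, bitAt_sw3 hℓ, bitAt_sw2 hℓ, bitAt_sw1 hℓ, bitAt_sw0 hℓ]

/-- The signs of the first row, as bits of the flipping state. -/
def baseBits (v₁ v₂ v₃ v₄ v₅ : Bool) : ℕ :=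
  16 * v₁.toNat + 8 * (!v₂).toNat + 4 * v₃.toNat + 2 * (!v₄).toNat + v₅.toNat

theorem baseBits_lt : ∀ x₀ x₁ x₂ x₃ x₄ : Bool, baseBits x₀ x₁ x₂ x₃ x₄ < 32 := by decide

theorem row0_idx : ∀ v₁ v₂ v₃ v₄ v₅ : Bool,
    swIdxBase (baseBits v₁ v₂ v₃ v₄ v₅) = fieldOf v₁ v₂ v₃ v₄ v₅ ∧
    swIdxBase (fieldOf v₁ v₂ v₃ v₄ v₅) = baseBits v₁ v₂ v₃ v₄ v₅ := by decide +kernel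

def tournBit (a b c : Bool) : Bool := Bool.xor a (Bool.xor b c)

theorem row1_idx : ∀ v₁ v₂ v₃ v₄ v₅ w₂ w₃ w₄ w₅ : Bool,
    (baseBits v₁ v₂ v₃ v₄ v₅ ^^^ flipMask false false false false false false (tournBit w₅ v₁ v₅)
      (tournBit w₄ v₁ v₄) (tournBit w₃ v₁ v₃) (tournBit w₂ v₁ v₂) 4)
      = fieldOf v₁ w₂ w₃ w₄ w₅ ∧
    fieldOf v₁ w₂ w₃ w₄ w₅ =
      baseBits v₁ v₂ v₃ v₄ v₅ ^^^ flipMask false false false false false false (tournBit w₅ v₁ v₅)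
        (tournBit w₄ v₁ v₄) (tournBit w₃ v₁ v₃) (tournBit w₂ v₁ v₂) 4 := by
  decide +kernel

theorem row2_idx : ∀ v₁ v₂ v₃ v₄ v₅ w₁ w₃ w₄ w₅ : Bool,
    swIdx3 (baseBits v₁ v₂ v₃ v₄ v₅ ^^^ flipMask false false false (tournBit w₅ v₂ v₅)
      (tournBit w₄ v₂ v₄) (tournBit w₃ v₂ v₃) false false false (tournBit w₁ v₁ v₂) 3) ^^^ 16
      = fieldOf v₂ w₁ w₃ w₄ w₅ ∧
    swIdx3 ((fieldOf v₂ w₁ w₃ w₄ w₅) ^^^ 16) =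
      baseBits v₁ v₂ v₃ v₄ v₅ ^^^ flipMask false false false (tournBit w₅ v₂ v₅) (tournBit w₄ v₂ v₄)
        (tournBit w₃ v₂ v₃) false false false (tournBit w₁ v₁ v₂) 3 := by
  decide +kernel

theorem row3_idx : ∀ v₁ v₂ v₃ v₄ v₅ w₁ w₂ w₄ w₅ : Bool,
    swIdx3 (swIdx2 (baseBits v₁ v₂ v₃ v₄ v₅ ^^^ flipMask false (tournBit w₅ v₃ v₅)
      (tournBit w₄ v₃ v₄) false false (tournBit w₂ v₂ v₃) false false (tournBit w₁ v₁ v₃) false 2))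
      = fieldOf v₃ w₁ w₂ w₄ w₅ ∧
    swIdx2 (swIdx3 (fieldOf v₃ w₁ w₂ w₄ w₅)) =
      baseBits v₁ v₂ v₃ v₄ v₅ ^^^ flipMask false (tournBit w₅ v₃ v₅) (tournBit w₄ v₃ v₄) false false
        (tournBit w₂ v₂ v₃) false false (tournBit w₁ v₁ v₃) false 2 := by
  decide +kernel

theorem row4_idx : ∀ v₁ v₂ v₃ v₄ v₅ w₁ w₂ w₃ w₅ : Bool,
    swIdx3 (swIdx2 (swIdx1 (baseBits v₁ v₂ v₃ v₄ v₅ ^^^ flipMask (tournBit w₅ v₄ v₅) false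
      (tournBit w₃ v₃ v₄) false (tournBit w₂ v₂ v₄) false false (tournBit w₁ v₁ v₄) false
      false 1))) ^^^ 16
      = fieldOf v₄ w₁ w₂ w₃ w₅ ∧
    swIdx1 (swIdx2 (swIdx3 ((fieldOf v₄ w₁ w₂ w₃ w₅) ^^^ 16))) =
      baseBits v₁ v₂ v₃ v₄ v₅ ^^^ flipMask (tournBit w₅ v₄ v₅) false (tournBit w₃ v₃ v₄) false
        (tournBit w₂ v₂ v₄) false false (tournBit w₁ v₁ v₄) false false 1 := by
  decide +kernel

theorem row5_idx : ∀ v₁ v₂ v₃ v₄ v₅ w₁ w₂ w₃ w₄ : Bool,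
    swIdx3 (swIdx2 (swIdx1 (swIdx0 (baseBits v₁ v₂ v₃ v₄ v₅ ^^^ flipMask (tournBit w₄ v₄ v₅)
      (tournBit w₃ v₃ v₅) false (tournBit w₂ v₂ v₅) false false (tournBit w₁ v₁ v₅) false false
      false 0))))
      = fieldOf v₅ w₁ w₂ w₃ w₄ ∧
    swIdx0 (swIdx1 (swIdx2 (swIdx3 (fieldOf v₅ w₁ w₂ w₃ w₄)))) =
      baseBits v₁ v₂ v₃ v₄ v₅ ^^^ flipMask (tournBit w₄ v₄ v₅) (tournBit w₃ v₃ v₅) false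
        (tournBit w₂ v₂ v₅) false false (tournBit w₁ v₁ v₅) false false false 0 := by
  decide +kernel

end Transforms

theorem notAllEq_tournBit : ∀ a b c d e f : Bool,
    NotAllEq (Bool.xor a d) (!Bool.xor b e) (Bool.xor c f) →
      NotAllEq (tournBit d b c) (!tournBit e a c) (tournBit f a b) := by
  decide

theorem force_eq {α : Type} (x : ℕ) (k : ℕ → α) : force x k = k x := by
  rw [force]; cases Nat.beq x 0 <;> rfl

def lowFields : ℕ → ℕ
  | 0 => 0x55555555
  | 1 => 0x33333333
  | 2 => 0x0F0F0F0F
  | 3 => 0x00FF00FF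
  | _ => 0x0000FFFF

def highFields : ℕ → ℕ
  | 0 => 0xAAAAAAAA
  | 1 => 0xCCCCCCCC
  | 2 => 0xF0F0F0F0
  | 3 => 0xFF00FF00
  | _ => 0xFFFF0000

theorem testBit_lowFields : ∀ q < 5, ∀ r < 32,
    (lowFields q).testBit r = !r.testBit q ∧ (highFields q).testBit r = r.testBit q := by
  decide +kernel

theorem flipMask_lt (b10 b20 b21 b30 b31 b32 b40 b41 b42 b43 : Bool) (q : ℕ) :
    flipMask b10 b20 b21 b30 b31 b32 b40 b41 b42 b43 q < 32 := by
  have key : ∀ b10 b20 b21 b30 b31 b32 b40 b41 b42 b43 : Bool, ∀ q < 5,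
      flipMask b10 b20 b21 b30 b31 b32 b40 b41 b42 b43 q < 32 := by decide +kernel
  match q with
  | 0 => exact key b10 b20 b21 b30 b31 b32 b40 b41 b42 b43 0 (by norm_num)
  | 1 => exact key b10 b20 b21 b30 b31 b32 b40 b41 b42 b43 1 (by norm_num)
  | 2 => exact key b10 b20 b21 b30 b31 b32 b40 b41 b42 b43 2 (by norm_num)
  | 3 => exact key b10 b20 b21 b30 b31 b32 b40 b41 b42 b43 3 (by norm_num)
  | n + 4 => exact key b10 b20 b21 b30 b31 b32 b40 b41 b42 b43 4 (by norm_num)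

theorem revise_sound {α : Type} {L ℓ : ℕ} (hℓ : ℓ < L)
    {v01 v02 v03 v04 v05 v12 v13 v14 v15 v23 v24 v25 v34 v35 v45 : Bool}
    (g123 : NotAllEq (Bool.xor v01 v23) (!Bool.xor v02 v13) (Bool.xor v03 v12))
    (g124 : NotAllEq (Bool.xor v01 v24) (!Bool.xor v02 v14) (Bool.xor v04 v12))
    (g125 : NotAllEq (Bool.xor v01 v25) (!Bool.xor v02 v15) (Bool.xor v05 v12))
    (g134 : NotAllEq (Bool.xor v01 v34) (!Bool.xor v03 v14) (Bool.xor v04 v13))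
    (g135 : NotAllEq (Bool.xor v01 v35) (!Bool.xor v03 v15) (Bool.xor v05 v13))
    (g145 : NotAllEq (Bool.xor v01 v45) (!Bool.xor v04 v15) (Bool.xor v05 v14))
    (g234 : NotAllEq (Bool.xor v02 v34) (!Bool.xor v03 v24) (Bool.xor v04 v23))
    (g235 : NotAllEq (Bool.xor v02 v35) (!Bool.xor v03 v25) (Bool.xor v05 v23))
    (g245 : NotAllEq (Bool.xor v02 v45) (!Bool.xor v04 v25) (Bool.xor v05 v24))
    (g345 : NotAllEq (Bool.xor v03 v45) (!Bool.xor v04 v35) (Bool.xor v05 v34))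
    {x0 x1 x2 x3 x4 x5 : ℕ}
    (h0 : bitAt L ℓ x0 (fieldOf v01 v02 v03 v04 v05) = true)
    (h1 : bitAt L ℓ x1 (fieldOf v01 v12 v13 v14 v15) = true)
    (h2 : bitAt L ℓ x2 (fieldOf v02 v12 v23 v24 v25) = true)
    (h3 : bitAt L ℓ x3 (fieldOf v03 v13 v23 v34 v35) = true)
    (h4 : bitAt L ℓ x4 (fieldOf v04 v14 v24 v34 v45) = true)
    (h5 : bitAt L ℓ x5 (fieldOf v05 v15 v25 v35 v45) = true)
    (k : ℕ → ℕ → ℕ → ℕ → ℕ → ℕ → α) :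
    ∃ y0 y1 y2 y3 y4 y5, revise L x0 x1 x2 x3 x4 x5 k = k y0 y1 y2 y3 y4 y5 ∧
      bitAt L ℓ y0 (fieldOf v01 v02 v03 v04 v05) = true ∧
      bitAt L ℓ y1 (fieldOf v01 v12 v13 v14 v15) = true ∧
      bitAt L ℓ y2 (fieldOf v02 v12 v23 v24 v25) = true ∧
      bitAt L ℓ y3 (fieldOf v03 v13 v23 v34 v35) = true ∧
      bitAt L ℓ y4 (fieldOf v04 v14 v24 v34 v45) = true ∧
      bitAt L ℓ y5 (fieldOf v05 v15 v25 v35 v45) = true := by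
  obtain ⟨path, all⟩ := flipPath_of_transitive (tournBit v45 v04 v05) (tournBit v35 v03 v05)
    (tournBit v34 v03 v04) (tournBit v25 v02 v05) (tournBit v24 v02 v04) (tournBit v23 v02 v03)
    (tournBit v15 v01 v05) (tournBit v14 v01 v04) (tournBit v13 v01 v03) (tournBit v12 v01 v02)
    (notAllEq_tournBit _ _ _ _ _ _ g345) (notAllEq_tournBit _ _ _ _ _ _ g245)
    (notAllEq_tournBit _ _ _ _ _ _ g235) (notAllEq_tournBit _ _ _ _ _ _ g234)
    (notAllEq_tournBit _ _ _ _ _ _ g145) (notAllEq_tournBit _ _ _ _ _ _ g135)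
    (notAllEq_tournBit _ _ _ _ _ _ g134) (notAllEq_tournBit _ _ _ _ _ _ g125)
    (notAllEq_tournBit _ _ _ _ _ _ g124) (notAllEq_tournBit _ _ _ _ _ _ g123)
  set m := flipMask (tournBit v45 v04 v05) (tournBit v35 v03 v05)
    (tournBit v34 v03 v04) (tournBit v25 v02 v05) (tournBit v24 v02 v04) (tournBit v23 v02 v03)
    (tournBit v15 v01 v05) (tournBit v14 v01 v04) (tournBit v13 v01 v03) (tournBit v12 v01 v02)
    with hm
  set U := baseBits v01 v02 v03 v04 v05 with hU
  have hU' : U < 32 := baseBits_lt _ _ _ _ _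
  let T : ℕ → ℕ := fun q => match q with
    | 0 => inRow4 L x5
    | 1 => inRow3 L x4
    | 2 => inRow2 L x3
    | 3 => inRow1 L x2
    | _ => x1
  let a : ℕ → ℕ := fun q => Nat.land (T q) (fieldMask L (lowFields q) 32)
  let b : ℕ → ℕ := fun q => Nat.land (T q) (fieldMask L (highFields q) 32)
  obtain ⟨r1, r1'⟩ := row1_idx v01 v02 v03 v04 v05 v12 v13 v14 v15
  obtain ⟨r2, r2'⟩ := row2_idx v01 v02 v03 v04 v05 v12 v23 v24 v25
  obtain ⟨r3, r3'⟩ := row3_idx v01 v02 v03 v04 v05 v13 v23 v34 v35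
  obtain ⟨r4, r4'⟩ := row4_idx v01 v02 v03 v04 v05 v14 v24 v34 v45
  obtain ⟨r5, r5'⟩ := row5_idx v01 v02 v03 v04 v05 v15 v25 v35 v45
  change U ^^^ m 4 = _ at r1
  change _ = U ^^^ m 4 at r1'
  change swIdx3 (U ^^^ m 3) ^^^ 16 = _ at r2
  change _ = U ^^^ m 3 at r2'
  change swIdx3 (swIdx2 (U ^^^ m 2)) = _ at r3
  change _ = U ^^^ m 2 at r3'
  change swIdx3 (swIdx2 (swIdx1 (U ^^^ m 1))) ^^^ 16 = _ at r4
  change _ = U ^^^ m 1 at r4'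
  change swIdx3 (swIdx2 (swIdx1 (swIdx0 (U ^^^ m 0)))) = _ at r5
  change _ = U ^^^ m 0 at r5'
  have hlt : ∀ q, U ^^^ m q < 32 := fun q =>
    Nat.xor_lt_two_pow (n := 5) hU' (flipMask_lt _ _ _ _ _ _ _ _ _ _ q)
  have hT : ∀ q, bitAt L ℓ (T q) (U ^^^ m q) = true := fun q => by
    match q with
    | 0 => exact bitAt_inRow4 hℓ (by rw [r5]; exact h5)
    | 1 => exact bitAt_inRow3 hℓ (hlt 1) (by rw [r4]; exact h4)
    | 2 => exact bitAt_inRow2 hℓ (by rw [r3]; exact h3)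
    | 3 => exact bitAt_inRow1 hℓ (hlt 3) (by rw [r2]; exact h2)
    | n + 4 =>
      change bitAt L ℓ x1 (U ^^^ m 4) = true
      rw [r1]; exact h1
  have hpath := path.imp (Q := fun A q => bitAt L ℓ (T q) (U ^^^ A) = true)
    (fun A q h => by rw [← h]; exact hT q)
  have ha : ∀ q < 5, ∀ r < 32, bitAt L ℓ (T q) r = true → r.testBit q = false →
      bitAt L ℓ (a q) r = true := fun q hq r hr h hb => by
    rw [bitAt_land, h, bitAt_fieldMask hℓ, (testBit_lowFields q hq r hr).1, hb]
    simpa using hr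
  have hb : ∀ q < 5, ∀ r < 32, bitAt L ℓ (T q) r = true → r.testBit q = true →
      bitAt L ℓ (b q) r = true := fun q hq r hr h hb => by
    rw [bitAt_land, h, bitAt_fieldMask hℓ, (testBit_lowFields q hq r hr).2, hb]
    simpa using hr
  obtain ⟨r0, r0'⟩ := row0_idx v01 v02 v03 v04 v05
  have hD : bitAt L ℓ (swBase L x0) U = true := by rw [bitAt_swBase hℓ, r0]; exact h0
  have hbase := hpath.bitAt_outBase hℓ hU' ha hb (by rfl) hD
  have hrows := hpath.bitAt_outRow (D := swBase L x0) hℓ hU' ha hb _ (by norm_num) (by rfl)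
    (by rw [Nat.xor_zero]; exact hD)
  have hout : ∀ q < 5, bitAt L ℓ (outRow (fun q => Nat.mul (2 ^ q) L) a b (swBase L x0) q)
      (U ^^^ m q) = true := fun q hq => by
    obtain ⟨A, hA, h⟩ := path.exists_of_mem hrows (all q hq)
    rw [hA]; exact h
  refine ⟨swBase L (outBase (fun q => Nat.mul (2 ^ q) L) a b (swBase L x0)),
    outRow (fun q => Nat.mul (2 ^ q) L) a b (swBase L x0) 4,
    outRow1 L (outRow (fun q => Nat.mul (2 ^ q) L) a b (swBase L x0) 3),
    outRow2 L (outRow (fun q => Nat.mul (2 ^ q) L) a b (swBase L x0) 2),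
    outRow3 L (outRow (fun q => Nat.mul (2 ^ q) L) a b (swBase L x0) 1),
    outRow4 L (outRow (fun q => Nat.mul (2 ^ q) L) a b (swBase L x0) 0), ?_, ?_, ?_, ?_, ?_, ?_, ?_⟩
  · rw [revise, reviseRows]
    refine (reviseStage0_eq (fun q => Nat.mul (2 ^ q) L) a b (swBase L x0) _).trans ?_
    simp only [force_eq]
  · rw [bitAt_swBase hℓ, r0']; exact hbase
  · rw [r1']; exact hout 4 (by norm_num)
  · exact bitAt_outRow1 hℓ (fieldOf_lt _ _ _ _ _) (by rw [r2']; exact hout 3 (by norm_num))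
  · exact bitAt_outRow2 hℓ (by rw [r3']; exact hout 2 (by norm_num))
  · exact bitAt_outRow3 hℓ (fieldOf_lt _ _ _ _ _) (by rw [r4']; exact hout 1 (by norm_num))
  · exact bitAt_outRow4 hℓ (by rw [r5']; exact hout 0 (by norm_num))

theorem Trie.get_set (p : List Bool) (v : ℕ) (t : Trie) (q : List Bool) :
    (q = p ∧ (t.set p v).get q = v) ∨ (t.set p v).get q = t.get q := by
  induction p generalizing t q with
  | nil =>
    cases t with
    | leaf x =>
      cases q with
      | nil => exact Or.inl ⟨rfl, rfl⟩
      | cons b q => exact Or.inr rfl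
    | node l r => exact Or.inr rfl
  | cons b p ih =>
    cases t with
    | leaf x => exact Or.inr rfl
    | node l r =>
      cases q with
      | nil => cases b <;> exact Or.inr rfl
      | cons c q =>
        cases b <;> cases c
        · exact (ih l q).imp_left fun h => ⟨by rw [h.1], h.2⟩
        · exact Or.inr rfl
        · exact Or.inr rfl
        · exact (ih r q).imp_left fun h => ⟨by rw [h.1], h.2⟩

theorem Trie.focus_eq {α : Type} (p : List Bool) (t : Trie) (k : ℕ → (ℕ → Trie) → α) :
    t.focus p k = k (t.get p) fun v => t.set p v := by
  induction p generalizing t k with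
  | nil => cases t <;> rfl
  | cons b p ih =>
    cases t with
    | leaf x => rfl
    | node l r =>
      cases b
      · exact ih l _
      · exact ih r _

theorem Trie.focusRem_eq {α : Type} (s : List Bool) (t : Trie) :
    ∃ ys g, (∀ k : List ℕ → (List ℕ → Trie) → α, t.focusRem s k = k ys g) ∧
      (∀ i y, ys[i]? = some y → t.get (rem i s) = y) ∧
      ∀ vs q, (g vs).get q = t.get q ∨ ∃ i, q = rem i s ∧ vs[i]? = some ((g vs).get q) := by
  induction s generalizing t with
  | nil => exact ⟨[], fun _ => t, fun _ => rfl, fun i y h => by simp at h, fun _ _ => Or.inl rfl⟩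
  | cons b s ih =>
    cases t with
    | leaf x =>
      exact ⟨[], fun _ => .leaf x, fun _ => rfl, fun i y h => by simp at h, fun _ _ => Or.inl rfl⟩
    | node l r =>
      cases b
      · obtain ⟨ys, g, hk, hy, hg⟩ := ih l
        refine ⟨ys, fun vs => .node (g vs) r, fun k => hk _, hy, fun vs q => ?_⟩
        rcases q with _ | ⟨_ | _, q⟩
        · exact Or.inl rfl
        · exact (hg vs q).imp_right fun ⟨i, h, h'⟩ => ⟨i, congrArg (false :: ·) h, h'⟩
        · exact Or.inl rfl
      · obtain ⟨ys, g, hk, hy, hg⟩ := ih r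
        refine ⟨l.get s :: ys, fun vs => List.rec (motive := fun _ => Trie) (.node l r)
          (fun v vs _ => .node (l.set s v) (g vs)) vs,
          fun k => (focus_eq s l _).trans (hk _), ?_, fun vs q => ?_⟩
        · rintro (_ | i) y h
          · exact Option.some.inj h
          · exact hy i y h
        · rcases vs with _ | ⟨v, vs⟩
          · exact Or.inl rfl
          rcases q with _ | ⟨_ | _, q⟩
          · exact Or.inl rfl
          · exact (l.get_set s v q).symm.imp_right fun h =>
              ⟨0, congrArg (false :: ·) h.1, congrArg some h.2.symm⟩
          · exact (hg vs q).imp_right fun ⟨i, h, h'⟩ => ⟨i + 1, congrArg (true :: ·) h, h'⟩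

theorem rem_rem (s : List Bool) {i o : ℕ} (h : i ≤ o) :
    rem i (rem (o + 1) s) = rem o (rem i s) := by
  induction s generalizing i o with
  | nil => rfl
  | cons b s ih =>
    cases b
    · exact congrArg (false :: ·) (ih h)
    · cases i with
      | zero => rfl
      | succ i =>
        cases o with
        | zero => omega
        | succ o => exact congrArg (true :: ·) (ih (by omega))

theorem length_rem (o : ℕ) (s : List Bool) : (rem o s).length = s.length := by
  induction s generalizing o with
  | nil => rfl
  | cons b s ih =>
    cases b
    · exact congrArg (· + 1) (ih o)
    · cases o with
      | zero => rfl
      | succ o => exact congrArg (· + 1) (ih o)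

theorem count_rem {o : ℕ} {s : List Bool} (h : o < s.count true) :
    (rem o s).count true + 1 = s.count true := by
  induction s generalizing o with
  | nil => simp at h
  | cons b s ih =>
    cases b
    · rw [List.count_cons_of_ne (by decide)] at h ⊢
      rw [← ih h]
      exact congrArg (· + 1) (List.count_cons_of_ne (by decide))
    · rw [List.count_cons_self] at h ⊢
      cases o with
      | zero => exact congrArg (· + 1) (List.count_cons_of_ne (by decide))
      | succ o =>
        rw [← ih (by omega : o < s.count true)]
        exact congrArg (· + 1) List.count_cons_self

/-- `p` is the indicator list of a `k`-element subset of `{0, …, 11}`. -/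
def IsSubset (k : ℕ) (p : List Bool) : Prop := p.length = 12 ∧ p.count true = k

theorem IsSubset.rem {k o : ℕ} {p : List Bool} (h : IsSubset (k + 1) p) (ho : o < k + 1) :
    IsSubset k (rem o p) :=
  ⟨(length_rem o p).trans h.1, by
    have := count_rem (h.2 ▸ ho : o < p.count true); rw [h.2] at this; omega⟩

/-- The field index of the circuit signs on the five-element set `f`. -/
noncomputable def fieldAt (X : List Bool → Bool) (f : List Bool) : ℕ :=
  fieldOf (X (rem 0 f)) (X (rem 1 f)) (X (rem 2 f)) (X (rem 3 f)) (X (rem 4 f))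

/-- The three-term relations on the six-element set `s` involving its first element. -/
def GrassmannPlucker (X : List Bool → Bool) (s : List Bool) : Prop :=
  ∀ k l m, 0 < k → k < l → l < m → m < 6 →
    NotAllEq (Bool.xor (X (rem 0 (rem k s))) (X (rem l (rem m s))))
      (!Bool.xor (X (rem 0 (rem l s))) (X (rem k (rem m s))))
      (Bool.xor (X (rem 0 (rem m s))) (X (rem k (rem l s))))

/-- The field of `X` is still present, in lane `ℓ`, in each domain. -/
def Present (L ℓ : ℕ) (X : List Bool → Bool) (t : Trie) : Prop :=
  ∀ f, IsSubset 5 f → bitAt L ℓ (t.get f) (fieldAt X f) = true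

section Revision

variable {L ℓ : ℕ} {X : List Bool → Bool}

theorem reviseAt_sound {α : Type} (hℓ : ℓ < L) {s : List Bool} (hs : IsSubset 6 s)
    (hX : GrassmannPlucker X s) {t : Trie} (ht : Present L ℓ X t) (k : Trie → α) :
    ∃ t', Present L ℓ X t' ∧ reviseAt L s t k = k t' := by
  obtain ⟨ys, g, hk, hy, hg⟩ := t.focusRem_eq (α := α) s
  rw [reviseAt, hk]
  rcases ys with _ | ⟨x0, _ | ⟨x1, _ | ⟨x2, _ | ⟨x3, _ | ⟨x4, _ | ⟨x5, ys⟩⟩⟩⟩⟩⟩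
  iterate 6 exact ⟨t, ht, rfl⟩
  have e : ∀ i j, i ≤ j → rem j (rem i s) = rem i (rem (j + 1) s) := fun i j h => (rem_rem s h).symm
  have f0 : fieldAt X (rem 0 s) = fieldOf (X (rem 0 (rem 1 s))) (X (rem 0 (rem 2 s)))
      (X (rem 0 (rem 3 s))) (X (rem 0 (rem 4 s))) (X (rem 0 (rem 5 s))) := by
    rw [fieldAt, e 0 0, e 0 1, e 0 2, e 0 3, e 0 4] <;> norm_num
  have f1 : fieldAt X (rem 1 s) = fieldOf (X (rem 0 (rem 1 s))) (X (rem 1 (rem 2 s)))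
      (X (rem 1 (rem 3 s))) (X (rem 1 (rem 4 s))) (X (rem 1 (rem 5 s))) := by
    rw [fieldAt, e 1 1, e 1 2, e 1 3, e 1 4] <;> norm_num
  have f2 : fieldAt X (rem 2 s) = fieldOf (X (rem 0 (rem 2 s))) (X (rem 1 (rem 2 s)))
      (X (rem 2 (rem 3 s))) (X (rem 2 (rem 4 s))) (X (rem 2 (rem 5 s))) := by
    rw [fieldAt, e 2 2, e 2 3, e 2 4] <;> norm_num
  have f3 : fieldAt X (rem 3 s) = fieldOf (X (rem 0 (rem 3 s))) (X (rem 1 (rem 3 s)))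
      (X (rem 2 (rem 3 s))) (X (rem 3 (rem 4 s))) (X (rem 3 (rem 5 s))) := by
    rw [fieldAt, e 3 3, e 3 4] <;> norm_num
  have f4 : fieldAt X (rem 4 s) = fieldOf (X (rem 0 (rem 4 s))) (X (rem 1 (rem 4 s)))
      (X (rem 2 (rem 4 s))) (X (rem 3 (rem 4 s))) (X (rem 4 (rem 5 s))) := by
    rw [fieldAt, e 4 4]; norm_num
  have f5 : fieldAt X (rem 5 s) = fieldOf (X (rem 0 (rem 5 s))) (X (rem 1 (rem 5 s)))
      (X (rem 2 (rem 5 s))) (X (rem 3 (rem 5 s))) (X (rem 4 (rem 5 s))) := rfl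
  have hx : ∀ o x, o < 6 → (x0 :: x1 :: x2 :: x3 :: x4 :: x5 :: ys)[o]? = some x →
      bitAt L ℓ x (fieldAt X (rem o s)) = true := fun o x ho h => hy o x h ▸ ht _ (hs.rem ho)
  have g0 := hx 0 x0 (by norm_num) rfl
  have g1 := hx 1 x1 (by norm_num) rfl
  have g2 := hx 2 x2 (by norm_num) rfl
  have g3 := hx 3 x3 (by norm_num) rfl
  have g4 := hx 4 x4 (by norm_num) rfl
  have g5 := hx 5 x5 (by norm_num) rfl
  rw [f0] at g0
  rw [f1] at g1
  rw [f2] at g2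
  rw [f3] at g3
  rw [f4] at g4
  rw [f5] at g5
  obtain ⟨y0, y1, y2, y3, y4, y5, hk, h0, h1, h2, h3, h4, h5⟩ := revise_sound hℓ
    (hX 1 2 3 (by norm_num) (by norm_num) (by norm_num) (by norm_num))
    (hX 1 2 4 (by norm_num) (by norm_num) (by norm_num) (by norm_num))
    (hX 1 2 5 (by norm_num) (by norm_num) (by norm_num) (by norm_num))
    (hX 1 3 4 (by norm_num) (by norm_num) (by norm_num) (by norm_num))
    (hX 1 3 5 (by norm_num) (by norm_num) (by norm_num) (by norm_num))
    (hX 1 4 5 (by norm_num) (by norm_num) (by norm_num) (by norm_num))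
    (hX 2 3 4 (by norm_num) (by norm_num) (by norm_num) (by norm_num))
    (hX 2 3 5 (by norm_num) (by norm_num) (by norm_num) (by norm_num))
    (hX 2 4 5 (by norm_num) (by norm_num) (by norm_num) (by norm_num))
    (hX 3 4 5 (by norm_num) (by norm_num) (by norm_num) (by norm_num))
    g0 g1 g2 g3 g4 g5 fun y0 y1 y2 y3 y4 y5 =>
    k (g [y0, y1, y2, y3, y4, y5])
  refine ⟨_, fun f hf => ?_, hk⟩
  rw [← f0] at h0
  rw [← f1] at h1
  rw [← f2] at h2
  rw [← f3] at h3
  rw [← f4] at h4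
  rw [← f5] at h5
  rcases hg [y0, y1, y2, y3, y4, y5] f with h | ⟨i, rfl, h⟩
  · rw [h]; exact ht f hf
  · rcases i with _ | _ | _ | _ | _ | _ | i
    · rw [← Option.some.inj h]; exact h0
    · rw [← Option.some.inj h]; exact h1
    · rw [← Option.some.inj h]; exact h2
    · rw [← Option.some.inj h]; exact h3
    · rw [← Option.some.inj h]; exact h4
    · rw [← Option.some.inj h]; exact h5
    · cases h

theorem reviseAll_sound {α : Type} (hℓ : ℓ < L) (k : Trie → α) {l : List (List Bool)}
    (hl : ∀ s ∈ l, IsSubset 6 s ∧ GrassmannPlucker X s) {t : Trie} (ht : Present L ℓ X t) :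
    ∃ t', Present L ℓ X t' ∧ reviseAll L k l t = k t' := by
  induction l generalizing t with
  | nil => exact ⟨t, ht, rfl⟩
  | cons s l ih =>
    obtain ⟨hs, hX⟩ := hl s List.mem_cons_self
    obtain ⟨t', ht', e⟩ := reviseAt_sound hℓ hs hX ht (reviseAll L k l)
    obtain ⟨t'', ht'', e'⟩ := ih (fun s hs => hl s (List.mem_cons_of_mem _ hs)) ht'
    exact ⟨t'', ht'', (show reviseAll L k (s :: l) t = _ from e).trans e'⟩

theorem bitAt_foldFields {x r : ℕ} (hr : r < 32) (h : bitAt L ℓ x r = true) :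
    bitAt L ℓ (foldFields L x) 0 = true := by
  have key : ∀ r < 32, r = 0 + (r.testBit 0).toNat * 1 + (r.testBit 1).toNat * 2 +
      (r.testBit 2).toNat * 4 + (r.testBit 3).toNat * 8 + (r.testBit 4).toNat * 16 := by decide
  have step : ∀ d (b : Bool) (x r : ℕ), bitAt L ℓ x (r + b.toNat * d) = true →
      bitAt L ℓ (Nat.lor x (Nat.shiftRight x (Nat.mul d L))) r = true := fun d b x r h => by
    rw [bitAt_lor, bitAt_shiftRight]
    cases b
    · simp at h; rw [h]; rfl
    · simp at h; rw [h, Bool.or_true]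
  rw [key r hr] at h
  exact step 1 _ _ _ (step 2 _ _ _ (step 4 _ _ _ (step 8 _ _ _ (step 16 _ _ _ h))))

theorem bitAt_alive {t : Trie} (ht : Present L ℓ X t) {l : List (List Bool)}
    (hl : ∀ f ∈ l, IsSubset 5 f) {x : ℕ} (hx : bitAt L ℓ x 0 = true) :
    bitAt L ℓ (alive L t l x) 0 = true := by
  induction l with
  | nil => exact hx
  | cons f l ih =>
    have e : alive L t (f :: l) x = Nat.land (foldFields L (t.get f)) (alive L t l x) := rfl
    rw [e, bitAt_land, ih fun f hf => hl f (List.mem_cons_of_mem _ hf),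
      bitAt_foldFields (fieldOf_lt _ _ _ _ _) (ht f (hl f List.mem_cons_self))]
    rfl

end Revision

theorem get_mkTrie (n : ℕ) (g : List Bool → ℕ) (p : List Bool) (hp : p.length = n) :
    (mkTrie n g).get p = g p := by
  induction n generalizing g p with
  | zero => rw [List.length_eq_zero_iff.1 hp]; rfl
  | succ n ih =>
    cases p with
    | nil => cases hp
    | cons b p =>
      have hp' : p.length = n := Nat.succ_injective hp
      cases b
      · exact ih (fun p => g (false :: p)) p hp'
      · exact ih (fun p => g (true :: p)) p hp'

theorem restrict_eq {α : Type} (P : Trie) (p : List Bool) (x : ℕ) (k : Trie → α) :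
    P.restrict p x k = k (P.set p (Nat.land (P.get p) x)) :=
  (P.focus_eq p _).trans (force_eq _ _)

section Domains

variable {L ℓ : ℕ} {X : List Bool → Bool}

theorem exists_repunit (_hL : 0 < L) (n : ℕ) :
    ∃ C, 2 ^ (n * L) - 1 = (2 ^ L - 1) * C ∧
      ∀ x < 2 ^ L, ∀ ℓ < L, ∀ r < n, (x * C).testBit (r * L + ℓ) = x.testBit ℓ := by
  induction n with
  | zero => exact ⟨0, by simp, fun _ _ _ _ r hr => absurd hr (Nat.not_lt_zero r)⟩
  | succ n ih =>
    obtain ⟨C, hC, h⟩ := ih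
    refine ⟨2 ^ L * C + 1, ?_, fun x hx ℓ hℓ r hr => ?_⟩
    · have h1 : 1 ≤ 2 ^ L := Nat.one_le_two_pow
      have h2 : 1 ≤ 2 ^ (n * L) := Nat.one_le_two_pow
      have h3 : 2 ^ ((n + 1) * L) = 2 ^ L * 2 ^ (n * L) := by rw [← pow_add]; congr 1; ring
      obtain ⟨a, ha⟩ := Nat.exists_eq_add_of_le h1
      obtain ⟨b, hb⟩ := Nat.exists_eq_add_of_le h2
      rw [h3, ha, hb]
      rw [ha, hb, Nat.add_sub_cancel_left, Nat.add_sub_cancel_left] at hC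
      rw [hC, Nat.add_sub_cancel_left]
      rw [show (1 + a) * (1 + a * C) = 1 + a * ((1 + a) * C + 1) by ring, Nat.add_sub_cancel_left]
    · rw [show x * (2 ^ L * C + 1) = 2 ^ L * (x * C) + x by ring, Nat.testBit_two_pow_mul_add _ hx]
      cases r with
      | zero => simp [hℓ]
      | succ r =>
        have h1 : ¬ (r + 1) * L + ℓ < L := by rw [Nat.add_mul]; omega
        have h2 : (r + 1) * L + ℓ - L = r * L + ℓ := by rw [Nat.add_mul]; omega
        rw [if_neg h1, h2]
        exact h x hx ℓ hℓ r (by omega)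

theorem bitAt_mul_copies (hℓ : ℓ < L) {x r : ℕ} (hx : x < 2 ^ L) (hr : r < 32) :
    bitAt L ℓ (Nat.mul x (copies L)) r = x.testBit ℓ := by
  have hL : 0 < L := by omega
  obtain ⟨C, hC, h⟩ := exists_repunit hL 32
  have h1 : 0 < 2 ^ L - 1 := by
    have : 2 ^ 1 ≤ 2 ^ L := Nat.pow_le_pow_right (by norm_num) hL
    omega
  have h2 : copies L = C := by
    change (2 ^ (32 * L) - 1) / (2 ^ L - 1) = C
    rw [hC, Nat.mul_div_cancel_left _ h1]
  rw [h2]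
  exact h x hx ℓ hℓ r hr

theorem bitAt_signFields (hℓ : ℓ < L) {R r : ℕ} {P : Trie} (hP : ∀ p, P.get p < 2 ^ L)
    {p : List Bool} (hX : (P.get (X p :: p)).testBit ℓ = true) (hr : r < 32)
    (hR : R.testBit r = X p) : bitAt L ℓ (signFields L R P p) r = true := by
  rw [signFields, bitAt_lor, bitAt_land, bitAt_land, bitAt_mul_copies hℓ (hP _) hr,
    bitAt_mul_copies hℓ (hP _) hr, bitAt_fieldMask hℓ, bitAt_fieldMask hℓ]
  have h1 : (Nat.xor 0xFFFFFFFF R).testBit r = !X p := by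
    have : Nat.xor 0xFFFFFFFF R = 0xFFFFFFFF ^^^ R := rfl
    have h2 : ∀ r < 32, Nat.testBit 0xFFFFFFFF r = true := by decide
    rw [this, Nat.testBit_xor, hR, h2 r hr, Bool.true_xor]
  rw [h1, hR]
  cases h : X p <;> rw [h] at hX <;> simp [hX, hr]

theorem bitAt_fieldPair (hℓ : ℓ < L) {r j : ℕ} (hj : j < 32) (h0 : j ≠ r) (h1 : j ≠ r + 16) :
    bitAt L ℓ (fieldPair L r) j = true := by
  have h2 : bitAt L ℓ (Nat.sub (Nat.pow 2 (Nat.mul 32 L)) 1) j = true := by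
    rw [bitAt, testBit_ones, decide_eq_true_eq]
    change j * L + ℓ < 32 * L
    have : (j + 1) * L ≤ 32 * L := Nat.mul_le_mul_right _ hj
    nlinarith
  rw [fieldPair, bitAt_xor, h2, bitAt_shiftLeft hℓ, bitAt_fieldMask hℓ]
  have key : ∀ i < 32, Nat.testBit 0x10001 i = true → i = 0 ∨ i = 16 := by decide
  rw [Bool.true_xor, Bool.not_eq_true']
  by_contra h
  simp only [Bool.not_eq_false, Bool.and_eq_true, decide_eq_true_eq] at h
  have := key _ h.2.1 h.2.2
  omega

theorem fieldOf_testBit : ∀ x₀ x₁ x₂ x₃ x₄ : Bool,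
    Nat.testBit 0xFFFF0000 (fieldOf x₀ x₁ x₂ x₃ x₄) = x₀ ∧
    Nat.testBit 0xFF0000FF (fieldOf x₀ x₁ x₂ x₃ x₄) = x₁ ∧
    Nat.testBit 0x0F0FF0F0 (fieldOf x₀ x₁ x₂ x₃ x₄) = x₂ ∧
    Nat.testBit 0xCCCC3333 (fieldOf x₀ x₁ x₂ x₃ x₄) = x₃ ∧
    Nat.testBit 0x5555AAAA (fieldOf x₀ x₁ x₂ x₃ x₄) = x₄ := by
  decide +kernel

theorem bitAt_dom (hℓ : ℓ < L) {P : Trie} (hP : ∀ p, P.get p < 2 ^ L)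
    (hX : ∀ p, IsSubset 4 p → (P.get (X p :: p)).testBit ℓ = true) {f : List Bool}
    (hf : IsSubset 5 f) (h0 : fieldAt X f ≠ 0) (h1 : fieldAt X f ≠ 16) :
    bitAt L ℓ (dom L P f) (fieldAt X f) = true := by
  have hr : fieldAt X f < 32 := fieldOf_lt _ _ _ _ _
  obtain ⟨r0, r1, r2, r3, r4⟩ := fieldOf_testBit (X (rem 0 f)) (X (rem 1 f)) (X (rem 2 f))
    (X (rem 3 f)) (X (rem 4 f))
  rw [dom, bitAt_land, bitAt_land, bitAt_land, bitAt_land, bitAt_land, bitAt_fieldPair hℓ hr h0 h1,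
    bitAt_signFields hℓ hP (hX _ (hf.rem (by norm_num : 0 < 5))) hr r0,
    bitAt_signFields hℓ hP (hX _ (hf.rem (by norm_num : 1 < 5))) hr r1,
    bitAt_signFields hℓ hP (hX _ (hf.rem (by norm_num : 2 < 5))) hr r2,
    bitAt_signFields hℓ hP (hX _ (hf.rem (by norm_num : 3 < 5))) hr r3,
    bitAt_signFields hℓ hP (hX _ (hf.rem (by norm_num : 4 < 5))) hr r4]
  rfl

theorem present_mkTrie (hℓ : ℓ < L) {P : Trie} (hP : ∀ p, P.get p < 2 ^ L)
    (hX : ∀ p, IsSubset 4 p → (P.get (X p :: p)).testBit ℓ = true)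
    (hacyc : ∀ f, IsSubset 5 f → fieldAt X f ≠ 0 ∧ fieldAt X f ≠ 16) :
    Present L ℓ X (mkTrie 12 (dom L P)) := fun f hf => by
  rw [get_mkTrie 12 _ f hf.1]
  exact bitAt_dom hℓ hP hX hf (hacyc f hf).1 (hacyc f hf).2

/-- The circuit on `T ∪ G` does not separate `T` from `G`. -/
def NotSeparating (X : List Bool → Bool) (T G : ℕ) : Prop :=
  fieldAt X (pathOf 12 (Nat.lor T G)) ≠ relCode T (elemMasks (pathOf 12 (Nat.lor T G))) ∧
  fieldAt X (pathOf 12 (Nat.lor T G)) ≠ relCode T (elemMasks (pathOf 12 (Nat.lor T G))) + 16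

theorem Present.restrict {t : Trie} (h : Present L ℓ X t) {p : List Bool} {x : ℕ}
    (hx : bitAt L ℓ x (fieldAt X p) = true) : Present L ℓ X (t.set p (Nat.land (t.get p) x)) :=
  fun f hf => by
  rcases t.get_set p (Nat.land (t.get p) x) f with ⟨rfl, hq⟩ | hq
  · rw [hq, bitAt_land, h f hf, hx]; rfl
  · rw [hq]; exact h f hf

theorem clearEdges_sound {α : Type} (hℓ : ℓ < L) (T : ℕ) (k : Trie → α) {l : List ℕ}
    (hl : ∀ G ∈ l, Nat.land T G = 0 → NotSeparating X T G) {t : Trie} (ht : Present L ℓ X t) :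
    ∃ t', Present L ℓ X t' ∧ clearEdges L T k l t = k t' := by
  induction l generalizing t with
  | nil => exact ⟨t, ht, rfl⟩
  | cons G l ih =>
    have step : clearEdges L T k (G :: l) t = cond (Nat.beq (Nat.land T G) 0)
      (t.restrict (pathOf 12 (Nat.lor T G))
        (fieldPair L (relCode T (elemMasks (pathOf 12 (Nat.lor T G))))) (clearEdges L T k l))
      (clearEdges L T k l t) := rfl
    have ih' := fun {t} => ih (t := t) fun G hG => hl G (List.mem_cons_of_mem _ hG)
    rw [step]
    cases h : Nat.beq (Nat.land T G) 0
    · exact ih' ht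
    · obtain ⟨h0, h1⟩ := hl G List.mem_cons_self (Nat.eq_of_beq_eq_true h)
      rw [cond_true, restrict_eq]
      exact ih' (ht.restrict (bitAt_fieldPair hℓ (fieldOf_lt _ _ _ _ _) h0 h1))

theorem clearFacets_sound {α : Type} (hℓ : ℓ < L) (k : Trie → α) {l : List ℕ}
    (hl : ∀ T ∈ l, ∀ G ∈ edgeMasks, Nat.land T G = 0 → NotSeparating X T G) {t : Trie}
    (ht : Present L ℓ X t) : ∃ t', Present L ℓ X t' ∧ clearFacets L k l t = k t' := by
  induction l generalizing t with
  | nil => exact ⟨t, ht, rfl⟩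
  | cons T l ih =>
    obtain ⟨t', ht', e⟩ := clearEdges_sound hℓ T (clearFacets L k l) (hl T List.mem_cons_self) ht
    obtain ⟨t'', ht'', e'⟩ := ih (fun T hT => hl T (List.mem_cons_of_mem _ hT)) ht'
    exact ⟨t'', ht'', (show clearFacets L k (T :: l) t = _ from e).trans e'⟩

end Domains

noncomputable def batchesLt (n : ℕ) (c : Cert) : Bool :=
  Cert.rec (fun b => Nat.blt b n) (fun _ _ _ h₀ h₁ => and h₀ h₁) c

/-- The signs `X` lead to lane `ℓ` among the leaves of batch `b`. -/
def ReachesLane (X : List Bool → Bool) (b : ℕ) : Cert → ℕ → Prop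
  | .leaf b', ℓ => b' = b ∧ ℓ = 0
  | .node v c₀ c₁, ℓ => (X (pathOf 12 v) = false ∧ ReachesLane X b c₀ ℓ) ∨
      (X (pathOf 12 v) = true ∧ ∃ ℓ', ℓ = cnt b c₀ + ℓ' ∧ ReachesLane X b c₁ ℓ')

section Lanes

variable {X : List Bool → Bool} {b : ℕ}

theorem cnt_node (v : ℕ) (c₀ c₁ : Cert) : cnt b (.node v c₀ c₁) = cnt b c₀ + cnt b c₁ := rfl

theorem ReachesLane.lt_cnt {c : Cert} {ℓ : ℕ} (h : ReachesLane X b c ℓ) : ℓ < cnt b c := by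
  induction c generalizing ℓ with
  | leaf b' =>
    have e : cnt b (.leaf b') = cond (Nat.beq b' b) 1 0 := rfl
    rw [e, h.1, h.2, Nat.beq_refl]
    exact Nat.one_pos
  | node v c₀ c₁ ih₀ ih₁ =>
    rw [cnt_node]
    rcases h with ⟨-, h⟩ | ⟨-, ℓ', rfl, h⟩
    · have := ih₀ h; omega
    · have := ih₁ h; omega

theorem exists_reachesLane {n : ℕ} {c : Cert} (h : batchesLt n c = true) :
    ∃ b < n, ∃ ℓ, ReachesLane X b c ℓ := by
  induction c with
  | leaf b => exact ⟨b, Nat.le_of_ble_eq_true h, 0, rfl, rfl⟩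
  | node v c₀ c₁ ih₀ ih₁ =>
    have h' : (batchesLt n c₀ && batchesLt n c₁) = true := h
    rw [Bool.and_eq_true] at h'
    cases hv : X (pathOf 12 v)
    · obtain ⟨b, hb, ℓ, hℓ⟩ := ih₀ h'.1
      exact ⟨b, hb, ℓ, Or.inl ⟨hv, hℓ⟩⟩
    · obtain ⟨b, hb, ℓ, hℓ⟩ := ih₁ h'.2
      exact ⟨b, hb, _, Or.inr ⟨hv, ℓ, rfl, hℓ⟩⟩

theorem testBit_keep {n lo m ℓ : ℕ} (hn : ℓ < n) (h : ¬ (lo ≤ ℓ ∧ ℓ < lo + m)) :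
    (keep n lo m).testBit ℓ = true := by
  have e : keep n lo m = Nat.sub (Nat.pow 2 n) 1 ^^^ (Nat.sub (Nat.pow 2 m) 1) <<< lo := rfl
  rw [e, Nat.testBit_xor, testBit_ones, Nat.testBit_shiftLeft, testBit_ones]
  have h2 : (decide (ℓ ≥ lo) && decide (ℓ - lo < m)) = false := by
    rw [Bool.and_eq_false_iff, decide_eq_false_iff_not, decide_eq_false_iff_not]
    omega
  rw [h2, decide_eq_true hn]; rfl

/-- The sign domains `P` are bounded and lane `ℓ` allows the signs of `X`. -/
def Allows (X : List Bool → Bool) (L ℓ : ℕ) (P : Trie) : Prop :=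
  (∀ p, P.get p < 2 ^ L) ∧ ∀ p, IsSubset 4 p → (P.get (X p :: p)).testBit ℓ = true

theorem Allows.restrict {L ℓ : ℕ} {P : Trie} (h : Allows X L ℓ P) {s : Bool} {p : List Bool}
    {x : ℕ} (hx : X p = s → x.testBit ℓ = true) :
    Allows X L ℓ (P.set (s :: p) (Nat.land (P.get (s :: p)) x)) := by
  refine ⟨fun q => ?_, fun q hq => ?_⟩
  · rcases P.get_set (s :: p) (Nat.land (P.get (s :: p)) x) q with ⟨-, e⟩ | e
    · rw [e]; exact Nat.and_le_left.trans_lt (h.1 _)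
    · rw [e]; exact h.1 q
  · rcases P.get_set (s :: p) (Nat.land (P.get (s :: p)) x) (X q :: q) with ⟨e', e⟩ | e
    · obtain ⟨h1, h2⟩ := List.cons_eq_cons.1 e'
      have h3 := h.2 q hq
      rw [e, show Nat.land (P.get (s :: p)) x = P.get (s :: p) &&& x from rfl, Nat.testBit_and,
        hx (h2 ▸ h1), ← e', h3]
      rfl
    · rw [e]; exact h.2 q hq

theorem restrictions_sound {α : Type} {L n ℓ : ℕ} (hn : ℓ < n) (c : Cert) (lo : ℕ)
    (hc : (lo ≤ ℓ ∧ ℓ < lo + cnt b c) → ∃ ℓ', ℓ = lo + ℓ' ∧ ReachesLane X b c ℓ')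
    {P : Trie} (hP : Allows X L ℓ P) (k : Trie → α) :
    ∃ P', Allows X L ℓ P' ∧ restrictions b n c lo P k = k P' := by
  induction c generalizing lo P k with
  | leaf b' => exact ⟨P, hP, rfl⟩
  | node v c₀ c₁ ih₀ ih₁ =>
    have step : restrictions b n (.node v c₀ c₁) lo P k =
      cond (Nat.beq (Nat.add (cnt b c₀) (cnt b c₁)) 0) (k P)
      (P.restrict (true :: pathOf 12 v) (keep n lo (cnt b c₀)) fun P =>
        P.restrict (false :: pathOf 12 v) (keep n (Nat.add lo (cnt b c₀)) (cnt b c₁)) fun P =>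
        restrictions b n c₀ lo P fun P => restrictions b n c₁ (Nat.add lo (cnt b c₀)) P k) := rfl
    rw [step]
    cases Nat.beq (Nat.add (cnt b c₀) (cnt b c₁)) 0
    · rw [cond_false, restrict_eq, restrict_eq]
      rw [cnt_node] at hc
      have side : (X (pathOf 12 v) = true → ¬ (lo ≤ ℓ ∧ ℓ < lo + cnt b c₀)) ∧
          (X (pathOf 12 v) = false → ¬ (lo + cnt b c₀ ≤ ℓ ∧ ℓ < lo + cnt b c₀ + cnt b c₁)) := by
        constructor <;> intro hv h
        · obtain ⟨ℓ', e, ⟨h', -⟩ | ⟨-, ℓ'', e', -⟩⟩ := hc (by omega)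
          · rw [hv] at h'; cases h'
          · omega
        · obtain ⟨ℓ', e, ⟨-, h'⟩ | ⟨h', -⟩⟩ := hc (by omega)
          · have := h'.lt_cnt; omega
          · rw [hv] at h'; cases h'
      have hP₁ := hP.restrict (s := true) (p := pathOf 12 v) (x := keep n lo (cnt b c₀))
        fun hv => testBit_keep hn (side.1 hv)
      have hP₂ := hP₁.restrict (s := false) (p := pathOf 12 v)
        (x := keep n (Nat.add lo (cnt b c₀)) (cnt b c₁)) fun hv => testBit_keep hn (side.2 hv)
      obtain ⟨P', hP', e'⟩ := ih₀ lo (fun h => by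
        obtain ⟨ℓ', e, ⟨-, h'⟩ | ⟨h', -⟩⟩ := hc (by omega)
        · exact ⟨ℓ', e, h'⟩
        · exact absurd h (side.1 h')) hP₂
        fun P => restrictions b n c₁ (Nat.add lo (cnt b c₀)) P k
      obtain ⟨P'', hP'', e''⟩ := ih₁ (lo + cnt b c₀) (fun h => by
        obtain ⟨ℓ', e, ⟨h', -⟩ | ⟨-, ℓ'', e', h'⟩⟩ := hc (by omega)
        · exact absurd h (side.2 h')
        · exact ⟨ℓ'', by omega, h'⟩) hP' k
      exact ⟨P'', hP'', e'.trans e''⟩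
    · exact ⟨P, hP, rfl⟩

theorem get_mkTrie_lt (n : ℕ) (g : List Bool → ℕ) (p : List Bool) {B : ℕ} (hB : 0 < B)
    (hg : ∀ p, g p < B) : (mkTrie n g).get p < B := by
  induction n generalizing g p with
  | zero =>
    cases p with
    | nil => exact hg []
    | cons b p => exact hB
  | succ n ih =>
    cases p with
    | nil => exact hB
    | cons b p =>
      cases b
      · exact ih (fun p => g (false :: p)) p fun p => hg _
      · exact ih (fun p => g (true :: p)) p fun p => hg _

theorem isSubset_of_mem {n k : ℕ} {p : List Bool} (h : p ∈ subsets n k) :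
    p.length = n ∧ p.count true = k := by
  induction n generalizing k p with
  | zero =>
    cases k with
    | zero => rw [List.mem_singleton.1 (show p ∈ [[]] from h)]; exact ⟨rfl, rfl⟩
    | succ k => exact absurd (show p ∈ [] from h) List.not_mem_nil
  | succ n ih =>
    cases k with
    | zero =>
      obtain ⟨q, hq, rfl⟩ := List.mem_map.1 (show p ∈ (subsets n 0).map (false :: ·) from h)
      obtain ⟨h1, h2⟩ := ih hq
      exact ⟨by simp [h1], by simp [h2]⟩
    | succ k =>
      rcases List.mem_append.1 (show p ∈ (subsets n (k + 1)).map (false :: ·) ++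
        (subsets n k).map (true :: ·) from h) with h | h <;>
      · obtain ⟨q, hq, rfl⟩ := List.mem_map.1 h
        obtain ⟨h1, h2⟩ := ih hq
        exact ⟨by simp [h1], by simp [h2]⟩

/-- The properties of the signs of a normalized acyclic chirotope admissible for the complex. -/
structure Realizable (X : List Bool → Bool) : Prop where
  base : X (pathOf 12 0xF) = true
  acyclic : ∀ f, IsSubset 5 f → fieldAt X f ≠ 0 ∧ fieldAt X f ≠ 16
  grassmannPlucker : ∀ s, IsSubset 6 s → GrassmannPlucker X s
  notSeparating : ∀ T ∈ facetMasks, ∀ G ∈ edgeMasks, Nat.land T G = 0 → NotSeparating X T G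

theorem Realizable.check_eq_false (hX : Realizable X) {L r ℓ : ℕ} {c : Cert}
    (hc : ReachesLane X b c ℓ) : check c b L r = false := by
  rw [check]
  cases hL : Nat.ble (cnt b c) L
  · rfl
  have hcnt := Nat.le_of_ble_eq_true hL
  have hlt := hc.lt_cnt
  have hℓ : ℓ < L := hlt.trans_le hcnt
  rw [cond_true]
  have hmask : Nat.sub (Nat.pow 2 (cnt b c)) 1 < 2 ^ L := by
    have h1 : 2 ^ cnt b c ≤ 2 ^ L := Nat.pow_le_pow_right (by norm_num) hcnt
    have h2 : 0 < 2 ^ cnt b c := by positivity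
    change 2 ^ cnt b c - 1 < 2 ^ L
    omega
  have hstart : Allows X L ℓ ((mkTrie 13 fun _ => Nat.sub (Nat.pow 2 (cnt b c)) 1).set
      (false :: pathOf 12 0xF) 0) := by
    refine ⟨fun q => ?_, fun q hq => ?_⟩
    · rcases Trie.get_set (false :: pathOf 12 0xF) 0
        (mkTrie 13 fun _ => Nat.sub (Nat.pow 2 (cnt b c)) 1) q with ⟨-, e⟩ | e
      · rw [e]; positivity
      · rw [e]; exact get_mkTrie_lt _ _ _ (by positivity) fun _ => hmask
    · rcases Trie.get_set (false :: pathOf 12 0xF) 0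
        (mkTrie 13 fun _ => Nat.sub (Nat.pow 2 (cnt b c)) 1) (X q :: q) with ⟨e', -⟩ | e
      · obtain ⟨h1, rfl⟩ := List.cons_eq_cons.1 e'
        rw [hX.base] at h1
        cases h1
      · rw [e, get_mkTrie 13 _ _ (by rw [List.length_cons, hq.1]), testBit_ones]
        exact decide_eq_true hlt
  obtain ⟨P, hP, e⟩ := restrictions_sound hlt c 0 (fun _ => ⟨ℓ, (Nat.zero_add ℓ).symm, hc⟩) hstart
    fun P => clearFacets L (reviseAll L
        (fun t => Nat.beq (alive L t (subsets 12 5) (Nat.sub (Nat.pow 2 L) 1)) 0)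
        ((subsets 12 6 ++ (subsets 12 6 ++ subsets 12 6)).take r)) facetMasks
        (mkTrie 12 (dom L P))
  rw [e]
  obtain ⟨t, ht, e⟩ := clearFacets_sound hℓ (reviseAll L
    (fun t => Nat.beq (alive L t (subsets 12 5) (Nat.sub (Nat.pow 2 L) 1)) 0)
    ((subsets 12 6 ++ (subsets 12 6 ++ subsets 12 6)).take r)) hX.notSeparating
    (present_mkTrie hℓ hP.1 hP.2 hX.acyclic)
  rw [e]
  obtain ⟨t', ht', e⟩ := reviseAll_sound hℓ
    (fun t => Nat.beq (alive L t (subsets 12 5) (Nat.sub (Nat.pow 2 L) 1)) 0)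
    (l := (subsets 12 6 ++ (subsets 12 6 ++ subsets 12 6)).take r) (fun s hs => by
      have hs' : IsSubset 6 s := by
        rcases List.mem_append.1 (List.mem_of_mem_take hs) with h | h
        · exact isSubset_of_mem h
        · exact (List.mem_append.1 h).elim isSubset_of_mem isSubset_of_mem
      exact ⟨hs', hX.grassmannPlucker s hs'⟩) ht
  rw [e]
  have halive := bitAt_alive ht' (l := subsets 12 5) (fun f hf => isSubset_of_mem hf)
    (x := Nat.sub (Nat.pow 2 L) 1) (by rw [bitAt_ones hℓ]; rfl)
  cases h0 : Nat.beq (alive L t' (subsets 12 5) (Nat.sub (Nat.pow 2 L) 1)) 0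
  · rfl
  · rw [Nat.eq_of_beq_eq_true h0, bitAt, Nat.zero_testBit] at halive
    cases halive

end Lanes
/-- The elements, in decreasing order, of a set of positive naturals given by its indicator
list. -/
def elems : List Bool → List ℕ
  | [] => []
  | b :: p => cond b ((p.length + 1) :: elems p) (elems p)

theorem mem_elems {p : List Bool} {a : ℕ} (h : a ∈ elems p) : 1 ≤ a ∧ a ≤ p.length := by
  induction p with
  | nil => cases h
  | cons b p ih =>
    rw [List.length_cons]
    cases b
    · have := ih h; omega
    · rcases List.mem_cons.1 (show a ∈ (p.length + 1) :: elems p from h) with rfl | h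
      · omega
      · have := ih h; omega

theorem length_elems (p : List Bool) : (elems p).length = p.count true := by
  induction p with
  | nil => rfl
  | cons b p ih =>
    cases b
    · rw [List.count_cons_of_ne (by decide)]; exact ih
    · rw [List.count_cons_self]; exact congrArg (· + 1) ih

theorem elems_rem (o : ℕ) (p : List Bool) : elems (rem o p) = (elems p).eraseIdx o := by
  induction p generalizing o with
  | nil => rfl
  | cons b p ih =>
    cases b
    · exact ih o
    · cases o with
      | zero => rfl
      | succ o =>
        have h : elems (rem (o + 1) (true :: p)) = ((rem o p).length + 1) :: elems (rem o p) := rfl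
        rw [h, length_rem, ih]
        rfl

theorem pairwise_elems (p : List Bool) : (elems p).Pairwise (· > ·) := by
  induction p with
  | nil => exact List.Pairwise.nil
  | cons b p ih =>
    cases b
    · exact ih
    · exact List.pairwise_cons.2 ⟨fun a ha => Nat.lt_succ_of_le (mem_elems ha).2, ih⟩

theorem pathOf_succ (n m : ℕ) : pathOf (n + 1) m = m.testBit n :: pathOf n m := rfl

theorem length_pathOf (n m : ℕ) : (pathOf n m).length = n := by
  induction n with
  | zero => rfl
  | succ n ih => rw [pathOf_succ, List.length_cons, ih]

theorem mem_elems_pathOf {n m a : ℕ} :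
    a ∈ elems (pathOf n m) ↔ (1 ≤ a ∧ a ≤ n) ∧ m.testBit (a - 1) = true := by
  induction n with
  | zero =>
    constructor
    · intro h; cases h
    · intro h; omega
  | succ n ih =>
    rw [pathOf_succ]
    cases h : m.testBit n
    · rw [show elems (false :: pathOf n m) = elems (pathOf n m) from rfl, ih]
      constructor
      · rintro ⟨h1, h2⟩; exact ⟨by omega, h2⟩
      · rintro ⟨h1, h2⟩
        refine ⟨⟨h1.1, ?_⟩, h2⟩
        by_contra h3
        rw [show a - 1 = n by omega, h] at h2
        cases h2
    · rw [show elems (true :: pathOf n m) =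
        ((pathOf n m).length + 1) :: elems (pathOf n m) from rfl,
        List.mem_cons, ih, length_pathOf]
      constructor
      · rintro (rfl | ⟨h1, h2⟩)
        · exact ⟨by omega, h⟩
        · exact ⟨by omega, h2⟩
      · rintro ⟨h1, h2⟩
        by_cases h3 : a = n + 1
        · exact Or.inl h3
        · exact Or.inr ⟨by omega, h2⟩

theorem elemMasks_eq (p : List Bool) :
    elemMasks p = (elems p).map fun a => Nat.shiftLeft 1 (a - 1) := by
  induction p with
  | nil => rfl
  | cons b p ih =>
    cases b
    · exact ih
    · have h : elemMasks (true :: p) = Nat.shiftLeft 1 p.length :: elemMasks p := rfl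
      rw [h, ih]
      rfl

section Signs

variable {χ : ℕ → ℕ → ℕ → ℕ → ℤ}

/-- The signs of the increasing quadruples, normalized at the quadruple `1, 2, 3, 4`. -/
def signsOf (χ : ℕ → ℕ → ℕ → ℕ → ℤ) (p : List Bool) : Bool :=
  match elems p with
  | [a, b, c, d] => decide (χ 4 3 2 1 * χ a b c d = 1)
  | _ => false

theorem signsOf_eq {p : List Bool} {a b c d : ℕ} (h : elems p = [a, b, c, d]) :
    signsOf χ p = decide (χ 4 3 2 1 * χ a b c d = 1) := by
  rw [signsOf, h]

theorem notAllEq_of_pos {a b c d e f : ℤ} (ha : a = 1 ∨ a = -1) (hb : b = 1 ∨ b = -1)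
    (hc : c = 1 ∨ c = -1) (hd : d = 1 ∨ d = -1) (he : e = 1 ∨ e = -1) (hf : f = 1 ∨ f = -1)
    (h : ({1, -1} : Set ℤ) ⊆ {b * a, -(d * c), f * e}) :
    NotAllEq (Bool.xor (decide (a = 1)) (decide (b = 1)))
      (!Bool.xor (decide (c = 1)) (decide (d = 1)))
      (Bool.xor (decide (e = 1)) (decide (f = 1))) := by
  have h1 := h (Set.mem_insert 1 _)
  have h2 := h (Set.mem_insert_of_mem 1 (Set.mem_singleton (-1)))
  simp only [Set.mem_insert_iff, Set.mem_singleton_iff] at h1 h2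
  rcases ha with rfl | rfl <;> rcases hb with rfl | rfl <;> rcases hc with rfl | rfl <;>
  rcases hd with rfl | rfl <;> rcases he with rfl | rfl <;> rcases hf with rfl | rfl <;>
  first
    | (exfalso; revert h1; decide)
    | (exfalso; revert h2; decide)
    | (unfold NotAllEq; decide)

theorem notAllEq_of_neg {a b c d e f : ℤ} (ha : a = 1 ∨ a = -1) (hb : b = 1 ∨ b = -1)
    (hc : c = 1 ∨ c = -1) (hd : d = 1 ∨ d = -1) (he : e = 1 ∨ e = -1) (hf : f = 1 ∨ f = -1)
    (h : ({1, -1} : Set ℤ) ⊆ {-(b * a), d * c, -(f * e)}) :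
    NotAllEq (Bool.xor (decide (a = 1)) (decide (b = 1)))
      (!Bool.xor (decide (c = 1)) (decide (d = 1)))
      (Bool.xor (decide (e = 1)) (decide (f = 1))) := by
  have h1 := h (Set.mem_insert 1 _)
  have h2 := h (Set.mem_insert_of_mem 1 (Set.mem_singleton (-1)))
  refine notAllEq_of_pos ha hb hc hd he hf ?_
  simp only [Set.mem_insert_iff, Set.mem_singleton_iff] at h1 h2
  rintro x (rfl | rfl) <;> simp only [Set.mem_insert_iff, Set.mem_singleton_iff]
  · exact h2.imp (fun h => by linarith) (Or.imp (fun h => by linarith) fun h => by linarith)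
  · exact h1.imp (fun h => by linarith) (Or.imp (fun h => by linarith) fun h => by linarith)

theorem grassmannPlucker_fin {ψ : Fin 6 → Fin 6 → Fin 6 → Fin 6 → ℤ}
    (hψ : ∀ a b c d, a < b → b < c → c < d → ψ a b c d = 1 ∨ ψ a b c d = -1)
    (hs₁ : ∀ a b c d, ψ b a c d = -ψ a b c d) (hs₂ : ∀ a b c d, ψ a c b d = -ψ a b c d)
    (hs₃ : ∀ a b c d, ψ a b d c = -ψ a b c d)
    (gp : ∀ y₁ y₂ x₁ x₂ x₃ x₄, y₁ < y₂ → x₁ < x₂ → x₂ < x₃ → x₃ < x₄ →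
      (∀ y ∈ [y₁, y₂], ∀ x ∈ [x₁, x₂, x₃, x₄], x ≠ y) →
      ({1, -1} : Set ℤ) ⊆ {ψ y₁ y₂ x₁ x₂ * ψ y₁ y₂ x₃ x₄, -(ψ y₁ y₂ x₁ x₃ * ψ y₁ y₂ x₂ x₄),
        ψ y₁ y₂ x₁ x₄ * ψ y₁ y₂ x₂ x₃}) :
    NotAllEq (Bool.xor (decide (ψ 2 3 4 5 = 1)) (decide (ψ 0 1 4 5 = 1)))
      (!Bool.xor (decide (ψ 1 3 4 5 = 1)) (decide (ψ 0 2 4 5 = 1)))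
      (Bool.xor (decide (ψ 1 2 4 5 = 1)) (decide (ψ 0 3 4 5 = 1))) ∧
    NotAllEq (Bool.xor (decide (ψ 2 3 4 5 = 1)) (decide (ψ 0 1 3 5 = 1)))
      (!Bool.xor (decide (ψ 1 3 4 5 = 1)) (decide (ψ 0 2 3 5 = 1)))
      (Bool.xor (decide (ψ 1 2 3 5 = 1)) (decide (ψ 0 3 4 5 = 1))) ∧
    NotAllEq (Bool.xor (decide (ψ 2 3 4 5 = 1)) (decide (ψ 0 1 3 4 = 1)))
      (!Bool.xor (decide (ψ 1 3 4 5 = 1)) (decide (ψ 0 2 3 4 = 1)))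
      (Bool.xor (decide (ψ 1 2 3 4 = 1)) (decide (ψ 0 3 4 5 = 1))) ∧
    NotAllEq (Bool.xor (decide (ψ 2 3 4 5 = 1)) (decide (ψ 0 1 2 5 = 1)))
      (!Bool.xor (decide (ψ 1 2 4 5 = 1)) (decide (ψ 0 2 3 5 = 1)))
      (Bool.xor (decide (ψ 1 2 3 5 = 1)) (decide (ψ 0 2 4 5 = 1))) ∧
    NotAllEq (Bool.xor (decide (ψ 2 3 4 5 = 1)) (decide (ψ 0 1 2 4 = 1)))
      (!Bool.xor (decide (ψ 1 2 4 5 = 1)) (decide (ψ 0 2 3 4 = 1)))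
      (Bool.xor (decide (ψ 1 2 3 4 = 1)) (decide (ψ 0 2 4 5 = 1))) ∧
    NotAllEq (Bool.xor (decide (ψ 2 3 4 5 = 1)) (decide (ψ 0 1 2 3 = 1)))
      (!Bool.xor (decide (ψ 1 2 3 5 = 1)) (decide (ψ 0 2 3 4 = 1)))
      (Bool.xor (decide (ψ 1 2 3 4 = 1)) (decide (ψ 0 2 3 5 = 1))) ∧
    NotAllEq (Bool.xor (decide (ψ 1 3 4 5 = 1)) (decide (ψ 0 1 2 5 = 1)))
      (!Bool.xor (decide (ψ 1 2 4 5 = 1)) (decide (ψ 0 1 3 5 = 1)))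
      (Bool.xor (decide (ψ 1 2 3 5 = 1)) (decide (ψ 0 1 4 5 = 1))) ∧
    NotAllEq (Bool.xor (decide (ψ 1 3 4 5 = 1)) (decide (ψ 0 1 2 4 = 1)))
      (!Bool.xor (decide (ψ 1 2 4 5 = 1)) (decide (ψ 0 1 3 4 = 1)))
      (Bool.xor (decide (ψ 1 2 3 4 = 1)) (decide (ψ 0 1 4 5 = 1))) ∧
    NotAllEq (Bool.xor (decide (ψ 1 3 4 5 = 1)) (decide (ψ 0 1 2 3 = 1)))
      (!Bool.xor (decide (ψ 1 2 3 5 = 1)) (decide (ψ 0 1 3 4 = 1)))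
      (Bool.xor (decide (ψ 1 2 3 4 = 1)) (decide (ψ 0 1 3 5 = 1))) ∧
    NotAllEq (Bool.xor (decide (ψ 1 2 4 5 = 1)) (decide (ψ 0 1 2 3 = 1)))
      (!Bool.xor (decide (ψ 1 2 3 5 = 1)) (decide (ψ 0 1 2 4 = 1)))
      (Bool.xor (decide (ψ 1 2 3 4 = 1)) (decide (ψ 0 1 2 5 = 1))) := by
  have sw₁ : ∀ a b c d, a < b → ψ b a c d = -ψ a b c d := fun a b c d _ => hs₁ a b c d
  have sw₂ : ∀ a b c d, b < c → ψ a c b d = -ψ a b c d := fun a b c d _ => hs₂ a b c d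
  have sw₃ : ∀ a b c d, c < d → ψ a b d c = -ψ a b c d := fun a b c d _ => hs₃ a b c d
  have h0 := gp 4 5 0 1 2 3 (by decide) (by decide) (by decide) (by decide) (by decide)
  have h1 := gp 3 5 0 1 2 4 (by decide) (by decide) (by decide) (by decide) (by decide)
  have h2 := gp 3 4 0 1 2 5 (by decide) (by decide) (by decide) (by decide) (by decide)
  have h3 := gp 2 5 0 1 3 4 (by decide) (by decide) (by decide) (by decide) (by decide)
  have h4 := gp 2 4 0 1 3 5 (by decide) (by decide) (by decide) (by decide) (by decide)
  have h5 := gp 2 3 0 1 4 5 (by decide) (by decide) (by decide) (by decide) (by decide)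
  have h6 := gp 1 5 0 2 3 4 (by decide) (by decide) (by decide) (by decide) (by decide)
  have h7 := gp 1 4 0 2 3 5 (by decide) (by decide) (by decide) (by decide) (by decide)
  have h8 := gp 1 3 0 2 4 5 (by decide) (by decide) (by decide) (by decide) (by decide)
  have h9 := gp 1 2 0 3 4 5 (by decide) (by decide) (by decide) (by decide) (by decide)
  simp (disch := decide) only [sw₁, sw₂, sw₃, neg_mul, mul_neg, neg_neg]
    at h0 h1 h2 h3 h4 h5 h6 h7 h8 h9
  refine ⟨?_, ?_, ?_, ?_, ?_, ?_, ?_, ?_, ?_, ?_⟩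
  all_goals first
    | (refine notAllEq_of_pos ?_ ?_ ?_ ?_ ?_ ?_ (by assumption) <;>
        exact hψ _ _ _ _ (by decide) (by decide) (by decide))
    | (refine notAllEq_of_neg ?_ ?_ ?_ ?_ ?_ ?_ (by assumption) <;>
        exact hψ _ _ _ _ (by decide) (by decide) (by decide))

end Signs
section Realization

variable {χ : ℕ → ℕ → ℕ → ℕ → ℤ}

theorem IsSubset.mem_Icc {k : ℕ} {p : List Bool} (hp : IsSubset k p) {a : ℕ} (ha : a ∈ elems p) :
    a ∈ Icc 1 12 := by
  have := mem_elems ha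
  rw [hp.1] at this
  exact Finset.mem_Icc.2 this

theorem IsSubset.exists_elems {k : ℕ} {p : List Bool} (hp : IsSubset k p) :
    ∃ e : Fin k → ℕ, StrictAnti e ∧ (∀ i, e i ∈ Icc 1 12) ∧ elems p = List.ofFn e := by
  obtain rfl : (elems p).length = k := (length_elems p).trans hp.2
  exact ⟨(elems p).get, fun i j hij => List.pairwise_iff_get.1 (pairwise_elems p) i j hij,
    fun i => hp.mem_Icc (List.get_mem _ _), (List.ofFn_get _).symm⟩

theorem IsChirotope.sign_eq (h : IsChirotope (Icc 1 12) χ) {a b c d : ℕ} (ha : a ∈ Icc 1 12)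
    (hb : b ∈ Icc 1 12) (hc : c ∈ Icc 1 12) (hd : d ∈ Icc 1 12) (hab : b < a) (hbc : c < b)
    (hcd : d < c) : χ a b c d = 1 ∨ χ a b c d = -1 :=
  h.1 a ha b hb c hc d hd (by omega) (by omega) (by omega) (by omega) (by omega) (by omega)

theorem IsChirotope.sign_eq' (h : IsChirotope (Icc 1 12) χ) : χ 4 3 2 1 = 1 ∨ χ 4 3 2 1 = -1 :=
  h.sign_eq (by decide) (by decide) (by decide) (by decide) (by decide) (by decide) (by decide)

theorem IsChirotope.grassmannPlucker (h : IsChirotope (Icc 1 12) χ) {s : List Bool}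
    (hs : IsSubset 6 s) : GrassmannPlucker (signsOf χ) s := by
  obtain ⟨e, he, hE, hse⟩ := hs.exists_elems
  have hlt : ∀ {a b : Fin 6}, a < b → e b < e a := fun hab => he hab
  have hne : ∀ {a b : Fin 6}, a ≠ b → e a ≠ e b := fun hab => he.injective.ne hab
  have hsq : χ 4 3 2 1 * χ 4 3 2 1 = 1 := by rcases h.sign_eq' with h | h <;> rw [h] <;> rfl
  have key := grassmannPlucker_fin (ψ := fun a b c d => χ 4 3 2 1 * χ (e a) (e b) (e c) (e d))
    (fun a b c d hab hbc hcd => by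
      rcases h.sign_eq' with h1 | h1 <;> rcases h.sign_eq (hE a) (hE b) (hE c) (hE d) (hlt hab)
        (hlt hbc) (hlt hcd) with h2 | h2 <;> rw [h1, h2] <;> decide)
    (fun a b c d => by rw [h.2.1 _ (hE a) _ (hE b) _ (hE c) _ (hE d), mul_neg])
    (fun a b c d => by rw [h.2.2.1 _ (hE a) _ (hE b) _ (hE c) _ (hE d), mul_neg])
    (fun a b c d => by rw [h.2.2.2.1 _ (hE a) _ (hE b) _ (hE c) _ (hE d), mul_neg])
    (fun y₁ y₂ x₁ x₂ x₃ x₄ hy h12 h23 h34 hxy => by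
      have hmul : ∀ u v : ℤ, χ 4 3 2 1 * u * (χ 4 3 2 1 * v) = u * v := fun u v => by
        rw [mul_mul_mul_comm, hsq, one_mul]
      simp only [hmul]
      have n : ∀ y ∈ [y₁, y₂], ∀ x ∈ [x₁, x₂, x₃, x₄], e x ≠ e y := fun y hy x hx =>
        hne (hxy y hy x hx)
      exact h.2.2.2.2 _ (hE y₁) _ (hE y₂) _ (hE x₁) _ (hE x₂) _ (hE x₃) _ (hE x₄) (hne hy.ne)
        (hne h12.ne) (hne (h12.trans h23).ne) (hne (h12.trans (h23.trans h34)).ne) (hne h23.ne)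
        (hne (h23.trans h34).ne) (hne h34.ne) (n _ (by simp) _ (by simp))
        (n _ (by simp) _ (by simp))
        (n _ (by simp) _ (by simp)) (n _ (by simp) _ (by simp)) (n _ (by simp) _ (by simp))
        (n _ (by simp) _ (by simp)) (n _ (by simp) _ (by simp)) (n _ (by simp) _ (by simp)))
  have hse' : elems s = [e 0, e 1, e 2, e 3, e 4, e 5] := by
    rw [hse]; simp [List.ofFn_succ]
  have hX : ∀ i j (a b c d : Fin 6),
      ([e 0, e 1, e 2, e 3, e 4, e 5].eraseIdx j).eraseIdx i = [e a, e b, e c, e d] →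
      signsOf χ (rem i (rem j s)) = decide (χ 4 3 2 1 * χ (e a) (e b) (e c) (e d) = 1) :=
    fun i j a b c d h => signsOf_eq (by rw [elems_rem, elems_rem, hse', h])
  have r01 := hX 0 1 2 3 4 5 rfl
  have r02 := hX 0 2 1 3 4 5 rfl
  have r03 := hX 0 3 1 2 4 5 rfl
  have r04 := hX 0 4 1 2 3 5 rfl
  have r05 := hX 0 5 1 2 3 4 rfl
  have r12 := hX 1 2 0 3 4 5 rfl
  have r13 := hX 1 3 0 2 4 5 rfl
  have r14 := hX 1 4 0 2 3 5 rfl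
  have r15 := hX 1 5 0 2 3 4 rfl
  have r23 := hX 2 3 0 1 4 5 rfl
  have r24 := hX 2 4 0 1 3 5 rfl
  have r25 := hX 2 5 0 1 3 4 rfl
  have r34 := hX 3 4 0 1 2 5 rfl
  have r35 := hX 3 5 0 1 2 4 rfl
  have r45 := hX 4 5 0 1 2 3 rfl
  obtain ⟨k0, k1, k2, k3, k4, k5, k6, k7, k8, k9⟩ := key
  intro k l m hk hl hm hm6
  have hl2 : 2 ≤ l := by omega
  have hm3 : 3 ≤ m := by omega
  interval_cases m <;> interval_cases l <;> interval_cases k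
  · rw [r01, r23, r02, r13, r03, r12]; exact k0
  · rw [r01, r24, r02, r14, r04, r12]; exact k1
  · rw [r01, r34, r03, r14, r04, r13]; exact k3
  · rw [r02, r34, r03, r24, r04, r23]; exact k6
  · rw [r01, r25, r02, r15, r05, r12]; exact k2
  · rw [r01, r35, r03, r15, r05, r13]; exact k4
  · rw [r02, r35, r03, r25, r05, r23]; exact k7
  · rw [r01, r45, r04, r15, r05, r14]; exact k5
  · rw [r02, r45, r04, r25, r05, r24]; exact k8
  · rw [r03, r45, r04, r35, r05, r34]; exact k9

theorem IsChirotope.signsOf_base (h : IsChirotope (Icc 1 12) χ) :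
    signsOf χ (pathOf 12 0xF) = true := by
  rw [signsOf_eq (show elems (pathOf 12 0xF) = [4, 3, 2, 1] by decide +kernel)]
  rcases h.sign_eq' with h | h <;> rw [h] <;> decide

end Realization
section Circuits

variable {χ : ℕ → ℕ → ℕ → ℕ → ℤ}

/-- The sign of a circuit entry encoded by a bit, relative to the normalization of `signsOf`. -/
def circuitSign (χ : ℕ → ℕ → ℕ → ℕ → ℤ) (b : Bool) : ℤ := cond b (-χ 4 3 2 1) (χ 4 3 2 1)

theorem circuitSign_not (b : Bool) : circuitSign χ (!b) = -circuitSign χ b := by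
  cases b
  · rfl
  · exact (neg_neg _).symm

theorem IsChirotope.circuitSign_eq (h : IsChirotope (Icc 1 12) χ) (b : Bool) :
    circuitSign χ b = 1 ∨ circuitSign χ b = -1 := by
  rcases h.sign_eq' with h | h <;> cases b <;> simp [circuitSign, h]

theorem IsChirotope.circuitSign_decide (h : IsChirotope (Icc 1 12) χ) {x : ℤ}
    (hx : x = 1 ∨ x = -1) : circuitSign χ (decide (χ 4 3 2 1 * x = 1)) = -x := by
  rcases h.sign_eq' with h | h <;> rcases hx with rfl | rfl <;> simp [circuitSign, h]

theorem IsChirotope.reverse (h : IsChirotope (Icc 1 12) χ) {a b c d : ℕ} (ha : a ∈ Icc 1 12)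
    (hb : b ∈ Icc 1 12) (hc : c ∈ Icc 1 12) (hd : d ∈ Icc 1 12) : χ d c b a = χ a b c d := by
  obtain ⟨-, h₁, h₂, h₃, -⟩ := h
  rw [h₁ c hc d hd b hb a ha, h₂ c hc b hb d hd a ha, h₁ b hb c hc d hd a ha,
    h₃ b hb c hc a ha d hd, h₂ b hb a ha c hc d hd, h₁ a ha b hb c hc d hd]
  ring

theorem IsChirotope.exists_circuit (h : IsChirotope (Icc 1 12) χ) {f : List Bool}
    (hf : IsSubset 5 f) : ∃ e : Fin 5 → ℕ, StrictAnti e ∧ (∀ i, e i ∈ Icc 1 12) ∧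
      elems f = [e 0, e 1, e 2, e 3, e 4] ∧
      circSign χ (fun i => e i.rev) 4 = circuitSign χ (signsOf χ (rem 0 f)) ∧
      circSign χ (fun i => e i.rev) 3 = circuitSign χ (!signsOf χ (rem 1 f)) ∧
      circSign χ (fun i => e i.rev) 2 = circuitSign χ (signsOf χ (rem 2 f)) ∧
      circSign χ (fun i => e i.rev) 1 = circuitSign χ (!signsOf χ (rem 3 f)) ∧
      circSign χ (fun i => e i.rev) 0 = circuitSign χ (signsOf χ (rem 4 f)) := by
  obtain ⟨e, he, hE, hfe⟩ := hf.exists_elems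
  have hfe' : elems f = [e 0, e 1, e 2, e 3, e 4] := by
    rw [hfe]; simp [List.ofFn_succ]
  have hlt : ∀ {a b : Fin 5}, a < b → e b < e a := fun hab => he hab
  have key : ∀ o (a b c d : Fin 5), [e 0, e 1, e 2, e 3, e 4].eraseIdx o = [e a, e b, e c, e d] →
      a < b → b < c → c < d →
      circuitSign χ (signsOf χ (rem o f)) = -χ (e d) (e c) (e b) (e a) :=
    fun o a b c d ho hab hbc hcd => by
      rw [signsOf_eq (show elems (rem o f) = [e a, e b, e c, e d] by rw [elems_rem, hfe', ho]),
        h.circuitSign_decide (h.sign_eq (hE _) (hE _) (hE _) (hE _) (hlt hab) (hlt hbc) (hlt hcd)),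
        h.reverse (hE _) (hE _) (hE _) (hE _)]
  refine ⟨e, he, hE, hfe', ?_, ?_, ?_, ?_, ?_⟩
  · rw [key 0 1 2 3 4 rfl (by decide) (by decide) (by decide)]
    exact neg_one_mul _
  · rw [circuitSign_not, key 1 0 2 3 4 rfl (by decide) (by decide) (by decide), neg_neg]
    exact one_mul _
  · rw [key 2 0 1 3 4 rfl (by decide) (by decide) (by decide)]
    exact neg_one_mul _
  · rw [circuitSign_not, key 3 0 1 2 4 rfl (by decide) (by decide) (by decide), neg_neg]
    exact one_mul _
  · rw [key 4 0 1 2 3 rfl (by decide) (by decide) (by decide)]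
    exact neg_one_mul _

theorem eq_of_fieldOf_eq : ∀ x₀ x₁ x₂ x₃ x₄ : Bool,
    fieldOf x₀ x₁ x₂ x₃ x₄ = 0 ∨ fieldOf x₀ x₁ x₂ x₃ x₄ = 16 →
    (!x₁) = x₀ ∧ x₂ = x₀ ∧ (!x₃) = x₀ ∧ x₄ = x₀ := by decide

theorem IsChirotope.fieldAt_ne (h : IsChirotope (Icc 1 12) χ) (ha : IsAcyclic (Icc 1 12) χ)
    {f : List Bool} (hf : IsSubset 5 f) :
    fieldAt (signsOf χ) f ≠ 0 ∧ fieldAt (signsOf χ) f ≠ 16 := by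
  rw [← not_or]
  intro h16
  obtain ⟨e1, e2, e3, e4⟩ := eq_of_fieldOf_eq _ _ _ _ _ h16
  obtain ⟨e, he, hE, -, s0, s1, s2, s3, s4⟩ := h.exists_circuit hf
  refine ha (fun i => e i.rev) (fun i j hij => he (Fin.rev_lt_rev.2 hij)) (fun i => hE _) ?_
  rw [e1] at s1
  rw [e2] at s2
  rw [e3] at s3
  rw [e4] at s4
  have key : ∀ i, circSign χ (fun i => e i.rev) i = circuitSign χ (signsOf χ (rem 0 f)) := by
    intro i
    fin_cases i
    exacts [s4, s3, s2, s1, s0]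
  intro i j
  rw [key i, key j]

theorem land_shiftLeft_beq (T i : ℕ) :
    Nat.beq (Nat.land (Nat.shiftLeft 1 i) T) 0 = !T.testBit i := by
  have e : Nat.land (Nat.shiftLeft 1 i) T = 1 <<< i &&& T := rfl
  rw [e, Nat.one_shiftLeft, Nat.two_pow_and]
  cases T.testBit i
  · rfl
  · have : 0 < 2 ^ i := by positivity
    rw [Bool.toNat_true, Nat.mul_one, Bool.not_true]
    exact Bool.eq_false_iff.2 fun h => this.ne' (Nat.eq_of_beq_eq_true h)

/-- The code of a partition in terms of the bits telling which elements lie in the first part. -/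
def partitionCode (t₀ t₁ t₂ t₃ t₄ : Bool) : ℕ :=
  Nat.lor (cond t₀ (cond t₁ 0 8) (cond t₁ 8 0)) (Nat.lor (cond t₀ (cond t₂ 0 4) (cond t₂ 4 0))
    (Nat.lor (cond t₀ (cond t₃ 0 2) (cond t₃ 2 0))
      (Nat.lor (cond t₀ (cond t₄ 0 1) (cond t₄ 1 0)) 0)))

theorem relCode_shiftLeft (T a₀ a₁ a₂ a₃ a₄ : ℕ) :
    relCode T ([a₀, a₁, a₂, a₃, a₄].map (Nat.shiftLeft 1 ·)) = partitionCode (!T.testBit a₀)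
      (!T.testBit a₁) (!T.testBit a₂) (!T.testBit a₃) (!T.testBit a₄) := by
  simp only [← land_shiftLeft_beq]
  rfl

theorem eq_of_fieldOf_eq_partitionCode : ∀ x₀ x₁ x₂ x₃ x₄ t₀ t₁ t₂ t₃ t₄ : Bool,
    fieldOf x₀ x₁ x₂ x₃ x₄ = partitionCode t₀ t₁ t₂ t₃ t₄ ∨
      fieldOf x₀ x₁ x₂ x₃ x₄ = partitionCode t₀ t₁ t₂ t₃ t₄ + 16 →
    (!x₁) = Bool.xor (Bool.xor x₀ t₀) t₁ ∧ x₂ = Bool.xor (Bool.xor x₀ t₀) t₂ ∧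
    (!x₃) = Bool.xor (Bool.xor x₀ t₀) t₃ ∧ x₄ = Bool.xor (Bool.xor x₀ t₀) t₄ := by
  decide +kernel

/-- The set of positive naturals encoded by a bit mask. -/
def maskSet (m : ℕ) : Finset ℕ := (Icc 1 12).filter fun a => m.testBit (a - 1) = true

theorem mem_maskSet {m a : ℕ} : a ∈ maskSet m ↔ a ∈ Icc 1 12 ∧ m.testBit (a - 1) = true :=
  Finset.mem_filter

theorem facetMasks_mem : ∀ T ∈ facetMasks, maskSet T ∈ facetsM := by decide +kernel

theorem edgeMasks_subset :
    ∀ G ∈ edgeMasks, (maskSet G).card = 2 ∧ ∃ T ∈ facetsM, maskSet G ⊆ T := by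
  decide +kernel

theorem count_union : ∀ T ∈ facetMasks, ∀ G ∈ edgeMasks, Nat.land T G = 0 →
    (pathOf 12 (Nat.lor T G)).count true = 5 := by
  decide +kernel

theorem IsChirotope.notSeparating (h : IsChirotope (Icc 1 12) χ) (hadm : IsAdmissible facetsM χ)
    {T G : ℕ} (hT : T ∈ facetMasks) (hG : G ∈ edgeMasks) (hTG : Nat.land T G = 0) :
    NotSeparating (signsOf χ) T G := by
  rw [NotSeparating, ← not_or]
  intro hsep
  have hdisj : ∀ i, T.testBit i = true → G.testBit i = false := fun i hi => by
    have := congrArg (Nat.testBit · i) (show T &&& G = 0 from hTG)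
    simpa [hi] using this
  obtain ⟨e, he, hE, hfe, s0, s1, s2, s3, s4⟩ :=
    h.exists_circuit ⟨length_pathOf 12 (Nat.lor T G), count_union T hT G hG hTG⟩
  have hor : ∀ i, (Nat.lor T G).testBit i = (T.testBit i || G.testBit i) := Nat.testBit_or T G
  have hrel : relCode T (elemMasks (pathOf 12 (Nat.lor T G))) =
      partitionCode (!T.testBit (e 0 - 1)) (!T.testBit (e 1 - 1)) (!T.testBit (e 2 - 1))
        (!T.testBit (e 3 - 1)) (!T.testBit (e 4 - 1)) := by
    rw [elemMasks_eq, hfe]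
    exact relCode_shiftLeft T (e 0 - 1) (e 1 - 1) (e 2 - 1) (e 3 - 1) (e 4 - 1)
  rw [hrel] at hsep
  obtain ⟨e1, e2, e3, e4⟩ := eq_of_fieldOf_eq_partitionCode _ _ _ _ _ _ _ _ _ _ hsep
  rw [e1] at s1
  rw [e2] at s2
  rw [e3] at s3
  rw [e4] at s4
  generalize hu : Bool.xor (signsOf χ (rem 0 (pathOf 12 (Nat.lor T G)))) (!T.testBit (e 0 - 1)) = u
    at s1 s2 s3 s4
  have e0 : signsOf χ (rem 0 (pathOf 12 (Nat.lor T G))) = Bool.xor u (!T.testBit (e 0 - 1)) := by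
    rw [← hu, Bool.xor_assoc, Bool.xor_self, Bool.xor_false]
  rw [e0] at s0
  have key : ∀ i : Fin 5, circSign χ (fun i => e i.rev) i =
      circuitSign χ (Bool.xor u (!T.testBit (e i.rev - 1))) := by
    intro i
    fin_cases i
    exacts [s4, s3, s2, s1, s0]
  refine hadm (maskSet T) (facetMasks_mem T hT) (maskSet G) (edgeMasks_subset G hG).1
    (edgeMasks_subset G hG).2 ?_ (fun i => e i.rev) (fun i j hij => he (Fin.rev_lt_rev.2 hij)) ?_
    ⟨circuitSign χ u, h.circuitSign_eq u, fun i hi => ?_, fun i hi => ?_⟩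
  · refine Finset.eq_empty_of_forall_notMem fun a ha => ?_
    obtain ⟨h1, h2⟩ := Finset.mem_inter.1 ha
    have := hdisj _ (mem_maskSet.1 h1).2
    rw [(mem_maskSet.1 h2).2] at this
    cases this
  · ext a
    have hmem : a ∈ elems (pathOf 12 (Nat.lor T G)) ↔ ∃ i : Fin 5, e i.rev = a := by
      rw [hfe]
      constructor
      · intro ha
        simp only [List.mem_cons, List.not_mem_nil, or_false] at ha
        rcases ha with rfl | rfl | rfl | rfl | rfl
        exacts [⟨4, rfl⟩, ⟨3, rfl⟩, ⟨2, rfl⟩, ⟨1, rfl⟩, ⟨0, rfl⟩]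
      · rintro ⟨i, rfl⟩
        fin_cases i <;> simp [Fin.rev]
    rw [Finset.mem_image, Finset.mem_union, mem_maskSet, mem_maskSet]
    simp only [Finset.mem_univ, true_and]
    rw [← hmem, mem_elems_pathOf, hor, Bool.or_eq_true, ← Finset.mem_Icc, ← and_or_left]
  · rw [key i, (mem_maskSet.1 hi).2, Bool.not_true, Bool.xor_false]
  · have h1 : T.testBit (e i.rev - 1) = false := by
      by_contra h1
      rw [Bool.not_eq_false] at h1
      have := hdisj _ h1
      rw [(mem_maskSet.1 hi).2] at this
      cases this
    rw [key i, h1, Bool.not_false, Bool.xor_true, circuitSign_not]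

theorem IsChirotope.realizable (h : IsChirotope (Icc 1 12) χ) (ha : IsAcyclic (Icc 1 12) χ)
    (hadm : IsAdmissible facetsM χ) : Realizable (signsOf χ) where
  base := h.signsOf_base
  acyclic _ hf := h.fieldAt_ne ha hf
  grassmannPlucker _ hs := h.grassmannPlucker hs
  notSeparating _ hT _ hG hTG := h.notSeparating hadm hT hG hTG

end Circuits

/-- The leaves and nodes of the case distinction, in postorder, twelve bits each. -/
def certData : List ℕ :=
  [0xf08c09f09f0144920bf06849f04446f02f0cf0afffffffffffffffffffffffffffffffffffffffffffffffffffffffffffffffffffffffffffffffffffffffffffffffffffffffffffffffffffffffffffffffffffffffffffffffffffffffff,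
   0xf05c0af02f06c03f08f0820bc0506af05f0df0bf0204b14c24c4c84c4f01f0c087988486f09f0803cf04849885f06f0bf0148a807885f04f0cf01f0240724af09f03264254f0df080d4f0bf0144c24c4c4f07f0cf0a80b48906a849f0bf09f0d,
   0xf04489889f06486f03f034c4f03449f0c445f0cf09254f07f0c44a087644f0af04644f0af044466444520784a802bf084a4f08f0802703af0109af03f0c03af0109af02f0c071f0bf014c2017426524f06f0cc0af03f07056f0df03087682f02,
   0x40df0a0c5f0a185505f0a81906a207f0df09f0d06a207f0df09f0df0af0ac0c20b6c0f0af03254f05f0c6c0f00254f06f0c641254f09f0c88a8c282af01f0182ac0af03f0a245f0cf0102722642af09f08486644f04f0b886c0af0af0b48cf0b,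
   0x82a42a03c02d10b06a60af0cf08f0d1380acf0cf0b09cf0bf0c40b0a941af01f0df0bf09f06207f06f0601742af06f06027f03f09254a4442a70248af0348cf0bf0b612c0af03f0b059f02528f03f0a40b46801df0af0cf0d612f0cf0110df0a,
   0x78f0af06f03c44f0a85801bf0785281af0cf0cf0af0350c06af03f0d468c28033f01f01c6082a868f02f0cf0c81c02df0711cf06f0bc09f0340bf0af0309c03cf0c464f0cf0b03c27081c0f0f0cf0821cf0bf040f0f0cf0b0acf0cf0c24a226,
   0xf0681cf0cf0b0170a6f0a28cf0bf0cf04017832f05f01f024684c8f0990a09328cf0282cf0cf030d8f03f0210701bf0bf0401bf0bf04f0709cf0bc2202b03af06f0cf0708bf02852f09f02053c44f0a85846846242af0af0a48af044c8f0cf08,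
   0x2d22cf0df0af0d02d22cf0df09f0df0682c01bf0a82af0cf09123238f0af0412a02d132f0d03af0df0af0df0b21c2151382a4059f0d0acf0df0a23803af08039f0df06f02170f0af06f08c0a82a80b90a88a017832912f08f0903af05f0b813,
   0x81c1158c4f0a09c047095f0cf0b0d1f0c069f0cf0b069065f0df0af09f0c087033f03f0602b08df0df0bf0108708bf0b81302bf0df0c02bf0df0c02bf0df0c11c07827022508705922cf0d02df0af0b09cf0cf0805902df0af0b09cf0cf0808b,
   0x5507201df01f0d074f08f0d207036f0cf0bf0a22cf0bf0d02bf06f0207240740b065f06f0d06a12af0bf0bf0d126f0a071f08f0c223053f0b05503cf0df0af0d06af02f0d0cc0cac8114cf0a06af08f0d14cf0a06af08f0d44c24c01d03c11c,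
   0xf0cf0bf0cf0203650a146f0bf0cf0c06af07f0d10d07202b0390a9f0bf0c01df07f0d055066f0af0106af0af0d05306606af09f0d056f0c035f0d264f0df0b071055f0bf0a065f0af0d066087065f06f0d14a065f0af0d154f0df0a225426f0b,
   0xf02f01f0303af0cf0524c85402703cf0af04055f06f0402703cf07065f01f0b06502b807f06f0b245f0df05f060cc2640caf0cf0a262f0cf05158017055350f0af0c035f0bf0a262f0af08138035f0af0d262f0bf0240d50c42c0170470550ca,
   0x28cf0df07f0506528cf0df05f0548cc0c04b03c055f0cf0a845425055f0a08df0cf0a4c4f07f060330170b4f0cf07f0c84af0cf0850a91886406af04f0d4c484af0cf0a4c8f0cf0484af0cf0984af0cf0a10b06af0af0d06af05f0d858a8440d,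
   0xf0af0b0e801b047f0af0c4250acf0df0106a065f0af0df0d1070ac0caf0cf0214af0df080aa065f08f0b02bf0d065f08f0dc84483485f0908df08f0d4a1485f09423f0cf0a829449f0cf02425f0982cf02f0148584af0cf070caf0cf09123065,
   0x416f0a072644017a12027852f0cf08852f0cf08138c0a027a14f09f04606f05f0a04704df0bf0b50af01f0bf08056f0d152f0cf0af0a053f0cf0b02b072f04f05072f06f0a04d14c84c0cc24c40d609f0a0a901744af06055f09f0b06503cf0c,
   0xf0c0cc42c4981430720f0f0c066438f0cf0af0b06af0cf09152f06f03138f01f060720a504d0caf0cf0b059f0bf0b4c2464f0cf06f08f0514c138017528f01a18f06f06036f0cf0b01b14af0c03af0df0bf0344644a027f09f0b036071f0cf0a,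
   0xf07f0c0ca0724c8f0af0cf0c072066f0df08f0c0cc036f0cf08f0404d468f0a055449027464f0c066f0cf0c063f0a066f0af0c10b059f0cf03252f0af04f0a0d401710b04bf0af0a04bf0a258f0af0c04bf0af0b01704bf08f0c059251f0af0d,
   0xf09f0c017138f03f0382af09f0a03c08798802df0bf0c01df0bf08988f07918f0bf0401d02709c891f0bf094c4f0af0509c891f0bf0841cf01f0b4138640ccf0cf06065f01f068640ccf0cf06065f01f0606c44c25446420b246036f0cf09264,
   0xf0290c03c017928f07f06928f07f0194804701df0af0791801df0bf0cf0819109c864f0bf0101df07f0b09c918f0cf0241cf07f0ba0c03ca05f02c14f09f0301d02709c988f0bf08864f0bf0609cf0141cf05f0ba24f07f0411c84a01df06988,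
   0x8860d4f07f0909cf068c241cf0cf0882af05f0480dc0903c027f0903a01df09f0cf0b09c0270a6f050aaf0af0c21cf04889f03f0b027f034c4f0bf0602784cf0cf03f0382c0530d409c056f08f01f0b838f0bf028b009c825f07f01f09838f0b,
   0xf0b819f05f0b80df09f05c8485885290af09f06059f06816f0cf0101df05f05928f02f0484a407c84f01f03c84f0205af0cf0904b04704df0cf0610780df05407f01845c84f07f0904df09f0c01d80df01815f0bf09889f09f02846f0af0cc0c,
   0x138125f06f0b321f07215f0df08f09017f05f0a88cc0c85222341cf0cf0441cf0cf0415202741cf0cf0241cf0cf05087c0a868f03f04512f0150af0af0b807f0341cf0cf0482c08702b838f03f09838f05f09838f05f0990c91110780d825f0c,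
   0x4620a5f06f0d2a4f0af04225226f0d027246f0cf0bf0d0a5f0bf0d10b41cf01f0c107065f0af0c0a5027f0af0cf0d1070a503af0c027f0bf0cf0d906f0af0a047071f0bf04017066f0df07f0a09c305047311f08115f0df0b311f08115f0df0b,
   0xf02f09f09f0cf0af0c485f0bf0b20741cf01f0a41cf01f0a50c21c138047407807125225f0cf0a129f0cf0842cf02f0b132f07f0a41cf02f0a0b109cf0af09039087192186f020a5f0af0c116f01906f07f0a2a40a5f0bf0cf070a3426464207,
   0x96f0af0cf0d0960390b8f09f0cf0d036f0cf0af0af07039f07f0d21a0b8f09f0b039f09f0df0b50c138f091988150e4066f01039225027f08f0df0cf0c039071f0cf09f0c039f09f0cf0bf0b19860c88c988f0848c09af01f0bf0529890a889,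
   0xf0803621cf0cf0cf0b047906f01056f0b113f0cf0b113017f0cf0bf0301701bf0bf0541cf0c056f0df0901d09c40d21c03550c1b0033231f0bf052b010d039f01f0df02f0609a514039096f0af0bf0d914039f08f0d5301541644a8149f05039,
   0x928f0bf0511312a131f0df0a036f02f0d151162152131f0df08f08170f0cf08158f0af0b19131491101b82cf05f0b113f0c107f0af0c905407f07f07815413131f0cf08832f0cf091b0f0a074087036f0bf0801701bf0cf0bf09906f01152f09,
   0xf0a149131f0df08f0b3a00a317006cf01f0d1a4f02f0d17006cf01f0d1d0132f0b1a4131f0df06f0d1a4f05f0d1461a216214a125f04f0df0af0a21cf0af0d254f05f0b0b4f0c129f07f0d027191f0bf0d191126f0af0cf0d270107113f0df07,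
   0xf0c12af04f0c04b0aaf06f0b06af050aaf0bf0bf04f0b268099078f0d01df0bf0c06af04151158f0cf0df06207270f0b0f0f01f0d0f0f01f0b03c01d01782cf08f0bf0b50c18c80d189f0cf0a819f05f0b11516409c294270170328f0cf0a191,
   0x40702702bf0cf09f0b027f0bf0b22601bf0a08bf0402bf0c0a5423f08f0cf0d622f040a5f03f0b20750a0a512af06f0cf0d0a542c02bf0cf0af0cf0d0a50aa036f0cf0bf0cf0d826816312f02164f0df05126f0bf010270a601b41c113f08f0d,
   0xf07f0c0a382604b10bf0613111af05f0df0d06610bf06113f0612311a027f0bf0cf0df0df0710782a033f0bf01f0101bf07f0d02b0a5f02f0d027f0af0b08b08d09cf09f0b123f08f0c158f0415414cf09f0df090a64a409342cf07f0cf072a4,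
   0xf01f0c01b41cf0cf0a41cf0cf091680ac02d40d1a888c44509cf01f0c485489f0bf06129f0cf054890c9f0bf0b4c4f090f009cf09f0df040a3191f0df08191f0df07f0a52850c071078f0cf06464f02f06f05125129119318407191f06f07027,
   0x438815056f0cf09056f0cf03f05858f01f0801703301bf0bf0c12342301bf0cf08f05f07f0648a01741cf0c82af0bf0981af09f0c60af01498f0cf0381a8320ccf0df0403941cf0cf0883885208740741cf0cf09f0bf0508782a41cf0cf0bf01,
   0xf0cf02c0a027017416f02f0c0a9f04f0c017f04889f0a02bf0df04c06027017f03055f0cf0b02b039f0d05af06f0c82af01f08027c84426f07f0af01446416f05f0cf0641a81a91440b498f0cf02093498f0cf03498f0cf0203a4544c4f06f0c,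
   0xf03f05a84047017894f0cf02f0782cf02894f0cf06807096883f02f09f05a06056f07f07889f02f0c093f04f0448cc88419489f09494f0bf0c08b4430c5889f09988415f0241af0cf09f010c9489f0cf0502df0bf09889f09988c90f01f01198,
   0x8b262f0bf08231f04f0b41c0b8055f08f0b22525401b039f08f0df0907802d48cf02f0a0390a9f0df06f0d047246262f0bf0d262f0af0c262066f0cf0c2d0f0d246f0cf0cf0af0ca9081a892a0a21af04f0cf09f03087292f03096f02f0a213,
   0xf0af0b07403af0df0b231f07f0d04bf060acf0af0cf0b047846f09f05f070d8055087819f030d4f0cf0409508df0af0df05017f01f01055059f0df0281a078f09f08f0560c88c0ac0392a4027262f020b8f0df0608d096f0a036f0df0af07f0b,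
   0x852f0cf0b26402b07201bf0af0cf0bf02232f02f0403904b03af0cf0b03af0cf0b2340b8170017f06f0b0550d1f0d072f0cf0c072807232f02f0a01b02b033f08f0b06a12af0af0cf0bf06f0a0470acf09f080acf09065f0bf0d8310aa02702b,
   0xf0d01bf0bf0c0ac0d4f0df08a12330f0bf06f0989489290cc0c04782cf05f05066059f0cf0bf0702bf08f0488c8a40ac0a5f0cf0af04f07f0b88c85882af06f0640b072f06f0c0720acf0af0bf0ca12a8481328988af03f0ca0af03f08f09f08,
   0x27838f08f09838039f09078f09f01f04832035134912074407078f03f0607803af0cf08f0643402704703af0cf02f08f07930039f0af06f01223f08f084344a444540df030a5f0af0c4c4f03f0408703af0cf030acf090a5f0cf070740cc0d4,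
   0x207232f0af080aa125f04f0df09438f09f04883f0903af0cf0990c099f03f0c91803af0cf09f09891a90a060a3f08f062b0f032a4f01f0cf0cf0981a83201701bf0cf09f0990cc0c017f01f0c087928f04838f06f09807819f04816f0cf0bf06,
   0x1741af0b0cc18cf09f02f05093f0cf0c017107f02f060acf0cf0c40bf03f08017f0cf0c03502705503af0cf02f0101bf0803af0cf0b2340ac0b817004b443f0704d039f0cf0a0ccf0bf0cf0813103af0cf0142c82604b063f06503f04f07f01,
   0xf0d8348b00354344a408742af0af04891f0af0404b03af04f0c03af08f0c04701b03a11af06f0df0cf03066f07f0b09a1a8047891f02f040b1f0c059f09f0b283f0818cf0cf09425f05f0691481604785409af02f09f05056f09f0201b88c858,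
   0x27f0b047126f0cf0b066f0bf08027f0af0a834107027f0bf0a027f0cf06138115215f0b254071232047f0d407f0c10bf08226f0df09407033066f0cf0bf0d066f0cf02f0a207f0bf04407425f0cf03039f0b0a9f05f0c115f04039027f0cf09,
   0xf0cf0af01066072f0bf03f0a0b8f0cf0b21980d02712902df0c039f07f0d02df0cf06033f0cf0604d02df0c825f0cf0c129055065f0cf09059f0cf0df0401b31102df0cf08252f0302df0cf0a09502bf0c039f09f0d04d02bf0cf0bf074344a4,
   0x2702d0caf0cf0cf07055f09f0c0170d8f0cf03056f04f0a14c04d06cf0df0a50cf0a524065f0df0984c407065f0df0418c10d425f0b429f04f0b055f05f0df01145905f090d1941f09065f0df0a04bf0cf0bf0982c1a8f0718c017039f0c02b,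
   0xf0d033226852066f0cf02066f0c027f0c870f0bf0c107216f0cf08216f0cf09f060d40d8f0cf0b2a4807017f0af09017f0af04047027f0df0c807f09f0907805a858053f09f0a06c06602744af0cf060e2059f09f0df09143065f06055f03f0b,
   0xf0bf0dc444232a4f04078f08f0d2a4f040e2f08f0d125f03152f07f0cf0a0354344a4087017f0cf08f09027446071f08f0a065f03f0c033f0af0a07105588306af03f0c06a232226f09f0cf0df0c254415807445f08f0c445f09f0c2b00f0f0b,
   0xf0cf09838f0cf03036074226126027078f03f04132f0df05826426027622f0c4e0f0cf0a622f0cf0a047832f07f02832f09f09426622f0cf0902714cf04164f06f0cf0a05a0172a4f090e2f09f0d2a4f09158f0cf038520cc807078f0bf0d078,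
   0xf09a12988107138f02f0702df09f05047087816f02f0a88cf08f090ccf0cf03f0415812af0cf0a858078f0cf0ca12119017039f09f0c819f06f02c1250ca84039f01f090d8f0c8c8f0103902df05f07f01039f06f09c22f03f0a027039852f02,
   0x18c0958940d4194f02f0cf0519414af0cf09f0c0872a4f09f08115f09f0d48c91804714af0c146f0af0c087107f07f0c04bf03f0c20781af01f0c894f03f08c0c0c6f08087056f0df0284a988f07f03f09207f02f0220bf0a216f0cf0a12c84c,
   0xf09f09216f0af0d01b19204705a056f0af0df0514a11af03f0d017f0d0b2f0d055f0df0a0170b2152f0cf0cf0609511a056f0af0cf0d119f0af0d416096216027232f0df0b21af0df0b02b056f0505af0df0a816f09f03047494f08f0cf0a09a,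
   0x416415f0af0cf0a81a036f0b0acf0909cf0cf09f0b09c21c41c0b403a036126027226074f02f09066f08f0c132f0bf091a8207138f0cf03f0384cf0a07802706602d039f09f0cf0af0b066f06f090d21a2898868074f0bf0c0f042cf01f07f0a,
   0xf0bf0b02df09f0c09c0d402703cf0cf05f05807f07f0305303cf0bf0803cf0bf0805c81c11c03c01d41c09c0b8027096f0af0df0a0170780c9f08f0cf0a11a078f0af0df0c291f05912f030274160a5f0b426f08f0c115f0af0d095099f0af0d,
   0xf060d2f01f0802b033f01039f0df0a0aaf0b039f0df0410b132027036f0a170f04f0a066f06f06858162f0482cf04f09183185f02126f01f0af08f0b192f0701b02b01df0b033f07065207f08f0df0d01df0b066f02027f09f0d017f0303a132,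
   0xf0c056f08074f09f0d08b017f02f0b01b01df0cf0cf0bf05f0a81c91894202712c912816f0cf0af05816f0cf07c1212cf05f07816f0cf0291280722311380d11af02f0cf09f0201b113f04f0cf0201bf09f02017816f0af0cf0703c0780d8350,
   0x47134238f0df0af04f0a02b04bf0df0a02df0b25406a072f0b066f0af0a065f0df09216f01f0bf0df0cf0ba12816f05f0c02d80df07f0b225f08f0d047f05017f09f0d027f07f0706682613413280b056027035f0df01f0bf0c81af01170f0b,
   0x132f0cf0bf05f0a41cf05f0b03a01b03609301d035f0d02d12cf0d047f09f0df0cf0a01d035f0df0703cf0df0a04701d132f0df09056f09f0c145f0c066f07f0d81a03603c05681605c07407842309cf02f0cf05223072f09f0d0950b4f03f0a,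
   0xf0d02bf0df0af0541a07210b270f09251216126f031320d2f0df0a12cf09f0df0a036f08f0bf0b05605c01781af04f0903c03af0c033f09f0d066f09f0d06af0af0df0c2d0458047f0906af08f0c01701bf04f0981a912f03f0af0610705c03c,
   0x17216f0df01074407f01036f04f0d027039f0af0c258f04f0a017813438f0cf04438f0cf0205c056f0af0d033078f0df04f0d03c017f0b08709cf05f0c80701df0d12a078072f0df06f0df0d270f06f08027134033f0c035f0df02f0402d232,
   0x56036f0cf0cf0b01df0c06c41af0bf0bf0d056f0a01df0c145f0df0a13803c11c82c087832f09f08852f07158f03f0d027922f06f0a158f07f0d45404705c066f08f0df0df06027047f0af0b41cf03f0c027123f0af0d12902df09f0df0c03c,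
   0xf0c42cf0c42af0b087078f09f05446f0cf0884342cf09f0407811af0df0af04f0b093033f0df08078f0b039f09f0df09f06047087078246f0df03216f0df08078246f0d0d2f0bf0c216f0df0809cf03f0d10e05a11a21a03a01b04703c107f08,
   0xf04f08035047134f0af0123201df0af0c01df08f0c0950acf0df0af080b40e262201711af05078f08f06246f042a4f0cf092522a2f0bf06f072980b821cf0af0d087f0602d11af0d078f0bf0cf020b8388f0cf0af0da22a2404702b262426622,
   0x39f0b42cf0c223f0bf0c42602b02df01f09126039f09f0b039f09f0b807825066f08f0df0522502bf0b02df0d039f0af0c425035f0cf08f04834a05f0482c84af07f08826f0cf0b225047207f0a226f0af0d226f09f0d2860a3264f06f0a2a2,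
   0xf0d017226158f0df033c0f0cf04306226158f0df033c0f0cf04468f04f05a24047f01f07223f04226f0cf0a162f0d168f0af0c262017126096f0bf0cf0b126f04f0b017862f03f0c126146f08f03226f06f0a03602782602b02df0b223f0df09,
   0xf09168f06f094862074074264a8f06f08f0654842644af0cf09f06f0c426066f02f0c464f02f0c01748cf0cf041c8446f0cf08f0322c14a152262229036234f0df05f0603902bf0df0605cf0df0aa60360027216f04f02036138f0df06078f05,
   0x6af0df054c4027445f09066f06f0c426066f09f0cf08486017426066f04f0c40702bf0af0c464f08f0c60a464f03f0cf0302748cf0cf06464f08f0c50a1a8f07126017f0a132464f08f0cf0c08bf0602d50cf05f0c464f05f0c4c4027168f06,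
   0xf0cf0df0d44a072017226f0cf01162f09152f0cf06158f0b262053f0730af08039168f09f02017132056f0d04df0af0c170f0af0cf05660407426f06429f0cf0a4c2464f04f0d446f0cf0344536084af01f0a06af0df06360170f08138f0cf08,
   0xf0df0af0b04df03f01207036f09f05838f06f0c4a46840a9f0cf0a0b8065f0a138f07f0c0a9f0c21cf0df040a60aaf0a170138f060a9f0c1a4f0cf0a017059f08f0a0650a9f0c21cf0df0af08f0a14a05a04bf0d01d059149849f0cf0b84af0c,
   0xf03846066f06f0af0128af0af0d23882c12c22506302bf0b02722af0df0af0d21902bf0df0af0b2232a2262f0bf02226f0df0af0a226f0af0c407226129f0bf09f07226129f0bf07f04036047066f03f0a06604df0bf0bf0b84304df0306511c,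
   0xf0cf07066f02f0cf0921929420b231f04f0b28af04f0d407087f0df09087f0d099f04f0d05905af09251027246f0af08071f0b0360d4f0af0cf0d027017f0af0d039f0df0530a318f0a622322f0602b213f0d232f08f0df0d017f09146066f08,
   0x42a426f08429f0bf0c630624f0b027f0cf08f060ac13822c0aa42a027429426f0cf0af0b62214af0bf0bf0902702bf0df0b622f07f0a21a622093059f0905a468f08f0cf0c0e824cf0df0806af0c44af0af0c80b05af0c4a8f02f0a2a210b05a,
   0x22c0ac81c01df0cf0c834f0a225f0a11cf0c868f0c01d1380aa0b8f08f0c854f09f03f0bf0c01744af08f06027429225f0af0cf0c429f01f0c12c8071380acf03f08f0813802bf02f0bf08107262312f0a132f0d074f0df0a225f06207f0df07,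
   0x12c125017f04429f09f0c033238170017f0a027f0cf098230aa035f09f0df02027f0cf06035f0bf0c415039f0c12af0c03501df0af0df0d017f0cf03126138033017f01066f09027f0df08154f03f04f0a087f08107f0cf0a047f08429f07f0c,
   0xf08429f01129f02f0b11a047225f0c066f06f0d107093f07f0c225f0bf05035047f0506a095f0cf06074f0d07106cf0af0df0d116f0a14613206a162f06f0b069f0bf0402702bf0af0c0aaf09113f0df0a017225f0bf0bf0d06c42c02d82c838,
   0xf0df0a04df09f0b01744af0a0caf0bf0b055f0af0a21c41c20720d286f0cf0a0ccf06f07c48c44f09f090cc0c5f0cf0bf0511c48c04744cf0af0b88c894f09f0bf05107489f09f05489f09f05119445505f01f0912a074f05f0a189f0c02df0c,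
   0x4c4f09f0b4c4f08f0b14c08714af0bf0914af0a50cf0c12cf07f0c0278944c4f06f090aa0a6f0bf0c807f03f048944c4f06f0928c2a4f0cf0b984f03f0441c21c18c14af02f0c0170caf0c189f0af0b0caf0c04df0cf0b0470caf0c04df0d14a,
   0x207f0b231f0df0af0d087f0a10704df0df0a035f0bf0b91430622cf0bf0c11904b11c065f0d074f0df08f0d84a05a074f0df08f0df0913414904df08f0d146f05f0d04bf0af0a815f0a0b1131f0806a05af06f0af0342cf0bf0b05c11c48c047,
   0x2bf0af0a055f0bf0b20704df0cf0cf0906602b464f0bf0bf0b02b047225f0c06af0c065f0cf0a06af0cf06826f0b08742cf08f0c01b09304df0bf0a10bf0bf0bf0703604704df08066f0bf0b04df09f0b06520b04d234f0df0604bf0bf0d027,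
   0xf03f0bf0350a416f0cf0b42502bf0a0a5f0df0a0b2f09f08027f080b2f0cf0201705684a24606af0bf09f0b05af0bf08816a06f0b84c286047033f0bf0202702bf0af0cf08f0c047107f06f08f0b852194f0b84c832047f060ccf08f0cf0c027,
   0x95f0cf02815194f0a831047891f09f0c829f0cf0204b81302bf0bf06f0a813f04f0b11611c027225069f0cf0af0c0330a9f0c0b2f0bf0af0aa140270a5f0af04033f08f0b88c807889f03f0780bf07f09087095f0c08d0b2f0bf0cf0b898912,
   0x80bf0cf04f0bf0b894815027095813f0af0b0a5f0a08df0af0d80d819813033f09f0cf0bf09813f0bf0b49401b0b212af09f0c095f0cf0b04b19419814cf07f03f04095f0c069f0d04df0af0d84af0984cf0af0c04704d446f0af0b095f0cf0b,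
   0x14af0a213f09f0d23140d107f07f0706302b04bf08f0d027f0af0d07822304bf08f0cf0df0af0a84af0c14c036047065f0df0a813f06065f0df0a017071f05f0df06027f07f0a12c22c036816017819129194f0c829107f0af0904704df0bf0c,
   0xf04f06027f0408df0cf0480dc0a027f0480bf0cf090aaf0b14a0caf0bf09f03017f09f0b01d05c21c21511c02741cf0802bf0bf0c115225f0cf0bf0d31481626422c225f0df0114af0af0b813245f0c065f0d14af0cf09f03194f0cf0c01bf0a,
   0xf07f0c90af05912f0201df0cf0ca18047056f0cf03f0384c04705301df0cf0bf07f0b138039f020b8f0cf09185039312f0502df01f070b8f0cf02039312f0502df0101df0cf0bf0681c81a80dc0c82911c078f07f09f0b889f0901df0cf02c09,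
   0xf09f058a8f0202d889f01f0c829838f0bf09f0504b84cf0cf0908bf060c3f0281cf03f0c838894f02f0112c01b832f09f0593018cf01f02f02849819889f06f0ac03f01f0106cf01f0180d08b18cf09f0680bf08f0481902b90af0501df0c912,
   0xf08f0118c98804df09f0704b18af09f04f0404b04d01df0cf090ccf02f0a90cf0281cf0cf0c81680d20708d819f0af0618cf05819f0cf0b80b807f0cf0af0880b04bf0105cf01f0c88c90ca03a06f0cf088a8a06f0cf01928f0cf0888aa0c04b,
   0x8df07f0a889f020a9f0cf0b0270acf0cf09f0582990c84918cf09f0af07207a0cf040acf01f0b28cf02f03819f0cf0c80d81ac0c02b0aa28cf0bf06889a18f0cf0bf0518cf08889f09f05407894c09f06f08f0840bf0cf0210782af06f0382a,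
   0x886f03f09f010178c8f0cf088c8f0cf08c0c48c1070acf0218cf08f0b0acf0318cf09f0b9880270d4f0590c05cf02f0cf020d4f0590cf01f024078c8c06f02f0509af05f0886809af04f0828cf03f0680d4a4988107889f07f0608df01f09027,
   0xf09f0a80bf01096f0bf0c889f060ccf0688cf0bf0888c04704bf03941f0a889f0af0b04df04f0881c087928f05f0a8c4f01f0b113903f02909f0bf0a06cf05f0203c09c82c88c84c84a02718c80df01f01f0818c80df01f09f08a8881618cf07,
   0xf05146f04f0c03cf07138f0af07944056f05146f04f0c216f0781af03f0602782614cf03f0cf03826d02f03f08f0354202bf01f0124305a14af04f0b988f01f01988146f04f0a942f0af0180dc8801781680bf04f0b446f02f07807c09f0b8c4,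
   0x168047126f02f0812cf07f0c017f01116f0bf0bf09826f0c126f05f0681c80df02f0c18a942f090cc85284af02f0cf0a9c0f06f03f0ac0c90694288988cf0bf0bf06027826f06f02c48f0bf02c42c84027944f01f07944f01f07152033944056,
   0xf04f0980df0bf0204720704bf01119f0bf0603cf0b01df07f0df0384ca0c82cd04984906988f05f09146f09f0c838948942f08928f0b988f03f0cf081c80ccf04f0603c8c488cf01f0b0b8f0cf04a44f05f07087c0af05f02c0af05f02924322,
   0x6606cf05f0d078f0df08154f02f0a0ac2a404706c168027078f01f0b234f02f06f02f06c0cd08f02119134f01f0cf0c04d94880df01f0a84cf08f02f061070a508df0bf0c10df0cf050b4f0b168f05f0720b88c988f04f0980df0bf0288c988,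
   0x20704b03301b129f0bf0df0d078f08f0d05af0d152f07f0d129017f06f0df07330f06170119f0d912f07f0c234f06f0a90c138914017f02807f0284af0cf0409502709c0b4f0cf0bf0909c0b4f0cf0bf08170074119f02f0c047072f07f0506a,
   0xf0bf0622c078027225134f0af0df0706af0724cf0c01707203cf0af0df0cf0d40d0a903cf0bf0d26804703cf06f0d06a82cf06f0c03c04bf0df09f0d047f07066f01f0a03c04df07f0df0df0d81a06a08b01bf0bf0df06162027f09119f0df0a,
   0xf04f0688c48cf04f0a01df0d03cf04f0df0c4230b8f07f058380b4f0cf02f0607410b125119f0582cf0bf0cf0281c119f04f0d11990af0bf0cf0d119f02f0a047f08f0681c21c0caf08889f09f0b03cf09f0d84a48af0721cf08f0c44c21cf0a,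
   0x1c4f01f0313805c09c21c1152940960d4f0989488cf0c40dc0cf08f04c0cf08f0816848c20bf06f06c44f02f06f0990c08d906095f0cf0c035047074095f0cf08095f0cf0b055095f0cf09f0b28c0b8f08f0c28af0503cf09f0d04b0ccf04889,
   0x88af03f03816f01f0ca0688a816f01f0cf03f01207a12f0284af09f03c0c84af09f01f0488a807988f08f02982f04f06c44017816506542407f02f08f0bf05f0c894f09807f0294840df02f08f0b9448c444c892f0bf01f02f0a894f0848cf01,
   0x5af09f0905a017852f06f0785201df0cf09f0408701df06f03912f0b096f0cf0501e10e11c116918138131f0809614c02711af0cf0a11af0c126f0df0641611af0cf08f0af0c027c14816f05f0cf01b08f09852b40f09f02f09c06852027a06,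
   0xf0741321af01f0bf0588c82a04bc22f02f0bf04883f080b21c829202728af08f0828af08f08152807f05f0502748c489f034a8f07f010a6f06f0b8c40a9f06f078684c8f060e4f06f0bf02f038a2f0cf0b047849f0cf06c4808df09f0cf01819,
   0x9a02b0a9f0cf0b41af03f0c426889981f0bf0bf0a44644af0bf09152f08f06f06017885889f07f0a113f05f0901d10710bf04f05f06f0808721af03f01f02c0a816813017096f0cf0690af01033f08f0c06381982af05f0cf07819c12f0cf04,
   0xf01f09f0b08702b8e00acf0bf05f01f07807f05f06027489f0af0a48af0af0881a80bc0a81308790a01bf09f0c413f01f03f0781641c047096f04f05096f01f0511a89810b06a903f0703cf0c01df07f0cf0785803cf0cf0c90908bf0af0bf0b,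
   0xf06f0b0b2f0cf0b027f04f0401bf07f04f0a0b815201705a11af09f0cf0cf0718a0acf0b91204705af01f0c05af07f0c851087107813113f0bf0cf050a9f05f07017f03f0b02789105af01f0c113f040a9f03f068c1039f03891f0af05815f0a,
   0xf058a885414a05cf0cf0a0b81380b4494f07f0c91803c06cf0cf0b06c1b0f02f091c80e884910d41cf0c42c42af0bf0b14c1a828c50cf0b294270158078f0cf0af0d0e4039f0bf06f06039f0df0cf0b134f0cf0bf0bf0804b04df0cf0202bf0d,
   0xf0cf0348cc88207c90c03d01f01f0302bf02f02f0ac9080b819f09f0110bf07c82198f0bf01f0cf0a0cc407489f0af0cf0298801d9824138c88c290af0cf0890af0cf0490af0af038c88c290af0cf0890af0cf048c2f0bf01017f04f0780df03,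
   0xf0cf06889f09407f01c82f01f05416c844a40a9f02f0cf01898f0cf0110b207889f0b01b407f0cf09f05889f0b02bf01f0301702b429f0cf020b8f02f0a107f03c1241cf05f0cf0588980b189143a12f0cf07a12f0cf0743805af0bf0cf0b198,
   0x178c8f06f048c8f06f0748940750340bf0af0cf0160a40bf02f0cf0384c14a8c805cf0cf0bf0c1380c98a8c81581f08f06918f03f0a0c6f09f0c04df05f0c82af0af04027849f0cf0104df0c845f08f0c498c0a047889f0944a017f01f0280b,
   0xf04807826c05f0cf020a6f09f08813f0af04a0905a213027a03f0284cf0bf04a0309af0c20bf02f0c18af0af08087286f0af0a407f01f06f0a02782901701df0bf06f0703340bf08f02f02f07c8848a82341cf02f0a98818af01f0b05af06f06,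
   0x81af02f0af0b11901b95009af02f0cf06f0802705a10bf04f0bf0105a10bf04f0c01bf0cf0488a08b88984940b1070aa04bf06f0cf05807f05f050870930a30470ca08df0bf0c05af0cf0b4c448cf0bf0604bf0cf02413017f0cf08f07813f09,
   0xf05813f0809af0cf0c18902bf0b06312af0af0d12af0af0d04bf0b84a05af0cf02017f08191f03f0801705c11cf0903cf0df0bf0510b40bf0cf0b21af0901df0cf0a18a06903cf0701bf0bf0703c05cf08f0d01bf0bf0791204b10bf08f0b08b,
   0xf0548902bf07f058890a9c09f04407f03f0c02df0cf0309cf0af0c04b04d0caf09889047f09f0cf0920df06f0808b09c89888988af0cf03f0a80df0bf0a807f04f051890a902bf0cf0bf04f0410e88a08b18a207988f0a81af05f02988f0a81a,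
   0x17087f0cf05f0904bf09f05f0701788a489f04f04f0788a82309cf02f0cf04f0790a02788a98881af0502bf06f05f0988982af05f0bf0588a98809c01bf03f05f0cf0988982af05f0bf0502708b09c89888988af0cf03f0a80df0bf0a807f02,
   0xf04f05f0c04d01df0cf0904bf0a017f09f0b10789409c80dc06f05c0af0bf0af0af0b90390cf02909f0cf04f0989409c80dc0af01f09f0af0b854f01807f03f0c0a90d288a852816f02f0103cf0a84af0cf0cf0788a03cf0b807c0680df03f0b,
   0xf05f0503cf0b892f09838f0cf05207a14f09a11f01f09883f09813f02f0a81582603cf07838889f09f0c834f09f0541a09c0b480df03f0b05cf0b056f0cf0411cf0cf0206a84c84af01f0cf03059056f0a852807825f03f0c053f0a05cf09119,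
   0xf02132f0211af0cf0a116f09838f0cf08f07c12c88419027116f099120a910bf01f0bf0690af09f0c0a903cf0b02bf0c039f07f0d01bf02017f0bf0c11cf07489f0709901b03cf0cf06f09f07f04c0c832056f0cf03f0c03cf0b918f0bf01087,
   0x852f05f0803cf0704b83809cf0cf08823f06f07c0a838f0803902bf0cf07f04f0488c891990a9008b033099f0903cf0c01bf050a9f0cf0b036f0b889099f0903cf0c138f02078039f03f0af0cf0a1380d203cf0bf0507815290905a11cf0cf0c,
   0xf060b8f0809c838f0cf01f0c81688c078158834f03f0cc500d80d1f07f058c8f0cf010d80e8f090b2f0cf028c8f0cf0703cf0bf0702704b03cf07807f05066f09f0203cf0791201b05911af0c90aa12807f0c039f06069f02f0cf0cf08f02f0c,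
   0xf0704bf0580d05c09cf0cf0af0342548af06f0248a28af0bf01f0280b89881c02781609c82af0bf09f0b15282cf0b04b858f0bf02819f098890a9f07f08f0a116f0503cf0411cf0df0781682af08f09039819f0503af0b02bf0bf03099838f0b,
   0xf07f04194f0cf0a18a18cf05f0cf0af0a88c82c88904b09cf03f0b03cf05838f0cf0a01709cf08f0909cf09f0b027898889988f05f0af0609cf06f0b09c889988f05f0ac88f08f08f0ac0c82c047858f07f01858f09f01807886f09f07886f02,
   0x864f03f0bf0481c09c01788903cf08f0cf08246254f0bf0cf06f0b83202788af0181305af09912948f05928f08f05f05f0588af0581305af0991294884af09f0c928f08f04f05f0502784af05f0c84af05f0c88a09c1c8198298f06889f010d4,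
   0x906942d02f01f09f01f05906826f0cf01f0608788cf06f0340df01f0706af0a868027826f09f0cf0824620720bf06702047708f06f0604bf0cf0b02b407f0a506f08f0cf0704bf0af0b90c027864f0af0c864f0af0c087942f06864f09f0ca48,
   0x944116f0cf0884cf0cf0b912f01f0cf0302b912898832f06f0a81af04f0cf07912c1281af05f0cf0bf07c06f0801bf02f0288cc18f03c44f06a84017813f06f0bf0820b0ccf02f0ca06f06f06889f08886f0cf0908e01e10e84ca0c82cc0c01b,
   0xf07f0210705cf07f0c05cf07f0c8460d8017886f0784af0cf0201df08f0605914a017f08f0389801701bf0cf09107f0609af07f0c02781af0b05cf0c88af08f0c036f02f0810711690cf0af03f0a807f0af0a85205c94811a047f06f06152b40,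
   0xf04f0715898289806325205af0c09cf01f0c11cf01f0105af0c170072f06f05f0141a05af0cf0a05af0cf0504b05af0cf0805af0cf0809c88c24c858f01f0a84a84cf0bf0c8d0f06f0302785803cf0af04059f030f0f06f068a2066f06f040a5,
   0xf0a11af0cf0601701b11af0a03cf0df05f0a0d211cf05f0d0d40b8f07f0cf0b41af0703c03af02912f02f0c20788c08bf03f058c411cf0cf04f0201df0c988f01056f0b232f01f0701703cf0bf0903cf0bf0981605620b04b843f0cf0bf08216,
   0xf0c04705af09912f06f0905af09f0290cf0681cf0af0c10e05a846087047f08f07047f08f02854912107906f0cf0b807f0b116f0cf0904788c11af0cf0c84cf0cf0b0c6f0cf0828309c03af06f05f0409c036f06f05f0409c09a41a01df050d2,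
   0xf0605604bf01f0901d053f0c069f0af0d11cf05f0c06a22303af0af0603af0af0750908704b01b158f0cf06f0805af0a903f02f0b886047903f0781cf0cf0c903f0781cf0cf0c05af0bf06017903312f0bf0681cf0cf0c816819f0cf0481cf0c,
   0xf030ac0a60a5f07f08f05f0711a912f03f0c189f0409a01bf09f0df0c11a12c912f01f0cc8848940bf07f0511cc03f02f01f0c11cf05f0c0a9119f08f070cc0aaf0b48af04f0af0114a10b13804703c838f0903af0cf0984681cf07f0c132f05,
   0x4a40acf0cf05f0606a066892f0cf0303cf09438039f0cf06f0c44cf0484c4a4f06f0222cf03f04017894096f0bf0c05af0244607206af0cf08f0a426f07f03894f0803cf0944606cf02072074f0bf0cf0a4e0f01f091a810b80bf02918914f03,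
   0x78119f0df02f0181cf0bf0b81a0b80e822c0e403cf09168f08892f0cf0b03cf09f0503603508703cf0b126f06f0703cf09f0603cf0a132f02f0b03cf090780acf0cf05f0c42c207894f0806a06606cf0af0c03cf09438f06f0c0e4072f06f07,
   0xf0c03a132f0df0a0d2f0b1b0f0a44a0478c8f07f0680df07f06027168f0af08518f06f0c138027928f0bf03928f0bf0315104b20703c12cf0bf0805af0df0503af0b017f0701bf08f0d0178c8f07f0605af0bf07027119f0b0b803af0cf05f07,
   0x66065f0af08f014c814af06f02894f0bf06f08588d0844c20744a4c4f09f03f0744a246f09f09f06027542522f08f06548138f0bf06f0612a13411cf06f0cf0114cf09f0c047f04f040b209af0af0c13801711c03cf0af0cf0c11c03cf0af0c,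
   0xf0b89409af0bf0b906f0b017f07f0788a04bf0511cf0cf0911a50a88904748911cf03f0c988603f0440bf06f0bf0504bf0740bf0909af0bf0c48c4e0c8802702bf07f09f0504704d18cf0bf01446f0304b11cf0af0c4c4f0bf0205c84cf0cf08,
   0x816894f05f0281cf0bf08816894f05f0181cf0bf0910e892138027918f04928f0b81af0cf01918f04928f0b81af0cf0303c11c918f0902df06f02f0b11a05af0cf0b033129f07f0d059f05f0581691804798891281a056f06f05f0c18af0cf09,
   0x107454132f0405cf0cf02f0205cf0cf0588c04bf0b0ccf0af0504bf0910bf0502bf09f09087f0209cf07f0401e88c81a40b01bf01f0cf03858f0501b02704bf04852854c48f01a09f02f01f09f0504bf03852854c48f0105cf09f01f09f05027,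
   0x17f0bf0904b04df0af0906a056f04f0c05cf0cf0888601703604711603cf0c845f0cf0a03cf0cf0603cf0c096f0cf0902790a14a05af04f0c146f03f0c087f0c894f0c906f07f0290a14a05a152f0df09f0c087f0cf04087f0c8a4f07f0a047,
   0x5cf0bf0a10bf0bf0b116f0cf0b89205c852f0905af0bf0cf01f09816047017f07f0405606af04f0af0a84606614a08708b113f07f0605cf0cf0a047f0cf0b0c618688c14cf06f0cf09486047f02f098c44c4f0104bf07f09f01906f02f0c03c,
   0xf0c05af0cf07216f04f0981a207813017f08f07815f04f05813096f06f0805a88af0bf0441cf08f0d80b027087116f07f0910b08bf05f0b11af0cf0b05a11af04912f0bf0b41cf04f0d81341c09af0108bf02f0901df0af0b04701701b087f0c,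
   0x107f07f0708b05af0904b04df0c843f0bf0c059f04903f0af0a01b91204bf09f0181cf0bf0cf0502705af0908bf08f0705af09f01087146056f06f0d81cf09f0c146056f06f0d81cf09f0c10e816027017033f07f02087f08f0b01705909af04,
   0xf0c44a05cf0a06cf0cf0781cf05f0c08781c50cc4414a42c864f02f0812af07f05047f07845f09f0af0414af07f05f0c84af0981c8c440d845f07843f0cf06f01f09f0c14a10b84c02704bf01143066f03f0780b903f01f0af0c04bf0104df07,
   0xf03f0c84a04bf05f09f0c0c6f0484af05f0c01706c84af09f0c42682af04f0cf0614a84584af0bf0c84a059f06f0bf0cf0684af05f0c44c06a02746405c14af05f03f0206cf05f0c46406606cf0df0804bf0af0406cf05f0c24644af0281cf04,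
   0x14af08f0c04bf06f0444cf044c4f09f0244c81cf08f0cf0306af0707821a81cf0bf0cc0cc4808704b069f07f05f0804bf06f0840b04bf0948af02f08312f06458f07f03f0481cf09f0c21384a849f06f09f0c82c83884af0af0c46808708b84a,
   0xf02a44f09f01017126146f0cf0a0e4f06f0a0e4264f06f06f0604784a8168c4f01f0cf0cf0580b04bf09f03f02047816912f02f0bf0504b44af06f07446f07f0881a84c85894803c81cf04f0c4e012c944f07f0c06c047107f08f0810704bf06,
   0x47903f01f0cf07027066942f0cf01f05903f06f0ca0a90a912838f0cf03f0bf0cf09903f08f0b8941918c4f08f0b1468c4f0cf0b186906f0c8c4f0cf0b90c8c4f0af0b4e089181cf0bf0b0b18c4f0af0b8c4f0af0b8c4f0af0b99081aac0027,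
   0xf0481c42305af03119f0cf0405af02119f0cf03027087f0809cf0cf08944f06f0202740b80bf02f06486c84f06f01f02942988d02f02f0b944f06f06f01d0281a80dc0c126f0805c81cf09f0c407486903f06f0c426f04f08426f06c03f04f0b,
   0x9410a9f06f0cf0202bf0cf01f02f07f09027849f0304bf0bf0c849f0404bf0bf0c017027891f07f06f02f0602710b84af01f0cf0610b84af06f0cf0604b10bf02f0590cf0988cf0af0911a02711cf0a126f0410bf09f0d18a11cf0bf0c09cf0c,
   0x12a10bf0cf0c48aa8280df0bf0c9c0f0828a1a8407f09f080a9f08f06f07f0984a20704bf0a113f01f0c04bf07f058c880b04708bf08f06f0348a889407f0881cf0bf0cc88f09a0af03a880470c9f06f0ba09f0cf060c9843053f07f0a017027,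
   0x807c06066087126f09107f0bf0bf0a24648606af0af09f0306af0bf0b413506f03f06506816f0281cf0cf0b286f0af0288690682606a066f0cf080a6f02f0ca06262f02066126f0cf0cf0690ac06087047f03f09407f01f0c91298881a898138,
   0xa0644a24cf08f07f0644a05cf0781c464f06f0cf0cf08486f0906a4a4f0660cf08f0cf040870c504750cf08f0af034c1f05f0af03988047c8890a0c3984f09f05f01f03f0288902df03f02f0302709cf0588af0b88cf08f0c09cf0581af07f05,
   0xf0af0409313806af07f0df0413803af08f0df07027f05f04047f0df0a622027423f02f04423f02c0a84af0bf04f0508b23241af0405af07f0c05af07f0c23241af04252f0cf0705a04bf07f0cf0c80e08e01e10e8468864c48c4f07f0b44c033,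
   0x12a01d01701bf06215f0bf0c05a11af0d107f0df0af0c09c0f0072f0341c4c806cf02f08f0205cf0cf02258f0bf0642c252f0cf07123033027f0a02df0df0601bf0b11af0d81cf09f0c30332122af0df04342f0bf0c21c129231f09f0df0741c,
   0x3af01232f0bf07f0103a06c234f0df08f0103cf07f02047225f09f0df0708742a426f06f0cf0a42a036f0af06f0aa2232202742af07468426f05f0cf0c42af07468f06f0c2320ca01b01d05af0af0c05af0bf0c40bf01252f0c05af03f0c03c,
   0xf08f0704704b06af0cf0bf0904bf0bf0c223622e0261265004bf05f0b24c252f0cf01238f02f03017f0204bf07f0b10b04bf01f0c40df0260c606f05f0cf070f0066f07f0706622c01df0505cf02f0b264a50056342f01f0c06cf08f0b80b350,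
   0xf0884af0bf02252027225f09f0d107f0205a047f0df08f0c862446c44f06f0a06a44af0784c02d462624f0106cf0c164f04f0cf07a24f0af0301705cf06f0905cf06f09223f0cf0705a322f05622116813162f01f0b254f09f02074f0403cf06,
   0xf0cf0d80740bf01245f08f0d425f0b24504df09f0df0d047087446065f0bf09f03446f06f0903c05c065f08f01f0b056f0bf0a8460a6446047c44f01f06a06f02f03017342807c44f05f03f03f0c243a06a24f0a642f0cf05f04342f04f0ca06,
   0xf0442a82a234f0a039f070aa0a5f07f07f0af07f032a2270a24f0bf0bf0a3420a5215f07f050f0624f0a425f0c42af05f0a270f07f0c14cf0df0af0401bf06684f09f06605017232f01f0b270234f0df04213f0af02017223f0df0923201df0b,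
   0xf03f0460c889f06f09f0404df0404bf0af0b02b05cf08f09f0420708704bf01f0b22920df0df09f022492c8286017f0422cf0af0d2252a403c216087f0905af0af0c01d123055f07261f0bf0d138f09261f0af0d252f0a02b039f0bf0a1a22a8,
   0xf04f04027225f0d05af0cf08342f02f01033252628f06606f01f0bf0c252628f06606f01f0bf0c017138f05425f06f0801d02df0d05cf0bf0c03cf0df0b24a264a0ca42047f01258f08f02a24047f030cc0caf0c216f0df05f0320d84608760c,
   0xf0df05f0df0761460cf0cf04252f0605af0cf0a05c61409301d41c225f0df04f0b454096017f07f0a03603cf0d095f0af0c095f08f0c44a234f08f0df0c01d03cf0a09cf08f0c03c03a234f05f0df030f0f05f0b25240704df04f07213f0340d,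
   0x41a216f01f0cf01834f08059f07f03434c0a416f08f0b834f0bf06c12f05f0a20df07056f0905cf0bf0b84c852f0af0b047416832f07f06e04f0bc24f01f0bc4406af09f02f08226423138f0502df0df07138f05f0726222c22a04b13803a06a,
   0x88605604d84c05cf0cf0905cf0cf0a88aa44894f0c8d0f05f05096f0cf028c2f0af0205a02704bf0bf0c146f05f02807416f0bf02f03c068c4017852446f09f02f03056f0a243f0cf09087a44074f04f03f05a44813f0bf04f0585484c86201b,
   0xf01918047a1881cf0cf01948a42f01f06f01065066074f0df09f0df0204781cf0c05cf0cf0305601df0cf0bf0c01b01d036f0d05cf0cf0bf05078f0281cf0cf0280703c03581cf0c074f02f0781cf0cf02f05033912f0103cf06036f0df0af03,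
   0xf0514cf0c416f06f0cf03017232072f09f0bf0d23205cf07f0df0d216f09f0d06a258017252f05f0506cf0cf02416432f07f0201703c05cf0cf07f0401df0206cf0cf09207f0780bf07f0781690603c16811c81cf0cf0106cf0cf0644a642f0c,
   0x225f08f0df0114c14af0cf0cf03f02407f09f08216f07f0d80b06c22504df08f0df0d225f05f0c06cf03225f05f0c862252f0405606a146f0714af0c84c02b01d80df0403cf0bf0405cf0cf0906906cf0cf0281c868f0cf0cf0601701b14cf0c,
   0xf07f03a14107a22f04f0aa24f0af0385841601705cf0cf0905cf0cf0902705cf0c232f05f0da3005cf0cf05063232f06f0df09232f01f0df09207047f04f0724305646214630605cf0df0af0d84c01781cf05816f0af0505cf0cf02017113223,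
   0x80740b486f03407f01f0b107407f05f0bf08113a24f0bf09f0405c027807f03f0a06c84cf0bf01f09027f0384c416f0cf03f0901bf0af0904725205c02701df0af03a22056f08f0dc0cf02f05c4402bf06f0441681af0684cf06f0b207f09816,
   0xf08807f080acf0bf0c08bc28f01f0b02bf06f0b01762806af01f0df0901bf0cf06a06a4226221620720b81a017f0af0960a01b01df05f0141941af0bf04f0284c81cf04f0906cf07f07232f0b21a107f02f0385481af0201bf04f05f05852286,
   0x22910710b82a21af09f0df0af0482a21af09f0df0a03af03f0c06c86262842a42cf0cf0bf02f05017252f0782cf0cf0482af07f0942a82a036f0b03c02d063138126f0bf0cf0a82cf0cf0b053605f0a06a063f0bf0af0d614426f06f0c09cf0c,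
   0x826f09f0a342f09f0c066826f09f0a342f09f0c2462260270a682a01701b42cf07f02207f0af0df0a22901bf0303cf0d20b223f0df08f0d01710b06cf05f06207f06f0df09426c06826f01f0c42cf07f0726205513841cf09f0cf07243f0bf05,
   0x31204781cf03116f07f0d81cf04116f07f0d04bf0cf0210b033262f0b04bf0802d42af0c06af0af0d066f0af0c262f0b03c30af07f0d06cf04f0c262f0b20702bf0cf0b84a462f02f0af0512a017126f0df0101df0d036f0c126f0df0b087066,
   0xf0c04b252f0820bf0cf0aa42262246f0cf0af0af0520b26202b06af0df08f0c226f0cf09063262f02226f0cf09262246f0cf04226f0cf0910e22601742c02df0703cf0af08f0a027123f0df0bf0630624a05a047116f04312f0df0d207f04f0b,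
   0xa0c24cf07f0bf0c262f09226f0cf0b14614af0af0af0b047845f0a90af0bf07a0cf02f0c24aa0323403c08703af0af0303af0af03017a0cf09f0ca0cf09f0c027226f0c017f0b04df0af0c066862f0bf0bf08a0cf09f0c017a0cf05f0ca0cf04,
   0xf08f0d036f0b01df0df0a01df0cf0bf0b06c42c02d05c12cf0c08df09f0cf0b0ac426f07f0bf0cf0bf0b8460560870cc03cf070ca06cf0cf0bf0c066074f02f0b06af0bf0c03c04d05cf0cf0bf07f0303cf07864f07f09a06a0aa4210705c246,
   0xf0898890af078c8f07f08a0c02722c24cf0bf09225f02f0d489f0540b84cf02f0b60cf03f0b04780d88cf03f0b807f02f0841cf04f0202b489f0af08489f0af0880e10e03c05c09c07801b138f08f0d158f09f0d138047f0af0801705af0a234,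
   0x9188c810bf0af0a047889891f0cf0b05cf04f0704b889f09f0405cf060aaf0df0bf08c0690a88af02f0c88988af0bf0cf03498f02f0a48c88602b88c047f06f08f0988c047f06f02f090cc09cf0cf0528c01706cf0544cf05f0568403cf04f06,
   0x10740b20bf03f0b449f07f0c40b20bf03f0b449f09f0c80705a80bf08f08f0105a21af02f0af0102b039f08f04823f09f0902741a09af09f0c03af0cf0441a09af09f0cf04c88c0a03341c80bf08419f0cf02f0303603cf04f090b8f09f05988,
   0xf0df0608b88a889059807813f0810bf0af0301df0cf05486226f0840bf0181381af03f08419f02f09f03c8848a017f098a8f0960a21af09f04f08819f03f09107489f01885903f09f03807f04f09489f0188511af01f09807f06f0881a82a04b,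
   0x47087f09f06f0281a10bf07f04226027f0a087f08f0d096f0806a01da06f06f04216f0bf09f0810e22610b06cf04f0c10703af0df0bf0d03c02701701df0c01bf0df0af0a03612cf0a306f0df09078039f0df06f04027223f0df01126f03036,
   0xf07f08027017035f0cf08226f0cf0a01d01705af0af0cf0b03cf04f0c08b01b047f0705af0cf0b80704bf0b01d087226223f0df02096f0bf01f0b10b05af0bf0c047017f0cf0af03a06226407087f0af0df09a22047216f04f05854f06f0cf0b,
   0xf0d05af0df0901710e027f0d05af0df08f0910e22cf0af0df09832f08078f08f0d02780b047033f0df08f0df03033f0942a0ca22cf08f0df08f0608e80e10e08b04b01bf0bf0801701b216f0af0df0401d039f08f0c055f0b03cf07f0c81a113,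
   0xf0c22af09f0df0412a04713807824cf08f0df0d622f0380e24a24cf03f0df0df0413807824cf08f0df0d056065f0a066f04f0d05af0d816f08f09a1205cf05314047324f0880e262f0df0584a22cf06f0d846066f06f0df04146f01055066f05,
   0xf0df0af03f0980e84cf07226f08f0d0aaf08138f07f0808bf07226f07f0d113078f01f0d02bf0bf0125244c107116065f05f0705af0df0306504df08069f0af0d06cf04f0d40dc48226f01f0df0644942cf0af0cf08078f08f0d02b42a40742c,
   0x5af09f0624a25826402705af0d036066f0df0af0cf0614610b14af0df0914af0d056f09f0d8320ac846f0714cf0df0505af0df06f0a216f08132f07232f03f0d322146f04548066f03f0df09226f0df0326412603307180725280ea03270f08,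
   0xa06807f09f02f0c826a24f06f0903af0311af07f0484509cf04f0b28509cf04f0b885f0309cf04f0b087816622f0b168f0bf01f0a81a24af08f03f0122604d027f08f0c027f09f0c087066826f0a0a6f08f0705af09f06066826f0a027f05f09,
   0xf0af0970230684af07312f03f03f0b017306f0cf08306f0c342f08f0c07821625250305614606614af0c312f0df0af09846312f0cf06066f08f0c017f0cf03152146116f03f0c322113f05f07f0a816056f0c44af0cf07f0a25406c01782cf05,
   0x146f0af0c08e04b84a017f08f0201706c81609cf01f090caf09f02f09a2206c06604704d80bf07f04f0df0cf09f09816f09f0584a42af06468f0cf0a05af0c44af0cf0710e24606c82a20781af07f09816f02f0912af01033f04f02047056f0d,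
   0xf02066f07f0c342f08f0c306c05164066f07f0c226f0df020e2162462226f0df04f0af09f07342072f0df07f0c14a06cf08f0981c146107f07036164f0bf0cf0d948862149145f07560f05f0908ef0303cf01f09f08207f09f08107146f0af0c,
   0xf0cf0a036074f0cf0cf0df0bf0b08709cf09f0bf0905a125225f0df0802df08f0d01b225f0d02df08f0d017f0bf0d40b41c02701df0a622f0cf07f0df0a027039f0b01df0cf0bf0d20e01e06a80e10e24606c04df07f06f0401b306168f09078,
   0x815191036f0af0d12c036f08f0d036f07f0d036f0bf0d035f0b036f07f0d81602781cf0cf0981cf0b225f0df0990c05af03f0524c80d30302d825f0cf0c125f0af0cf0204701b036f0cf0d017f06f0df03f0981c41c09c10702d12cf08f0d138,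
   0x21509c056407815192096017113f0bf0df0df09152f0a017f07f0d01df0bf08017425f0cf0bf0d20744644af09f0cf0a0960d2f0bf0bf0bf08f0612c02b069f0bf0c138f0af07065f08f0a01d246f0a05cf0b40df06425f0bf0a20d11c116055,
   0x8d0a9f0b40df0bf0cf0c22623403622301b01d039f0bf0c0b4035f0d056f0cf0bf0af0360609c231093138f06f07138f06f0701d0a5f0bf0b02740d219f0bf0bf0701b219f06f0b096f0af0a434f06f0b047225f0df0305c622f0cf06f0c116,
   0x512f0af08087432f0a01df0cf01027138f0cf06f0780713212af02f0c216f0cf0913212af09f0cf0303c04d14cf0705cf0af0d438f0c11c039f07f0df0a20e02d12c08df0b138f0cf0b087125f0bf0a125f0bf0a12c027138f0af07138f0af0b,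
   0x1d099039f0bf0c039f0bf0c02df08138f0cf0bf0842a12603605502d12af0cf0812af0cf0b02d12af0c047f0af0d12af0cf0b02bf0b12af0cf0b017225027f0b123138f08f0df0df0b132f0b027f0b434f08f0c11a41a047512f0a40bf0cf0b,
   0xf0cf0a858f0bf0a05a838f0b05cf08f0901df0bf0803c11904705901df0cf0405c071f06f07f0d03601df0cf0c01df0c04bf07f0d047115419f0601df0c039f0af0c01df0c01bf0bf0d01df0c01bf0cf0b12c12613801df0cf0b426f0bf0c116,
   0x84c826838f0af0c82cf0cf0386405cf09f0cf0410e20e81c81610701d039f0bf0c01bf0bf0c90c01d05cf0bf0cf08f0102712622603cf0cf05f0511af07f0d81a03a01df0cf0121cf0af0805cf03f0c84c40b84a05cf0cf0a858f0bf0a84a05c,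
   0xf0c04bf0201df0cf0712c01df0bf0512af07f0a02782c01df0cf0c12af09f0a82c838f0bf0c84cf04f0410708d01df0cf0bf0702b01df0c0a9f0cf0882301df0cf0701df0cf0801782cf0605af0cf0703a039f0bf0c838f0cf0c01d05cf0af09,
   0xf0d0b809cf0cf09f082262344a40470b8f022a4f0df090b8f042a4f0df09017425f07225f0df0801d0a5f0bf0cf0b83881cf05f0388a21af06f0b05a84af08f0c078f0cf0820b0b8096f0af0cf06087f03f0d80e82a01b0ac10b04782c838f0b,
   0xf05f080b8f04f080b80aa0a9f08f0c08b42c0170acf0c0a6f0cf0b03af0c093f0af0c2070a6f07f0a02d425f0af0af06039f0af0c01709af0709cf0df0701df07f0b20e41c81cf02017838138f05f0cf0983801df0bf0bf0901b02df0c017f08,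
   0xf0a05cf06f0d80e05a05c017087f0cf07087f0bf0c41640782cf09036f06f0df0608709c036f04f0df0a036f07f0a01b072f0bf0cf0a10e20e41c81c01711c09c416f0cf0bf0c01df0bf0c039f0a01bf0df0a407087f09017f08f0c83801df0c,
   0x234232017f0803c035f0df08f0d807f0a80b01bf0bf0d01bf0af0d81323203cf08f0d2b0f0df0142603cf0af0df0304703cf07f0d03cf09f0d047035f0d03cf09f0d035f0d017f09f0d08e03c0a503901df0cf0af0c0b8039f07f0c09a01bf0d,
   0xf0af0d80703c816f07f09f0d03c846f09078f06f0df0d80703ca06a05246f05f0df04f0af0d06c03ca0684c14af0af03f09f0af0d03ca06f03f0cf0d216243813342f04f07342f02225f0df06446f0709a84af09342f08066f09f06f08207306,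
   0x146f0c056216f04f0df025062a4f0bf03216f04f0d047096f05f0cf04087093f01f0c0a5f0cf0822605602714614af0b512f0cf05f0914603c225f0df08f0d03c225f0df09f0da4424580b03ca2401bf0bf05f0af0da2403ca06f03f05f0d03c,
   0x80e81a82c09c0ccc0cf0af0a83403c02df08f0c072f09f05017f09825f0cf0af05834f01f0283804703af0bf0503af0bf0583404703af0cf05f0202782cf0a82af0af0cf0503601720e2320aaf0bf0b234f03f08216f01f0b116132047846f03,
   0xf0c864f07f090ac03cf0c01df08f0d0aa0170a9027f0101bf0af0df0c0a6f0df050a6056f08f070470c6f02066f07f0d44a4a4f0af0c04bf09f022264a40a6f0b486622232f08f08f0c027f0cf0b027f0bf0704b24af03f0740bf0b056f0df07,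
   0xf0af0af0d132115f0df05f0b08e20e80e02d08704b01df05f0d06cf0df0204b01d843f0af0bf0d82cf0a06cf0df0682c40740d027f0cf0904bf0bf0c24c449f02f0704df0704bf0af0dc4484cf07864f08f0884c08704bf08f07027f08f0608d,
   0x4b622426f0af092a4f08f01232f06f07027216f0af0cf06017226f0a056f0bf02207306a0cf0cf0cf06a03f05f0c11c033116f0cf0801df06f0c036134132f0bf0a13804b035033f0bf0bf07033f0af08017131f08132f0df0803a033f07039,
   0xf09116f02036f0df08232f0824a238f0cf0bf02f0b017f0cf0c226047066f0484cf0603cf06f0c846f03a24f03f0a056252f04036f0303c322f08f0cf0c270f06f08216033286f05f09286f05f0910731203cf02f0bf02906f0cf0303ca06036,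
   0x9621603689484a027f0c0878c4f0cf0c8c4f0cf0c11605af02152f02f06017f06232138f03f0c234f09226f0cf08047294852f06f09f0b294087f09f03f0b087095027f0df0b306f0bf0b306232f0bf0bf0203c226107056286f0df0801bf03,
   0xf0881af0cf0a82a829f09f0c816894f0b906f01f0c81c892f0cf0b862f0af0c20e816a0611a90a03621631201711cf0bf0c80711cf06f0c11cf0af0c407306f0230cf0cf0b306f0230cf0cf0bf0b11cf06f0cf05a1480703cf0bf0503cf0bf04,
   0x84cf0cf0182af0b894f0bf0c823225f06f0610b03af0802df0bf0c123f06107f0cf07918017928f0cf0503cf0cf0591290c01711cf0cf02087823816f04f0c854903f09f02f09852f03f0290a81384cf03f06858f0482cf08f05906f02426f01,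
   0x1a4f06f06918f0412584c03cf0c82af09f0442cf01f0c06c04d03cf0c035f0df08f0582af09f04f0908df0cf0b89881c03c9181a80b4f08f0c138f0cf04138027f0509cf05f0c20780df03225f0bf0408df010b8f0cf03807027116f07f0d03a,
   0xf0a81c033f07f08918f0af0511604781681cf0cf0681cf07f0c81a88af07f0c036f08f0b407096f03107f0c033f04f0b096f03036107f0c115f0df0af0c81c48c80701df070b4f07f0c01df06f0309340d08df07f0cc09f05f0412cf07838f0c,
   0x1703cf0cf0303a04bf0403cf0cf05f0301bf04918f07f08a0ca44f08944918f0cf02f0191404bf09f08f08894017f08f0804781682af09f0481cf0cf08816f02f01f0809c89882c03c01702df0bf0a02d0b4f07f0df0a82a826123f08825f04,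
   0xf02826f04f0b286f0af06053056f05f02a06f02f040ac48c485f0803cf0c416226f05f0cf022074a4f0bf07027f0b4a4f0bf070aa2070a9622f0cf0af0c0a9622f0cf0af0c2074a4f0b606f0af07027f0b624f07f0a80e20e88c84c89890c834,
   0xf0905af09f04f0924aa42027c48f05f02c4884af0bf09f06017f01f01a42f0984af04f0980e22642648618362402d262f06f04f02f0662402d225234f0df08425123f0bf0cf0cf02f06047407f04027f0cf0a262027f0cf06246f09f0764282c,
   0x21c44a252f04f0382a06af08f0bf054a4f05f07027f09f0a80740bf0b0aaf03423f0bf0c40bf0bf0844c44a1130ccf01f0b8510ccf01f0b0ccf01f0b01704b40df04f08a0cf0bf05c4404bf09f04f0344a12346224ac0cf06f0af09f09462458,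
   0xf07f054c4f070a5f06087f0cf07816c2244af0908df09065f09f0402742640bf09f0af08047f0bf06047f0bf06426486226885622f03027f04f02096622f0302704df02f0df03622f03027036f0cf05f062160562622a2f04234f0af0df03f03,
   0x864f0552242af0af0cf014c2c06f0114af0484af08426524f04f0a606462f0c522f09f03f0910748a426f0348cf0bf04f0142642af0cf0442af044a4f0cf0402e01e10e08e20e80e04b84609580df09f0480df09f048450334c4f07886f030a5,
   0x9c522262f0af07234262f0a454f0cf0816442340bf06f0b074f02216f0405cf08f0c017074f0865006cf0af0c03cf05f0c854f0407405cf0af0cf0408785481cc50f09f0105cf0af0c864f0552242af0af0cf0185484605cf01f0c05cf0af0c,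
   0xf0c452542107512f0548af024c8f0bf0548a50af0bf054c8f0bf044c280bf030ccf0bf04642720606f0af0608740bf0af07f078c408740bf0348af05f0b40742af07f0c8c842cf0206cf05f0dc4405cf0af0c468f03f0c6c0684f09454f0cf04,
   0xf0c0b8f03f03f05f09c09c03889f0cf01f05f0948901788641cf0cf01486f09407f01f07886c03f0cf01f01486f04f01e04c18f0448502708df03f04c84f09c88f0cf070a3c88f0c02b027f08f0642a423f0af0cf044a4f01f07c88f0ac48f01,
   0xf0cc0a44af0cf08458f01f0b027426f03c06f0af04c06f0a42642af0af0bf0ac0a44a033407429413f0cf0af0cc06f0a42af0c426f0cf0840742af0c426f08f0cc06f0a42af0cf07036f06485f054c8f0cf04c06f0af038a888a047c0903c81c,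
   0xd0228cf04f0b486f01f0bc0302701df0cf0cf09407f0740bf0bf090339030acf03f020acf0308d0a5f0bf0cf010acf0308d03cf0cf0bf0168421cf0af030acf0cf08033c06f0a486f0cf09c06f0a486f0cf0948609a08740b407f07f0c407f08,
   0x498458c88f0304d05c11c036047207f06f06f0620720df05f0182c0b4f0bf01f04f0af0a01df0bf0a05cf04f0cf01688c0503c82c864c22f0bf0cf03c09426f01f0bf0b0b4f03039f02f04423425f04429f0cf07e04033e0108df09621f04f06,
   0x93036f0148605c660522f0a4c4f0cf02464f01f08f07f0b036f030e4826066f0b42af07f0d42af01f0d4e0f0af06486464445f0cf07624f05f0bf0b48642a423f0cf0cf0cf0bc840a342640bf0cf04f09486485f08f0cf0b09c84c88cf07f0a,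
   0x609342852017c0a40740bf0b42af0bf0c486f0af038c4f07f06c0a819f0381af04f06f0460af02f0bf04c0af02f07416c0a017c06f0af06426c06f0a407f08f0844af0bf0a48a4a4c24063486f02f0b486f05f0bc2204d0ac09cf01486f05f0b,
   0x48640b413f05f09f0b483207f08f0810701b423f08f0b093113413f0af0b413f0b42af0cf08f04462f0c429f0af0c462c03017423f0af0cf07027f01c12066f08f07f0401742642af07f0cf0b42af0340bf0cf0be0802760af03f05426f04f06,
   0x41cf0df05c0941cf0df0a41cf0df080cac2242a423107243f0af08f0a123c84f04c14614f0bf05864854f08f0cf0762422c434f04f0bf05f01027426f0df09426f0df09017f078c482cf02f09f02f09047426f0cf0b407f0b41cf0df0a642407,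
   0x5cf06f01464f080476058c4066f0bf0b86403301d485f05f0cf0282cf01f0501b01df09f01854f01816f08f04f0801d815485f08f0c485f03f0c01bf0909cf0af02063c44f0af07c44f0af07807486f0bf03407f0b50cf0bf084164c4c0a80b,
   0xf09063215252f0cf02252f0cf08f040ac0870a6f040aaf0cf0b684f020a6f0bf0c017344f01252f09f0422cf04522f0cf0701bf04f0442642a62422cf04f08423f0bf058074a8f0cf08f09017486f04f0c05af0941cf0cf09454047c44f0af01,
   0xf0bf044622466426126606c0f08682017622f03f07f02107622f04f09622f08f09f07f082622c4f01f04342270452234254f0bf0c16842514cf0506af0cf0a429f04f0803c864522f084c4f08f0c07806cf0af09138f05f09226f0a0b4f0cf09,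
   0x2b425f06f0d426f08f0c464f0c01df0af0cc0c446c424c80c64454c2c844c4f09f0c48a542483f04c50950f05f04252f0124af09f09c50906550f06f03d02f04f0502741a854f08f06816f08f0341a854f08f0609cf0709af0cf0442a486f09,
   0x3c01df0af0df0a0172a4225a24825f0af0cf08324f0522cf0cf09f0303c01d116f0df09f0df0a01df0cf0d285c81f03684f04f0708df03f0b48c0274984c4688f08f09f0c4c440bf08f01f0b4984c4688f08f09f0c4c440bf08f02f0b42c027,
   0xf06f0ad048254c1f08f04f0a825f02f0a4a4223c21f0120df05f0cc214c4f04f0cf04f0a48c01742af02f0221cf0bf0450c08760cf07f07485f0af0a80d10b825f0820df0bf0b825f0820df0bf0b0a5f0b035a0501742942af0a20df0bf0af04,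
   0x825f06605f06f06c44c8444a48a20df07f0c426416047f05f04446f0bca0f06f0110706a14af0bf0bf0c06af0af0c85484cf0af0c46801742af08454f08f0c829f0af0408bf0af0903384cf0a483f08f0748a20df01f0c20df07f0cc24701825,
   0x485426f09f0c426486f0cf0af0c449f0cf0309c093449f0c059f0cf0af050c541948660c08df05f0c48af0af0c0b8f02f0c449f0cf0a41cf0c449f0c0a6f0cf0c445c0c48c40750328cf0bf0b28cf0bf0b454f0bf0b60c213e01f03603f09f02,
   0xf0df0348648af0bf0642c464f0c0a6f03f0bf01d10548f05f04407506f0284af0bf0584af0b4468c4f04f0cf0340d42c48c08741a449f0cf08449f0cf0641a449f0cf08449f0cf09446606c0c0a3426f02f0c426f06f0c5814c4f06426f09f0c,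
   0xf034890aaf05f05f0644a1070ca88cf0bf01982f05f018070caf03f04f01522f01464f04f0a017107889f09f04c06f0190cf02f0b889f09f03886486f0690af08f0203c02701d036f06033f0b131f0df0988cf0bf0802bf0101d06611af0af0d,
   0xf0541af01f0b02790cf0b45414af0cf01d02f03407f06f0390cf0b45414af0cf01426f01087f04f0384c48cc8442c468f06f0c28c4c4f0bf0c08d52802d445f08f0cf0c449f0cf09f080b4c44f0b590f05f07f0188a98842a04b88cf0b42cf0a,
   0xf04f0cf0484a88af07f0cc48f09f0cc42a4244af06f07f05816f01f0188a909f05a0a889f0c189f0c119f08f05f01f0c90c08df01f0bf01017a4244af04f0484af0c44660cf0cf01f0881684af0cf0588c81af0bf09f0910e948d1084c90cf0b,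
   0xa42f05c44f0cf0304b10b40bf0c60644a087f03f0cf0760cf07f0644a606087f03f0c60cf09f06f0680ba42f0bf0a606f0260cf0bf020c924a08d90c88af04f0cf0510e80d01bf04f05f0cf051c818a84a88af04f0ca42f04f0430aa4264888a,
   0xf03f0b21a027017f08f0c407f06489f0541cf0df0b10781c813f0cf0341cf0df02612605213f03f09f08f0344c80e84c48c04728ca0cf0bf03f0408d443f01f0cf0808b48603348af0c087f07f0c48af0c41cf0cf06246027a42f05407f03f07,
   0x42c22342af0cf0a509f0242af0cf0a81a483434f08c824c2486f0c48cf0cf08c81f0cf01413c4840df0a41cf0df0941cf0df0805af05056f0bf0a4264a242af0b489f08f0c08b02df0af0c05af0941cf0df08407f0a429c06017f02f01017f04,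
   0xf0cf0d01d40709cf0cf0af0cf0d48981a027087f03885f0bf0a05af04813f05f0c889087f0109cf0df0603c0470a5f0909cf0df0840709cf0df0809cf0df0a81940709cf0df0140df08f03087813f0880df0b09cf0df07885f0af0509cf0df0a,
   0xf0cf0cf0d09a01df0bf0df0640701df0af0d01d039107f0cf0bf0cf0d10b225f06f0a01df01f0d58168420b01df0af0d01df06f0d0474a201df06f0d01df08f0d60552248cf0cf0848cf0c486f0cf0840d41301df0bf0df01f0102701d407f0a,
   0xf05f0460af0af0642a063f04f05226f0cf0201b08b485446027426225f08f0c02d40742af0cf0af0cf0c407f07f0b10746401dc84f01f01f0d09501df06f0df0742cf05494642f0501df02f0d43201df07f0df080a5226f0b0b80c504701d039,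
   0xf0df0a09c60af02f0a08b20709af0c407f08f0c05a09af0c04bf0cf0a449f0bf09c480270aaf0bf02f0411a01b81af0cf03f0660a02721c40bf04f09468225f0af0cf0421c4c8f04f0c03cf05f02f0648340742a40bf09f0cf06f0520742a10b,
   0xf0ac4882af064a8f06f07f0af0221af09f0c48a44ac0a09960a40b02702d449f09f0c449f0af0c454f02449f02f0c027454223f0c4c8f0af0cf074644c8f06f0c624f084c8f04f0c017f05f070a360a01df0741cf0df07f0640bf0b01bf0c41c,
   0xf0af0cf0cf0b132f02f0b52810bf08f0cf0c01701bf03f0501d02bf0bf0af0344a446234462f07f0c644660454f0b4c8f04f0c06af0cf03464f0cf0b017087036f0af05416f0bf06f060caf0884af0830a26260cf0c06cf02f0c2c24c8f0a548,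
   0x413807528f07f0c10b528518f09f0cf0cf0280710b528f06f0c407f0cf02129528f08f0c512f0b621f07f0803c10740bf0cf0402d40bf0cf0a10df0c40bf0cf08f0344a138407039f07f0620bf01416f06454f0af0802bc0af0754101b01d449,
   0xf0cf03605f03f0401780bf06f0a80b813f0af0cf0af0c40bc0a489f05087446f0cf080aaf08f0cc88047489f084a4f0bf0c489f014a4f0bf0c20bf09f07c0a44ac12f08f0601701bf0df06522f08f06027407f03f0a522f02c88f04f0b50944a,
   0xf0a446246017c22f0af01027f0bf0a24c03c522207f0c225f08f0c087407f0cf01107704f06f08648226f0cf02f0142cf0af0b017522036f07f0cf08027f0af0a468f0bf0b48960a82c017413f0cf08a22f09f0321360528cf02207f0cf0b40d,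
   0x1d066f0b059f0bf0b82cf0642cf0df08036425f0af0c20b42cf0df0802d42cf0df04425f07f0d425f08f0c22c20df0842cf0d425f08f0c42cf0cf0740d42cf0cf05234522f08688628702f0160af0242cf0cf0bf08207f0642cf0cf0a02df01,
   0x944f0805cf04f0802b84af0c862864f09066f09f0906c868f06f09f0986284af0c864f09066f09f0984af0c85842af0160af05f07f0941a42a50a48a40bc0ac03f0720bf03f024264a406c04d0270170a9413f0af04225f0b429f08f0bf0401b,
   0x41cf0cf0401d03c03af0cf0af0b489f0cf0680b44a90ac44f0ca0348af09216416f07852f09f04f02f03f0781684af0cd08f03988858a03158f06f04f0af0bf0784af0cf0520784af03f08a44944942a03f08f03f098c4c48f01f0cf01f09a48,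
   0x116119f06f07c0af04f0bf06c06f0b702f0690cf0b407f06f0348c41cf0b494f098c4c1281af0bf04f064b0f09f0542c12cf01126f02f0201d48950cc88f0bf0502d08df05f0bf09f03c88f0b03541cf0cf0902df0cf0780e84c48c01b08df06,
   0x84af0cf0984af0c08df04f09a48407126a0af0cf03426f08f0ba44306f0112cf01f0a84af0cf0b88a21c06c14a84af0cf0b50cf09126312342f03f0bf0303603cf09f0df0784af0cf0841cf0684af0cf0b84af0cf08c0c087c06f0b506407f03,
   0xf01f0bf0920e10e80e84c04740d42cf07f0548cf060ac41cf0cf0301d03c10d017f07f0df0df0c08df08f0548cf0242cf07407027f07126423f0bf07f0c44cf06f0ca0c81c8520cc05cf0cf0c8c4f03f0b12a87009cf05f0384af0ca14f09f07,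
   0x219f0bf0c48af0af0b44c0cc41905a4c8f0bf0288cf034c8f0bc18f09f0b40df01f092c4f0b2c80ca20722cf02f0122cf02f0101b05c08d055f0df0bf0cf0d458f0b05cf07f0df0b0a309cf01452f0142af0140d48cf0cf0bf0c0ca4c4528f04,
   0x489f02f0a614f02f0102bf0610b423f0b129f09f0b489f03f09027207f0bf0cf0a80780b01bf0df02f0709af080d8f05f0c88a41c08744cf040acf0942cf05f0c407f0cf060cc4c80a3f04f05489f0b44cf0cf0c0c9f0b21cf0cf02017f0b027,
   0xf0822641cf0df0af07107226f0a036432f0cf07f02113017087f0cf0401d027f0bf0af04017087f0cf0401d027f0bf0af0610ec0c01701b14af0af03f0150cf0901df0af0220d41cf0bf0380d10df08f08c0af04f0608b40b42a44af0a446107,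
   0xf0bf0c644f0444a443622f09f0562206af0af0cf0540b06af0af0c06af0af0c08e20e80e41642650602741cf0d226f09f0884a41cf0df0a48af0bf0151442502df0640b40df0df08413f01f0901741cf0df07f07425f0bf0c04d226f0b066f0c,
   0xf01432f0cf0a06cf0bf0a41af0af0248940d08742af03432426f0c41cf0df08f03426485f08f0cf01491485f0bf05035f07f0b42a4c4f0cf0606a4c4f0cf0bf0c08706a40b44af0cf0804bf02f0c078f0cf0b06a56014af08f02528f06f0c06c,
   0x6cf0bf0b07205af01f0bf0248c05cf034c4f0bf0c10b80b41af0bf01f0394890af0bf0811a40bf0242af0af0c126056f06f0cf0a06c06af05f0c05360cf0bf0460cf0bf0420e45248648c04740df02407f0c027f0cf0c40df08f0c01706a0ca,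
   0xf0cf0541cf0c116f03f0448c06cf0cf09f0914a01d06a14cf09f0c06cf0bf0705c02bf0bf0cf0bb0206a05a20e41af0409cf07f04f0af0b06cf0cf0820e05a83803af09f0cf0bf0706a24af0df0a06cf0cf0b20e81a20706a41af0405af03f0b,
   0xf0af0df0ca4484606a431f02452f0cf0af0b04df09f0d06a0ccf0cf06f0b08e45289480e458f0705cf02f07407087f06f0b458f0605cf0cf080d4f03f0306a01b44af0cf0a0ca0ccf0cf0bf0a027056f07f0d05cf0cf0610e80e82a06a09c41c,
   0xf06426f06f0d423426f0af0d407f05f0a107066f0bf0320ef0bf03087f06f0340d506524017512f06f0bf06047426407f0df06f0d027f0bf0503c10706af0c01df0cf0a027f0cf0a486606470624f06f08074f0802df0cf0af01017f05027059,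
   0x50cc06027413f03f02f02017f0904705cf0af0d036f07426f0cf06027f0480ef02f0802e44644a486c4208e407f0b4a4f07f07c44f08f0720720e074606852f03f0cf0af0af0440708ef0af05426f01f0dc42017506f06f02f07443606807c22,
   0x20ef0df0404df0cf0108e2314a8f0cf03f01f0148c0cc01705c0e8f07f0cf0b027f06f080ca807f0520ef080d8f0cf08017027f0205cf04f0cf0250ca03f04f04c0c01748af05f03423429f05f0c036c44f0bf0b02bf09f0b02740bf09f07f04,
   0xf07027f06f0744c074f0842c40d01701d445f0cf0b445f0cf09072f05445f0cf09027207425f0cf08425f0cf0b056207426f0c05af0df0a033017f0cf0af060d205c053f0bf01f0d05cf05f0d02d0ac12cf01f0720708e01709c138f07f01f0a,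
   0xf0314cf0c48c8c8f03f020caf0cf0c80e48c096f0af01027c28f08f04425f0840df0904df0bf0d017f07027548f0cf0b14af01f0c44c036017f04066f0af0c2070cc03cf03f0d03cf05f0d548027f06f0a03cf02f0d01705cf0af0d20705af0d,
   0x3c08ef0af04f05027425f08f0944614af04f0cc09f0bf0110703c06cf06f0cf0708ef07f030cc02706582c06cf0bf0c12cf07f0206cf0af0c03c08ef0c84a14a06c14cf0c86401df06f05f09f0cf0cf0c81c84af09f0c14cf0cf0a40d445f0a,
   0x8df0a48af0af0c44a08df0a0c904df0bf0af0508df0af044074c4f034c1f01889f04f0a544f09f0b04b454f0745801df0b41cf05c0cf0af0cf0701e54450af0bf07f0bf0b04e01e02e10e44c84cc0c80d017816845f02f0b06cf01f0c858f01,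
   0xf0b407f07f0904701e0c6f09f0606cf0920e02df05f0bf0b01e846f06f0706cf0920ef03f0b50c48c78001748a44af0a486f0cf0908df0af0940708df0af06f0702741c02d425f0af0944af07f0201ef07464f0703cf09f0841c486688f04f0a,
   0x407f02f0c04720df0bf08f06207684f09e04f04f0b7044074c4f09f01f0b407f06f0b02710e145f01f04a42f0202ef07f0310e04df01f09446f01f0404e24602d41c425f08f0701df07f0941c01e06c544f06f05f0cf0642cf06f0520720ef09,
   0x462f0b489f0cf01063f07f074a8489f0cf03451f0808ef08f07c05047845f04c09f0bf0540741cf02f04483486f0cf09f0784c644246642e0202760920df06f09f03415f01243446f05f0cf061075414c4f09f05f0310dc09f01f09f08017f05,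
   0xf0cf0b02e48af0cf09f0c12301ef09f0101e415f0cf0bf0384a08748af09f02f03c48c0a06688c462f01f0b01702ef0af0904b548f0cf0306af04f0c02ef09f0c08e48602ef01f02f06027f07f06207f0214af03f0b60c4854c10274c4f07425,
   0xf02423f06f07846f0bf03605641027407f0df05522f02f09f09644f0cf02506207f01458f02f0c20706af09f0a06af06f0a027407f054834a1f04f08f0848af0c0d8426f02f04f0942a42610b42cf0bf0c4c2464446f0cf08f038074860ccf07,
   0xf09f026c080b48af04f0c4c4f03f0c0174644c4f06f0c4c4560f08f0cf0c426f0af0609c8138160ccf09f0c550f0af04816f01f01087807f04017047f05f0df0a08df0c09540bf0df0bf0c46260601706360cf03f0cf04468f07f0380720702e,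
   0x606f05f0401b462f0780ef0b43202bf06f0602e06cf0cf0bf0384c0ccf07f0cf0920710b02e06cf09f0380df05f0950c0ccf08f0c06cf09f0310b48a20ef03f04f0c10ef0b06c0ccf0af0cf064c84e024342648af07f0c462f0af0547050af05,
   0x48cf05f0402df07464f04f0c047027f06f06605f0cf03644c0cf0bf05f0541a48644645805c087f07f074c822580e48af08f0c4a848af05f0cf0402e80e48af09f0cf0648ac0af05f09f0c80720e14346842602ef0bf0cf01451f08f0c464f05,
   0xf0cf0260902b483f08f070ca14904bf0d06af0cf0984c02701ef06f080cc05cf07f0c08df06f0c01701e4154c4f0bf0cf0905cf08f0c08780ef01f07c44f0588c08df04f0cf0810b48cf08f0c04bf0df08f0a42901ef02f0c42cf0cf0b0174c4,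
   0xf05f0af0102702bf0cf0944a4c2f03f02f0204e01b08b60c05c0ccf0140bf0df06f0440bf0df0160c05c4520c6f03f0801ef0df02047f07f0480780bf01f08648f04f05648c48f0260320ef08f0cf0560c41c468464017416f0af0c05af0c407,
   0xf0902760608ef01f0bf0348a44af08f03702f01f0754802b06341cf0af0d42341cf0af0d30341cf0af0d41cf06f0df0704d41cf08f0d05c04bf0df09f0802e548f0a0cc0470874c8f0cf05f01f0110b12af06f0842af0af02c0c107f024c8c48,
   0xf0af06246f09f0a24624a06af0cf0af0bf0742640b42a05a80bf0802bf0c06af0af0c612087c0a05908bf08f0cf0cc2248cf01f0941cf06f0df0702b41cf09f0d072f0cf06f0cf0ac0a20b20e08e48a04bf0df0504bf0df02f0b80ef0104bf0d,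
   0x80784508ef08f0c053454f0df0848cf09f0c852f0281608ef0cf0cf03c0605a20b059f08f0c053f08f0b04744a50606af0cf06f01f03c420ca059f0af0cf03f0464201b053055f09f0d80ef0244a52206af0cf07f07f07027f09f0902b80e419,
   0x2e42a42cf01f09f03f0710708ef0af0c40708ef0af0cf0d4c1036f06f010c310b10703380e48cf07f0c02e04bf0df05432f05f0702ef0548cf03f0c80748cf04f0cf0b10705304df0bf0b10ef0a48cf0af0c461432f02426f07f0a08ef0bf0c,
   0x24c468807c0c46414a02724af03f0cf06f02f0806cf01f0c6484640e8f08582f01f06f06f0142cf05f0c285702f04f04489f04f0801e41648620e4c1027407f0bf0d04bf0df0805320742c04bf0df06055f07f0cf050c30a3063f0a423f0af05,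
   0xf07688107f01f0148c02b84cf0101df07f01251f0120df0cf0108701e20df0cf02c88f09f0402701df08f05f0442662203624c262e02f08462f05f0c462f02f0c462f06f0c017648f02262f0af02027f09f0c017462f04f0c462407f0af0df0c,
   0xf0bf05452454f0cf0bf02207f0709303c01df03f0d09cf07f0903cf04f0405601ef03f0c41c42905301d01e02df0cf08f0cf0501e02ef0cf08f0c80701e42cf0cf0bf0c01e42cf0cf0bf0c09301ef0af0d01ef0af0d4c801702df08f0302df06,
   0x413f05f0c04df0803cf06f0604780df02f0bf0644944304e60c05c06c01e4c2454f0cf0a642027f0302ef0af0d14c606f06322f0cf0360681342af0cf02f03846017544f01f0af0940b454f0cf01f0845148c605f0221cf02f02063464f0c416,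
   0xf09f09426f0cf0a01b81cf03f02189f0cf03017099f0bf018a8f01f08213909d08f0b18908e08df0bf06606f0484af04f05819f04f06d01f04f01909189f02d08f0bf04d01f04f0114c08708df03489f02f0a08df0305cf0bf0110e01b81af07,
   0xc05c09f05f0608d843503505f02f0b035f03485f0b458f034c4f03415f0af0c807f0680df0bf070a91850acf0908ef01f0788ca84489819f03f02f0909998880df0bf01b04489f03f0b8a8017c21f01f0342af06f0981cf02c88f06f0340b413,
   0x17438431f05f09f04035f05f0a04710ef0cf0942910ef0cf09f0d126039017f07f03426f0b425017119f0902ef0d01bf0df09f05047017f0bf09f01036035f0bf03027107416f0cf05426f0cf04129f0cf0902706cf06f0b06cf07f0bc0c407,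
   0xf0b415f0df0a01703310df07458f0cf05426446264f0bf0cf05226f0cf06416f0af0bf0b02d05c078047858f03f05431f04f0122c017074f03f0cf06017f08215f09f0c017f08f0810d03c42a123207113f07429f01f0d20df05429f03f0d50a,
   0xf0260cf09f0a10702df02f0d225f0bf0108701713803cf01f0cf02f0b027f0402bf01f0b10711c123f06f02f0801703a129f06f07f03207f06f0c02e60c50c027425f0b20df0cf08035458f0cf0642504ef09f0cf0a01701e415f0cf0901bf0c,
   0xf01f0df0703c82c03af0701ef0df0603a02df0102ef09f0d01ef0d10df08f0d429f05f0942c05c20d07840785114cf0405a09cf06f05f05468158f0bf0150cf01f08017131f0203c039f0df0af0cf0722902e03c41a02df09f0df01f0c234291,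
   0xc09c84087f07f06017894889f05f0af0589409cf0cf07f01c81c48c0af0bf0c40bf02087407f09c84f09f0af0150c80bf08807894f0bf09f0b10d80780bf09f03f0402711cf0c095f09f09c90f0af0202702d42a0acf09f0a03cf04f0c42c02e,
   0x2d03cf0cf0af02891807f09f0484cf0cf01107c14a05f02f098c4f0cf05d04944f0b845f03f06894f0181cf08f0cc06017e01f04f03f09e01207a05f04f04988f01c44f05c41f02f0b10d89181582cf04825f03f09f03909f01f0650cf09f04,
   0x485f0cf06f0103cf080b4f09f084c48c14e0f081c40e4f05f0a5810175a04a1f0bf01f03485f0cf0402d485f0c50cf0cf08f020c9f09f07189f05f0508703c485f0c468f0cf07f01485f0cf04e04c4481c10d03582cf05f09f09f0902711cf04,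
   0xac4a40cc099429f0bf06f0701742642a429f0af0cf0c039f01f0cf0560c20df0603902ef07f0c02df0cf0a05cf0350cf03f03807f04f02c0c80d88920df08f05c844a48a4f0b4834c41072850e4485f0cf08485f0c50cf0af08f04285684f03,
   0xf0480ef03f0c446f0cf0602742c035f0af084c40a5f04f0bf0a4c428af01f02f0a4860274c4f01f0c4c4f01f0c688c0cf06f09918f04291f08f0308d42c485087f0a02df0cf0701742a426f0b44af01f0302df0c438f0af0b03902ef0bf0cf04,
   0x9cf0bf03039f0af08f08f0944340bf03f0c506f09446027f0a454f0af0c454f05f0948620d096f0cf09f06119099f07f0c18980b18cf0cf04f0110bf0cf0548960c087c0c0a94c4f07f01f01f032894a1f0cf09f0850c087c0c42c02df07f02,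
   0x4a1f08f0c5840c5f02039f02f0a22502df01f0702df02f084c442c09a047096f0b09c50cf09f0cf0c09cf08f0c027f0af0a80d02df05f0bf060a344af06f0b44af06f0a80d20df0bf0c02ef0cf0b08b4834c40c302d80ef08f0cf07c84c4402d,
   0xf0bf0cf06431f0af08036072f0bf0c072446f0bf0c039f0405cf0af0d02ef0920ef08f0a01d48c08d49802d88c09cf08f0cf0340bf07f0a08e0cc09cf02f0d28c1070acf0bf060acf0bf0604ef01f0d04e4854a801709509c425f0cf0af0cf0c,
   0x81c02702d0acf08f0cf0702df02425f05f0611c0b8017039f0348c095f0bf0bf03039f09f0508748cf0af03498f07f03056027036072f0bf0b42cf02f0b036072f0bf0b074f02f0b48c01b4c4f0944af0af0c4c4f0944af0af0c02702d0ac0a9,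
   0xf0cf0a04721cf0d12af0df0721cf0df0780e44a446f03f0a246f0cf07246f07f0a813f0550c05cf01f0d48cf07f09017047036039f0cf09f060b4f09039099f06f0df020b4f09f0609c0c60ca462f064c4f0644af0bf0c4c4f09f0b05cf0bf0d,
   0x82c20780df0780ef0cf0c50cf05f0b11c047819889f0805cf0bf0d825f07f0a48911908df0c90c81cf0bf0bf08f01095f0cf0601df09f0df0b08e09c20e017f0af0521622602b21cf0df0401bf0d225065234017f0df0af0b232234f0bf05207,
   0x446f09f0a44544af0af0cf0902df0cf0b22c80d429f0cf02429f0b14cf05f0809c01df03f0d9c048c429f0cf08f0348c429f0cf09f0303c10d48c08e816f0cf04036f0b056f020ca44a4c4f0805cf0af0df084c4f0805cf0af0d09c017f07f0a,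
   0x87f074c4f0201df06f0d09908d017485f0c445f03f0c01df05f0d20e816095f0b01df06f0d894f02f0380ef02f03207416f05f0c42af05f0af0b09a04701bf0c03af0bf0d03af05f0d4c420760af07423f07f0a48cf02087f0201df02f0d207,
   0xf0646402ef06f0cf0c02d41903cf08f0c03cf0af0c42a01741940bf0af0cf08816429f03f0c429f09f0c10d426f0a03cf03f0c44601750c429f08f0cf03434f0cf01047462f06f0a452416f06f0c05af0741af0df0a04e02e42c50c407514494,
   0x12cf06f0b02ef06f0c12cf02f0bf0584c08d20b01d02e02df0cf08f0c02ef05f0c40b10b02ef09f0cf0502ef02f0c01b14a02df0b425f0cf0702ef07f0c036f02f0304702df0b509f03f0c02e50904df0cf09f0cf0c02705af07462425f0cf0a,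
   0x4c4f0a20e24c446f0cf06f0a05cf05f0c4c4f0af0360960c02e4c48c4868f0282cf04f0a84af02f0bf01f0a80780e82af0602ef05f0cf0a20e80ef06f0a02e82cf0280ef06f0bf0b02ec0610e14cf07f02f0b08df0af03f0a06c10d047074548,
   0x183c44f07f0ac44f07f0a10720e24cf02c09f02c44845f0548cf05f09f0a41af0df0814630a02ef01f0c642f0641af0dc44f03f0af040cc4c8c8448cf09f09c6002702ef07f0c41af0cf04c4480ec22446f0cf06f07f0901d4c4f0a464f02f0c,
   0xf0df0b04bf0d42af0cf0108bf03f0906a08b42c48af03027f06f0df0b84af03027f09f0d407486f06f07486446f06f06f0744c41c01e42c50c84c44ac4284655005cf08f0c452468f0cf05f02c4480b832f02036f05f028c8889f05f09f03f0a,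
   0x2d01b02e42a03903af0781cf0cf0af0702b43104bf0df06f08419f0d225f0df08065225f0df09069107071f05039f0df0b039f0503cf0d027f0df0a027f0a04bf0df0c02e017407f0a08bf0622cf0df0808704bf0d42af0cf0703504bf0d225,
   0x4bf0df0201e04bf0d0caf0cf08f0d183425f05f01027f0604bf0df07f0b08b02ef0a01ef0cf0284af0304bf0d03cf0df0b02e03af0708d02750cf0cf0a066f0af05f0280e01701ef0cf02f0702706af02f0c84af0b04bf0df0542904bf0df0b,
   0x8bf06f0c10d84502e04bf0df05f0280df0a04bf0df0750504bf0d14af0af0cf0b07806644644a14342904bf0df0406af0cf0624604bf0df08f0648c8430c684a02704bf0df0af0504bf0df06f0b06a069f0c039f09f0d0cc039f08f0cf050a3,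
   0xf0cf080e806941af09f0cf0c04bf0df0604bf0df0604bf0d10df0cf0a44c08d4a404bf0df0801705a01ef0d08ef0bf0c42af08f0a45242604bf0d05af0df0a04bf0df01443f07486f06f0cf0b42a09344605af0b04bf0df06f06053f0704bf0d,
   0x17407f06f04f0502b468f0bf0c445f07f0c20d01d02d44550c4c80e804bf0df078070c680e04bf0df05449f01f0b04bf0df0808b04bf0d065f0d06cf0df0504bf0df0906a01b04bf0df0980d06cf0b04bf0df0704bf0df0902b0e404bf0d44a,
   0x2ef0df0702df05f0c06c429f0af07f0648c027036464f0cf07f01407f0cf064c10174c401e407f0cf0980d407f0cf07407f0cf08f0b0474c401d01ef0cf08f0af0bf03027622624225f05f044e04a4489f04f03f08066443f04f06065f0cf08,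
   0xf0601701ef04c44f0a05c494f09f08f0c01ef04c44f0a05c494f0902ef0cf09f0c036107f04f0441364101ef0bf0c02742cf04462f0c407f08f0d81342cf02f02426f03f0301bf07074f0cf0242c0b106c01d08df0af0142af0306af0cf0a251,
   0xf0af0514a18cf01f0b503948f04152f03f03548f0cf07053644f07f0c01ef06644f08f0c04e20d06c0cc628f0114c02d06af07464f0cf0905606af0cf0bf0405c01ef08468f08f0cf0c84c04701d01e03c02df0af0cf0705cf0af0cf0b464f0c,
   0x42af0cf04462f05f0cc8248cf0b4c4f01f0bc03f0104ef02f0d48cc44f0850c42c42602e06af0bf0bf0c62101745201e05cf0af0cf0a04784cf0bf03f03e01f0284af0420720ef05f0cf02017425f05f0cc06f09f0401706c02df0af0df0b50a,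
   0xf0b0e2066f04f0cf0b06502d06af0df0bf0c066f08f0c605684047f0a407f0df06107407f0af0514cf0112cf04168f0af0a407f0cf0a684642017603f05f0604ef05f0dc44644522f0af05f0b644f01f0b483c06642f05f05c0980ef04f08262,
   0xf0c42505cf05f0bf0c08d027035f0702ef0df08f0cf0120b24380b01ef03f01407f0cf0502d01704e264f07f0cf0df03642017258f0804ef06f0d258f08f0464420ef06f0c04ef08f0d407207f01f0c207f06f0a0c626402714c407f0af060e4,
   0xf0a017f0cf0750cf02047f0c14af08f0c01df08f0c02d09311cf010ccf04f080ccf0411cf07f08c0308ef0305c06cf0df09f0b05c02ef0bf03f0b24c06c42603305cf05468f0bf0c06a42af0cf0bf0522502d0174c4425f05f0c42503cf0af0c,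
   0xf0201e462027f0b464017f08416f08f0c425f07f0a01705cf03f0d407f0942af0af0c80702df07f0c02df07f0c056852146215107047f0c017f0c207f0cf060d201d464f04053f0d407f0cf02f0cf02027047f0cf0414a047f0cf06066047f0c,
   0x1bf0df0a407f0df080d801df09854f09f020acf03f0881a4c2642416f0cf06852f07f03413f08f0605af0af0b4c208d01df09f0c42a8c2f03f04f0bc03c06864854f03f0208d01df09f0cf0305cf03f0cc0982c08df064c4f01f0b864f05f05,
   0x9c49445223425403cf08f0b01df0af072b065025421cf01f0bf07055294f05f0b074f07f010d8894f03f0cf0542a01760af0601df0bf0360a01ef0c462f0cf05f0320bf06f074520e44a4f06f0801701ef0b05505a454f0cf08415f09056f0c,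
   0x41c42c0cc10714c1c8f0706af05f0101e02ef0bf0c452f03f014c404e09c48cf0cf02452f0148cf0b28cf07f0cf0df0b84c20701e02ef07f0c12cf09f0701e12c02ef06f0c02ef05f0c12cf09f07c4402704ef06f0d08708ef0af0550cf0af02,
   0x2ef07f0250c02e462f07f0c82608ef06f0a066f02f09429f05f0710708708d08ef0bf0cc05f0a40701b80bf04f09c09f01f0101748cf06f0bf03509903f09f03905017854f03f0380bf0bf0a017903f05f0980bf0bf0a01d01ef0af09f0260c,
   0xf08f0381990980bf09f0a858f01f090ccf08f0c03c0cc11c14af01f058e008ef01f0d116f06f01f0b01df0cf0a21302d03c10df0af010b4f0bf0682902ef0cf0388cf09f0c02d0ac12c03cf0bf0df0712cf0a0b4f07f040d888cf02f0cf05622,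
   0xf01f0af0305c854017c0cf0c06cf04f0b01df0cf0109c81a04781cf02f0b81c055f07f03f0b10709601ef0cf0b81c858f0910df0cf03f0b85881cf05f0b88c06cf02f0bf0408d1c802742982af0af0402ef0c426f04f0188948cf0b074f05017,
   0x944f05942f0bf04944f07f0303502df0bf02a44f01245f01f0701d41cf07415f0502df0c01ef06f0df04509d02d08c22826f07f0242af09f0303342cf02f0542cf02f05f0a468027909f08f05864f06c21f03f0b807129f02f0b02e0e8f0303c,
   0x6cf02f0808df08f0a44a446868942f09f0589805cf01f0af02506854f09416017f0514601ef09f0c01ef05f0c01701ef0cf09407f0c10ef09f0c017609f0284510df0bf02f01845606f05145f04149f0bf0cf0284582c90c81c948f05a0c099,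
   0x2b44a446f0bf09c60f03f01cc044a446f0bf09f03419f08f03027e01d01c42f06f02f09e08f07f0be01e02f01f03f03f059440c9509f05185f03f05d04f04f0301750cb40a0cf0cf04446f0b0c9819f04f05f0804ef01f0944a50cf0bf06889,
   0x27f05f04063c06f0405cf04f0b503f09f0390c40750af02506f06909f0bf04506f04f05017a0c01e05cf09f0b05cf05f0a948f0bf02a0c948f0ba05505f0bf0706cf03f04948f0bf0294854821344af0405cf07f0544af0405cf07f0560ae40,
   0x48c88c01b08bf06f07143909f0bf02186909f0bf04f0294494820708bf0af0808bf0af0810710bf0bf06909f0bf0c08708ef0bf0af05f0c02d0a30c34c4909f0bf06f05909f0bf0448c0a5f0bf0af0b01d01701ef0b819f0af0801ef0af09407,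
   0x486f09f0608bf08f080170c9f05f0c0c9f03f0c88c01701b08b10ef0cf0b189f0af0c01ef0bf0880e10ef0cf07189f01f0c88308b988f0bf08f0c8c4f06f0210ef0bf0c02748c485f06f0a01df01f0701d01ef08f09065509f0bf05f01f0b08d,
   0xf0c44af04f0384608d48c10b20b80ba0385101701e05cf0bf0580ef05f0401b419f0bf05509f0ba09f03f089094c4f07f0a819113f07f09889f03a09f0bf04189f08f0bf0980ef03189f09f0b4c80ca588542f080a3f0af09189f01f0c446017,
   0xf01f08f020a5f04f0a01d08d0acf07f02889f0cf0102706cf07f0cf0b10705c42c88508b88918cf06f09f07f09f08f0b04ef07f0c81ca81305f04f03f0302ef05f07f0b88c81941cf03f0c825468f05f0782c829f0bf01509f0bf0580780ef04,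
   0x2d48c8464c8c48468047f0720d115819f024a4f04f09f07f0444a02b446f03f0544606af05f04f0380b08bf0cf01f08c0a2134c488cf05f08f054c488cf05f08f050a544608ef06f0344af05f0c446509f0bf07f0288c01708d4a408ef07407,
   0xf0a48c099f04f0901ef0af0406cf05f0b94890601744a047f0bf04f0444a944443f0cf06f03f04093c82849f0cf05849f0cf05c82849f0cf05849f0cf04d04087849f0cf03f0101b44af0781af07f0208df0444af08942f0bf0580dc0950c10d,
   0xa919108df050c5f0748c485f05f06f0414a88c90af07f06f0c19419810b087183f0788c50cf05f0bf0c08df0a02df07f0203348c4c402bf09f06f09143f0b88c02bf0af07f0c09c01df0cf0311c10ef0788cf03f0cf02119f0310e05af01f05,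
   0x1b207419f098c8059f02f0441cf04f014c4489f0c41c01d01ef0af0cf09f03f0580b1894c404b21a81a01ef0c889f03f02f09f09f07f07f02f07207a03f03f0180b889f01f07f06189087c81849f0cf0218648cf06f0bf0248c08df03f0af01,
   0x11cf07f0c458506f0af039185c0506f0ac84f01f09506f0a5a0f0490c05cf0cf05f01506f0a05cf0cf09458f0703c54402b429f07f0a06904bf05f0b0e181c09cf06f0114af01f0b468f0590cf06864f01f03807f03f0901ef0bf09c0908b20b,
   0x59f040ccf03f03454f07c48f0452801b438f03518426f0bf02f04099489509f01f0cf07c09f09f0b0b8506f0af08f0210e518017c09c03f03f03506f0cf08807c03f09407f09f0cc06f01f0a09c80708b506f0c498f0cf0804bf05f01506f0a,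
   0x622f08f07f05612f02702f08f0809c093f07f03053912f02f0860af0348af05f09183f05189f08f0709303cf09f0903cf09f0458842c0274a4f01426f0bf0b506f0a42a423f08f090ccf04f0b464446f0742af0bf0a45844af0742af0cf0b09c,
   0x80e42af0c407f0bf0cf07f04c4420742cf0af0af0ac81f0588503581c80df06f0b425f0bf04f0101781cc06f0bf04c06f0bf0481cc06f0bf0101df0af0201e41a42ac2842cf04f01522f08c88093813f05183f08f0742cf0cf08603f06815512,
   0xf0505c063f08f07854548544f0bf0442cf07509f02f0601704ef01f0cf0150ac0a099f07468f08f01506423c4402744af0cf0a20742cf0af0af0a46246411345404ef01f0cf01468f01f0b434f0386442af0cf08087606426f0cf08d08f06f0a,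
   0xc03f03f0a04ef07f0c04ef0bf0c01e02742af04f0a017438f09f0cf0618502e04e01df0cf0af0c02df0df02069f0708e04ef0af0cf0750c94810d017047149f05f06509f0b02d056f02f05f0bc05f01047f0bf0706cf0380d04ef01f0c02ef02,
   0x4ef04f0cf0c44af07f0c033426f0410ef0ac88f04f01426f0404e948f05f03f0c41c42c02e03c10701ef07f0301e09cf0a02df08f0d42af09f0b03342af0af0681cf06f030cc50c14cf09a0cf08f08063423c09c03f05f0bf0706af05f01c09,
   0x40e40d04d44c84cc0c48c08e8c102788cf0cf034c4f02f09c4484a8c8f0af0c5c0f04f05c03f02f0c4c414c01744a446f0af09f0244a446f0af09f0308b44af09f0642c40702ef0504ef0bf0cf01f01462f0514c21344a04ef04f0cf0c12344a]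

/-- A case distinction on the signs that leads to the batches refuted below. -/
noncomputable def cert : Cert := decode certData []

theorem batchesLt_cert : batchesLt 13 cert = true := by decide +kernel

set_option maxHeartbeats 0 in
/-- Each of the batches is refuted by simultaneous propagation in all of its lanes. -/
theorem check_cert :
    check cert 0 577 2770 = true ∧
    check cert 1 583 2742 = true ∧
    check cert 2 596 2682 = true ∧
    check cert 3 624 2561 = true ∧
    check cert 4 644 2481 = true ∧
    check cert 5 695 2301 = true ∧
    check cert 6 717 2231 = true ∧
    check cert 7 783 2041 = true ∧
    check cert 8 894 1789 = true ∧
    check cert 9 1055 1516 = true ∧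
    check cert 10 1290 1240 = true ∧
    check cert 11 2040 784 = true ∧
    check cert 12 837 225 = true := by
  and_intros <;> decide +kernel

/-- No acyclic uniform rank-4 chirotope on {1,…,12} is admissible for ℳ = 2_12_1_1 ∖ {{1,2,3}}. -/
theorem no_chirotope_2_12_1_1_minus_triangle :
    ¬ ∃ χ : ℕ → ℕ → ℕ → ℕ → ℤ,
      IsChirotope (Finset.Icc 1 12) χ ∧ IsAcyclic (Finset.Icc 1 12) χ ∧
        IsAdmissible facetsM χ := by
  rintro ⟨χ, h, ha, hadm⟩
  have hr := h.realizable ha hadm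
  obtain ⟨b, hb, ℓ, hℓ⟩ := exists_reachesLane (X := signsOf χ) batchesLt_cert
  obtain ⟨h0, h1, h2, h3, h4, h5, h6, h7, h8, h9, h10, h11, h12⟩ := check_cert
  interval_cases b
  · exact Bool.false_ne_true ((hr.check_eq_false hℓ).symm.trans h0)
  · exact Bool.false_ne_true ((hr.check_eq_false hℓ).symm.trans h1)
  · exact Bool.false_ne_true ((hr.check_eq_false hℓ).symm.trans h2)
  · exact Bool.false_ne_true ((hr.check_eq_false hℓ).symm.trans h3)
  · exact Bool.false_ne_true ((hr.check_eq_false hℓ).symm.trans h4)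
  · exact Bool.false_ne_true ((hr.check_eq_false hℓ).symm.trans h5)
  · exact Bool.false_ne_true ((hr.check_eq_false hℓ).symm.trans h6)
  · exact Bool.false_ne_true ((hr.check_eq_false hℓ).symm.trans h7)
  · exact Bool.false_ne_true ((hr.check_eq_false hℓ).symm.trans h8)
  · exact Bool.false_ne_true ((hr.check_eq_false hℓ).symm.trans h9)
  · exact Bool.false_ne_true ((hr.check_eq_false hℓ).symm.trans h10)
  · exact Bool.false_ne_true ((hr.check_eq_false hℓ).symm.trans h11)
  · exact Bool.false_ne_true ((hr.check_eq_false hℓ).symm.trans h12)
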